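/- Let S_n be the size of the G-trie built from n i.i.d. random labelings of the infinite rooted M-ary tree. Then the variance Var(S_n) is strictly positive for all sufficiently large n, and the normalized size (S_n - E(S_n))/sqrt(Var(S_n)) converges in distribution, as n → ∞, to the standard normal distribution N(0,1). -/

import Mathlib

open MeasureTheory ProbabilityTheory Filter Topology

/-- A word `w` over `{1,…,M}×{1,…,A}` occurs in the labeling `L` of the infinite rooted
`M`-ary tree (nodes are identified with words over `Fin M`; the value of `L` on the root `[]`
is irrelevant) if along the path determined by the first components the labels are the
second components. -/
def Occurs {M A : ℕ} (L : List (Fin M) → Fin A) (w : List (Fin M × Fin A)) : Prop :=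
  ∀ t : Fin w.length, L ((w.take (t.1 + 1)).map Prod.fst) = (w.get t).2

/-- The number of labelings among `Ls` in which the word `w` occurs. -/
noncomputable def occCount {M A n : ℕ} (Ls : Fin n → List (Fin M) → Fin A)
    (w : List (Fin M × Fin A)) : ℕ :=
  Nat.card {i : Fin n // Occurs (Ls i) w}

/-- The G-trie built from the labelings `Ls`: all words occurring in at least two of them. -/
def GTrie {M A n : ℕ} (Ls : Fin n → List (Fin M) → Fin A) : Set (List (Fin M × Fin A)) :=
  {w | 2 ≤ occCount Ls w}

/-- The size of the G-trie built from the labelings `Ls` (as a real number). -/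
noncomputable def gtrieSize {M A n : ℕ} (Ls : Fin n → List (Fin M) → Fin A) : ℝ :=
  (GTrie Ls).ncard

/-- `μL` is the distribution of a random labeling of the infinite rooted `M`-ary tree where
all labels are independent with `P(letter = j) = p j`: every finite cylinder set has the
product probability. -/
def IsLabelingMeasure {M A : ℕ} (p : Fin A → ℝ) (μL : Measure (List (Fin M) → Fin A)) : Prop :=
  ∀ (s : Finset (List (Fin M))) (f : List (Fin M) → Fin A),
    μL {L | ∀ w ∈ s, L w = f w} = ∏ w ∈ s, ENNReal.ofReal (p (f w))


open Filter Topology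

/-- Expectation of `F (N_1,…,N_A)` under the multinomial distribution. -/
noncomputable def Ex {A : ℕ} {E : Type} [AddCommGroup E] [Module ℝ E] (p : Fin A → ℝ) :
    ℕ → ((Fin A → ℕ) → E) → E
  | 0, F => F 0
  | n + 1, F => Ex p n (fun N => ∑ a, p a • F (N + Pi.single a 1))

section ExBasic
variable {A : ℕ} {E : Type} [AddCommGroup E] [Module ℝ E] {p : Fin A → ℝ}

lemma Ex_succ (n : ℕ) (F : (Fin A → ℕ) → E) :
    Ex p (n + 1) F = Ex p n (fun N => ∑ a, p a • F (N + Pi.single a 1)) := rfl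

lemma Ex_congr {n : ℕ} {F G : (Fin A → ℕ) → E} (h : ∀ N, ∑ a, N a = n → F N = G N) :
    Ex p n F = Ex p n G := by
  induction n generalizing F G with
  | zero => exact h 0 (by simp)
  | succ n ih =>
    rw [Ex_succ, Ex_succ]
    refine ih fun N hN => Finset.sum_congr rfl fun a _ => ?_
    rw [h]
    simp [Finset.sum_add_distrib, hN]

lemma Ex_add (n : ℕ) (F G : (Fin A → ℕ) → E) :
    Ex p n (fun N => F N + G N) = Ex p n F + Ex p n G := by
  induction n generalizing F G with
  | zero => rfl
  | succ n ih =>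
    simp only [Ex_succ, smul_add, Finset.sum_add_distrib]
    rw [← ih]

lemma Ex_smul (n : ℕ) (c : ℝ) (F : (Fin A → ℕ) → E) :
    Ex p n (fun N => c • F N) = c • Ex p n F := by
  induction n generalizing F with
  | zero => rfl
  | succ n ih =>
    simp only [Ex_succ]
    rw [← ih]
    congr 1
    funext N
    rw [Finset.smul_sum]
    exact Finset.sum_congr rfl fun a _ => smul_comm _ _ _

lemma Ex_neg (n : ℕ) (F : (Fin A → ℕ) → E) : Ex p n (fun N => - F N) = - Ex p n F := by
  have := Ex_smul (p := p) n (-1) F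
  simpa using this

lemma Ex_sub (n : ℕ) (F G : (Fin A → ℕ) → E) :
    Ex p n (fun N => F N - G N) = Ex p n F - Ex p n G := by
  simp only [sub_eq_add_neg, Ex_add, Ex_neg]

lemma Ex_zero' (n : ℕ) : Ex p n (fun _ => (0 : E)) = 0 := by
  have := Ex_smul (p := p) n 0 (fun _ => (0 : E))
  simpa using this

lemma Ex_sum {ι : Type} (n : ℕ) (s : Finset ι) (F : ι → (Fin A → ℕ) → E) :
    Ex p n (fun N => ∑ i ∈ s, F i N) = ∑ i ∈ s, Ex p n (F i) := by
  classical
  induction s using Finset.induction_on with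
  | empty => simp [Ex_zero']
  | insert i s hi ih => simp only [Finset.sum_insert hi, Ex_add, ih]

lemma Ex_const (hp : ∑ a, p a = 1) (n : ℕ) (c : E) : Ex p n (fun _ => c) = c := by
  induction n with
  | zero => rfl
  | succ n ih => simp only [Ex_succ, ← Finset.sum_smul, hp, one_smul, ih]

lemma cnt_cons {n : ℕ} (a b : Fin A) (ℓ : Fin n → Fin A) :
    Fintype.card {i // (Fin.cons a ℓ : Fin (n + 1) → Fin A) i = b} =
      (Pi.single a 1 : Fin A → ℕ) b + Fintype.card {i // ℓ i = b} := by
  simp only [Fintype.card_subtype, Finset.card_filter, Fin.sum_univ_succ, Fin.cons_zero,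
    Fin.cons_succ]
  congr 1
  by_cases h : a = b
  · subst h; simp
  · simp [h, Ne.symm h]

lemma Ex_eq_sum (n : ℕ) (F : (Fin A → ℕ) → E) :
    Ex p n F = ∑ ℓ : Fin n → Fin A, (∏ i, p (ℓ i)) • F (fun a => Fintype.card {i // ℓ i = a}) := by
  induction n generalizing F with
  | zero =>
    simp only [Ex, Finset.univ_unique, Finset.univ_eq_empty, Finset.prod_empty, one_smul,
      Finset.sum_singleton]
    congr 1
  | succ n ih =>
    rw [Ex_succ, ih]
    simp_rw [Finset.smul_sum]
    rw [Finset.sum_comm, ← Fintype.sum_prod_type']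
    refine Fintype.sum_equiv (Fin.consEquiv (fun _ => Fin A)) _ _ ?_
    rintro ⟨a, ℓ⟩
    have hc : (Fin.consEquiv (fun _ => Fin A)) (a, ℓ) = (Fin.cons a ℓ : Fin (n + 1) → Fin A) := rfl
    rw [hc]
    simp only [Fin.prod_univ_succ, Fin.cons_zero, Fin.cons_succ]
    rw [smul_smul, mul_comm]
    congr 2
    funext b
    rw [Pi.add_apply, cnt_cons, add_comm]

end ExBasic

section ExReal
variable {A : ℕ} {p : Fin A → ℝ}

lemma Ex_mono (hp0 : ∀ a, 0 ≤ p a) {n : ℕ} {F G : (Fin A → ℕ) → ℝ}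
    (h : ∀ N, ∑ a, N a = n → F N ≤ G N) : Ex p n F ≤ Ex p n G := by
  induction n generalizing F G with
  | zero => exact h 0 (by simp)
  | succ n ih =>
    rw [Ex_succ, Ex_succ]
    refine ih fun N hN => Finset.sum_le_sum fun a _ => ?_
    refine mul_le_mul_of_nonneg_left (h _ ?_) (hp0 a)
    simp [Finset.sum_add_distrib, hN]

lemma Ex_nonneg (hp0 : ∀ a, 0 ≤ p a) {n : ℕ} {F : (Fin A → ℕ) → ℝ}
    (h : ∀ N, ∑ a, N a = n → 0 ≤ F N) : 0 ≤ Ex p n F := by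
  rw [← Ex_zero' (p := p) n]
  exact Ex_mono hp0 h

lemma Ex_mul (n : ℕ) (c : ℝ) (F : (Fin A → ℕ) → ℝ) :
    Ex p n (fun N => c * F N) = c * Ex p n F := Ex_smul n c F

lemma Ex_mul' (n : ℕ) (c : ℝ) (F : (Fin A → ℕ) → ℝ) :
    Ex p n (fun N => F N * c) = Ex p n F * c := by
  simp_rw [mul_comm _ c]; exact Ex_mul n c F

lemma norm_Ex_le (hp0 : ∀ a, 0 ≤ p a) (n : ℕ) {E : Type} [NormedAddCommGroup E] [NormedSpace ℝ E]
    (F : (Fin A → ℕ) → E) : ‖Ex p n F‖ ≤ Ex p n (fun N => ‖F N‖) := by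
  induction n generalizing F with
  | zero => exact le_rfl
  | succ n ih =>
    rw [Ex_succ, Ex_succ]
    refine (ih _).trans (Ex_mono hp0 fun N _ => ?_)
    refine (norm_sum_le _ _).trans (Finset.sum_le_sum fun a _ => ?_)
    rw [norm_smul, Real.norm_of_nonneg (hp0 a), smul_eq_mul]

lemma abs_Ex_le (hp0 : ∀ a, 0 ≤ p a) (n : ℕ) 
    (F : (Fin A → ℕ) → ℝ) : |Ex p n F| ≤ Ex p n (fun N => |F N|) := norm_Ex_le hp0 n F

/-- Cauchy–Schwarz -/
lemma Ex_cs (hp0 : ∀ a, 0 ≤ p a) (n : ℕ) (F G : (Fin A → ℕ) → ℝ) :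
    Ex p n (fun N => F N * G N) ^ 2 ≤ Ex p n (fun N => F N ^ 2) * Ex p n (fun N => G N ^ 2) := by
  simp only [Ex_eq_sum, smul_eq_mul]
  have hw : ∀ ℓ : Fin n → Fin A, 0 ≤ ∏ i, p (ℓ i) := fun ℓ => Finset.prod_nonneg fun i _ => hp0 _
  refine Finset.sum_sq_le_sum_mul_sum_of_sq_le_mul _ (fun ℓ _ => ?_) (fun ℓ _ => ?_) (fun ℓ _ => ?_)
  · have := hw ℓ; positivity
  · have := hw ℓ; positivity
  · exact le_of_eq (by ring)

lemma Ex_abs_mul_le (hp0 : ∀ a, 0 ≤ p a) (n : ℕ) (F G : (Fin A → ℕ) → ℝ) :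
    Ex p n (fun N => |F N| * |G N|) ≤
      √(Ex p n (fun N => F N ^ 2)) * √(Ex p n (fun N => G N ^ 2)) := by
  rw [← Real.sqrt_mul (Ex_nonneg hp0 fun N _ => sq_nonneg _)]
  refine Real.le_sqrt_of_sq_le ?_
  have := Ex_cs hp0 n (fun N => |F N|) (fun N => |G N|)
  simpa only [sq_abs] using this

lemma Ex_abs_le_sqrt (hp0 : ∀ a, 0 ≤ p a) (hp : ∑ a, p a = 1) (n : ℕ) (F : (Fin A → ℕ) → ℝ) :
    Ex p n (fun N => |F N|) ≤ √(Ex p n (fun N => F N ^ 2)) := by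
  have := Ex_abs_mul_le hp0 n F (fun _ => 1)
  simpa [Ex_const hp] using this

lemma Ex_sq_le (hp0 : ∀ a, 0 ≤ p a) (hp : ∑ a, p a = 1) (n : ℕ) (F : (Fin A → ℕ) → ℝ) :
    Ex p n F ^ 2 ≤ Ex p n (fun N => F N ^ 2) := by
  have := Ex_cs hp0 n F (fun _ => 1)
  simpa [Ex_const hp] using this

/-- Jensen for powers -/
lemma Ex_rpow_le (hp0 : ∀ a, 0 ≤ p a) (hp : ∑ a, p a = 1) (n : ℕ) (F : (Fin A → ℕ) → ℝ)
    (hF : ∀ N, 0 ≤ F N) {r : ℝ} (hr : 1 ≤ r) :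
    Ex p n F ^ r ≤ Ex p n (fun N => F N ^ r) := by
  have h1 := Ex_const (E := ℝ) hp n 1
  simp only [Ex_eq_sum, smul_eq_mul, mul_one] at h1 ⊢
  exact Real.rpow_arith_mean_le_arith_mean_rpow _ _ _
    (fun ℓ _ => Finset.prod_nonneg fun i _ => hp0 _) h1 (fun ℓ _ => hF _) hr

/-- Jensen for concave powers -/
lemma Ex_rpow_ge (hp0 : ∀ a, 0 ≤ p a) (hp : ∑ a, p a = 1) (n : ℕ) (F : (Fin A → ℕ) → ℝ)
    (hF : ∀ N, 0 ≤ F N) {r : ℝ} (hr0 : 0 < r) (hr : r ≤ 1) :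
    Ex p n (fun N => F N ^ r) ≤ Ex p n F ^ r := by
  have := Ex_rpow_le hp0 hp n (fun N => F N ^ r) (fun N => Real.rpow_nonneg (hF N) r)
    (r := 1 / r) (by rw [le_div_iff₀ hr0]; simpa using hr)
  have h2 : (fun N => (F N ^ r) ^ (1 / r)) = F := by
    funext N; rw [← Real.rpow_mul (hF N), mul_one_div_cancel hr0.ne', Real.rpow_one]
  rw [h2] at this
  have h0 : 0 ≤ Ex p n (fun N => F N ^ r) := Ex_nonneg hp0 fun N _ => Real.rpow_nonneg (hF N) r
  have h3 := Real.rpow_le_rpow (Real.rpow_nonneg h0 _) this hr0.le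
  rwa [← Real.rpow_mul h0, one_div_mul_cancel hr0.ne', Real.rpow_one] at h3

/-- Hölder -/
lemma Ex_holder (hp0 : ∀ a, 0 ≤ p a) (n : ℕ) (F G : (Fin A → ℕ) → ℝ)
    (hF : ∀ N, 0 ≤ F N) (hG : ∀ N, 0 ≤ G N) {r s : ℝ} (h : r.HolderConjugate s) :
    Ex p n (fun N => F N * G N) ≤
      Ex p n (fun N => F N ^ r) ^ (1 / r) * Ex p n (fun N => G N ^ s) ^ (1 / s) := by
  simp only [Ex_eq_sum, smul_eq_mul]
  have hw : ∀ ℓ : Fin n → Fin A, 0 ≤ ∏ i, p (ℓ i) := fun ℓ => Finset.prod_nonneg fun i _ => hp0 _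
  set c : (Fin n → Fin A) → (Fin A → ℕ) := fun ℓ a => Fintype.card {i // ℓ i = a}
  set w : (Fin n → Fin A) → ℝ := fun ℓ => ∏ i, p (ℓ i)
  have := Real.inner_le_Lp_mul_Lq_of_nonneg Finset.univ (f := fun ℓ => w ℓ ^ (1 / r) * F (c ℓ))
    (g := fun ℓ => w ℓ ^ (1 / s) * G (c ℓ)) h
    (fun ℓ _ => mul_nonneg (Real.rpow_nonneg (hw ℓ) _) (hF _))
    (fun ℓ _ => mul_nonneg (Real.rpow_nonneg (hw ℓ) _) (hG _))
  have hr : 0 < r := h.pos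
  have hs : 0 < s := h.symm.pos
  have e1 : ∀ ℓ, (w ℓ ^ (1 / r) * F (c ℓ)) ^ r = w ℓ * F (c ℓ) ^ r := by
    intro ℓ
    rw [Real.mul_rpow (Real.rpow_nonneg (hw ℓ) _) (hF _), ← Real.rpow_mul (hw ℓ),
      one_div_mul_cancel hr.ne', Real.rpow_one]
  have e2 : ∀ ℓ, (w ℓ ^ (1 / s) * G (c ℓ)) ^ s = w ℓ * G (c ℓ) ^ s := by
    intro ℓ
    rw [Real.mul_rpow (Real.rpow_nonneg (hw ℓ) _) (hG _), ← Real.rpow_mul (hw ℓ),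
      one_div_mul_cancel hs.ne', Real.rpow_one]
  have e3 : ∀ ℓ, w ℓ ^ (1 / r) * F (c ℓ) * (w ℓ ^ (1 / s) * G (c ℓ)) = w ℓ * (F (c ℓ) * G (c ℓ)) := by
    intro ℓ
    have : w ℓ ^ (1 / r) * w ℓ ^ (1 / s) = w ℓ := by
      rw [← Real.rpow_add_of_nonneg (hw ℓ) (by positivity) (by positivity)]
      have := h.inv_add_inv_eq_one
      rw [one_div, one_div, this, Real.rpow_one]
    calc _ = (w ℓ ^ (1 / r) * w ℓ ^ (1 / s)) * (F (c ℓ) * G (c ℓ)) := by ring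
      _ = _ := by rw [this]
  simp_rw [e1, e2, e3] at this
  exact this

/-- variance under the multinomial distribution -/
noncomputable def Vx (p : Fin A → ℝ) (n : ℕ) (F : (Fin A → ℕ) → ℝ) : ℝ :=
  Ex p n (fun N => (F N - Ex p n F) ^ 2)

lemma Vx_eq (hp : ∑ a, p a = 1) (n : ℕ) (F : (Fin A → ℕ) → ℝ) :
    Vx p n F = Ex p n (fun N => F N ^ 2) - Ex p n F ^ 2 := by
  unfold Vx
  have : (fun N => (F N - Ex p n F) ^ 2) =
      fun N => (F N ^ 2 - (2 * Ex p n F) * F N) + Ex p n F ^ 2 := by funext N; ring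
  rw [this, Ex_add, Ex_sub, Ex_mul, Ex_const hp]
  ring

lemma Vx_nonneg (hp0 : ∀ a, 0 ≤ p a) (n : ℕ) (F : (Fin A → ℕ) → ℝ) : 0 ≤ Vx p n F :=
  Ex_nonneg hp0 fun N _ => sq_nonneg _

lemma Vx_le (hp : ∑ a, p a = 1) (n : ℕ) (F : (Fin A → ℕ) → ℝ) (c : ℝ) :
    Vx p n F ≤ Ex p n (fun N => (F N - c) ^ 2) := by
  have : (fun N => (F N - c) ^ 2) =
      fun N => (F N ^ 2 - (2 * c) * F N) + c ^ 2 := by funext N; ring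
  rw [Vx_eq hp, this, Ex_add, Ex_sub, Ex_mul, Ex_const hp]
  nlinarith [sq_nonneg (Ex p n F - c)]

/-- One-step variance decomposition -/
lemma Vx_succ (hp : ∑ a, p a = 1) (n : ℕ) (F : (Fin A → ℕ) → ℝ) :
    Vx p (n + 1) F = Ex p n (fun N => ∑ a, p a * (F (N + Pi.single a 1)
      - ∑ b, p b * F (N + Pi.single b 1)) ^ 2)
      + Vx p n (fun N => ∑ a, p a * F (N + Pi.single a 1)) := by
  rw [Vx_eq hp, Vx_eq hp, Ex_succ, Ex_succ]
  simp only [smul_eq_mul]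
  have : ∀ N : Fin A → ℕ, ∑ a, p a * (F (N + Pi.single a 1)
      - ∑ b, p b * F (N + Pi.single b 1)) ^ 2 = ∑ a, p a * F (N + Pi.single a 1) ^ 2
        - (∑ b, p b * F (N + Pi.single b 1)) ^ 2 := by
    intro N
    set c := ∑ b, p b * F (N + Pi.single b 1)
    have : ∀ a, p a * (F (N + Pi.single a 1) - c) ^ 2 = p a * F (N + Pi.single a 1) ^ 2
      - 2 * c * (p a * F (N + Pi.single a 1)) + c ^ 2 * p a := by intro a; ring
    simp_rw [this, Finset.sum_add_distrib, Finset.sum_sub_distrib, ← Finset.mul_sum, hp]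
    ring
  simp_rw [this, Ex_sub]
  ring

/-- variance lower bound -/
lemma Vx_ge (hp0 : ∀ a, 0 ≤ p a) (hp : ∑ a, p a = 1) (n : ℕ) (F : (Fin A → ℕ) → ℝ) :
    ((n : ℝ) + 1) * ∑ a, p a * (Ex p n (fun N => F (N + Pi.single a 1)) - Ex p (n + 1) F) ^ 2
      ≤ Vx p (n + 1) F := by
  have base : ∀ (n : ℕ) (F : (Fin A → ℕ) → ℝ), 
      ∑ a, p a * (Ex p n (fun N => F (N + Pi.single a 1)) - Ex p (n + 1) F) ^ 2 ≤
      Ex p n (fun N => ∑ a, p a * (F (N + Pi.single a 1)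
      - ∑ b, p b * F (N + Pi.single b 1)) ^ 2) := by
    intro n F
    rw [Ex_sum]
    refine Finset.sum_le_sum fun a _ => ?_
    rw [Ex_mul]
    refine mul_le_mul_of_nonneg_left ?_ (hp0 a)
    have h := Ex_sq_le hp0 hp n (fun N => F (N + Pi.single a 1) - ∑ b, p b * F (N + Pi.single b 1))
    rw [Ex_sub] at h
    exact h
  induction n generalizing F with
  | zero =>
    rw [Vx_succ hp]
    have := base 0 F
    have h2 := Vx_nonneg hp0 0 (fun N => ∑ a, p a * F (N + Pi.single a 1))
    simp only [Nat.cast_zero, zero_add, one_mul] at *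
    linarith
  | succ n ih =>
    rw [Vx_succ hp]
    have h1 := base (n + 1) F
    have h2 := ih (fun N => ∑ a, p a * F (N + Pi.single a 1))
    have h3 : ∀ a, Ex p n (fun N => ∑ b, p b * F (N + Pi.single a 1 + Pi.single b 1)) =
        Ex p (n + 1) (fun N => F (N + Pi.single a 1)) := by
      intro a
      rw [Ex_succ]
      simp only [smul_eq_mul]
      congr 1; funext N
      refine Finset.sum_congr rfl fun b _ => ?_
      rw [add_right_comm]
    simp_rw [h3] at h2
    have h4 : Ex p (n + 1) (fun N => ∑ a, p a * F (N + Pi.single a 1)) = Ex p (n + 1 + 1) F := by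
      rw [Ex_succ (n + 1)]; simp
    rw [h4] at h2
    push_cast
    nlinarith

end ExReal

open Filter Topology

section
variable {A : ℕ} {p : Fin A → ℝ}

lemma le_of_sum_eq {N : Fin A → ℕ} {n : ℕ} (h : ∑ a, N a = n) (a : Fin A) : N a ≤ n :=
  h ▸ Finset.single_le_sum (f := N) (fun _ _ => Nat.zero_le _) (Finset.mem_univ a)

lemma Ex_top (n : ℕ) (a : Fin A) :
    Ex p n (fun N => if N a = n then (1 : ℝ) else 0) = p a ^ n := by
  induction n with
  | zero => simp [Ex]
  | succ n ih =>
    rw [Ex_succ, pow_succ, ← ih, ← Ex_mul']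
    refine Ex_congr fun N hN => ?_
    rw [Finset.sum_eq_single a]
    · simp [mul_comm]
    · intro b _ hb
      have := le_of_sum_eq hN a
      have h2 : (N + Pi.single b 1 : Fin A → ℕ) a = N a := by simp [hb.symm]
      rw [h2, if_neg (by omega)]; simp
    · simp

lemma Ex_top_le (hp0 : ∀ a, 0 ≤ p a) (hp : ∑ a, p a = 1) (n : ℕ) (a : Fin A) (f : ℕ → ℝ) (b : ℝ)
    (hb : 0 ≤ b) (hf : ∀ k < n, f k ≤ b) (hfn : 0 ≤ f n) :
    Ex p n (fun N => f (N a)) ≤ b + p a ^ n * f n := by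
  rw [← Ex_top, ← Ex_mul', ← Ex_const hp n b, ← Ex_add]
  refine Ex_mono hp0 fun N hN => ?_
  split_ifs with h
  · rw [h]; linarith
  · have := hf (N a) (lt_of_le_of_ne (le_of_sum_eq hN a) h)
    linarith

lemma sum_pow_le (hp0 : ∀ a, 0 ≤ p a) (hp : ∑ a, p a = 1) {n : ℕ} (hn : 2 ≤ n) :
    ∑ a, p a ^ n ≤ ∑ a, p a ^ 2 := by
  refine Finset.sum_le_sum fun a _ => pow_le_pow_of_le_one (hp0 a) ?_ hn
  rw [← hp]; exact Finset.single_le_sum (fun b _ => hp0 b) (Finset.mem_univ a)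

lemma rec_bdd (hp0 : ∀ a, 0 ≤ p a) (hp : ∑ a, p a = 1) {M : ℝ} (hM : 0 ≤ M)
    (hq : M * ∑ a, p a ^ 2 < 1)
    {x : ℕ → ℕ → ℝ} {T : ℕ → ℝ} (hx : ∀ K n, 0 ≤ x K n) (hx0 : ∀ n, x 0 n = 0)
    (hx1 : ∀ K n, n ≤ 1 → x K n = 0)
    (hrec : ∀ K n, 2 ≤ n → x (K + 1) n ≤ T n + M * Ex p n (fun N => ∑ a, x K (N a))) :
    ∃ B : ℕ → ℝ, ∀ K n, x K n ≤ B n := by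
  suffices h : ∀ n, ∃ B : ℝ, ∀ K, x K n ≤ B by
    choose B hB using h
    exact ⟨B, fun K n => hB n K⟩
  intro n
  induction n using Nat.strong_induction_on with
  | _ n ih =>
  by_cases hn : n ≤ 1
  · exact ⟨0, fun K => (hx1 K n hn).le⟩
  push Not at hn
  choose! B hB using ih
  set b := ∑ k ∈ Finset.range n, |B k| with hb
  have hb0 : 0 ≤ b := Finset.sum_nonneg fun _ _ => abs_nonneg _
  have hxb : ∀ K, ∀ k < n, x K k ≤ b := fun K k hk =>
    (hB k hk K).trans ((le_abs_self _).trans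
      (Finset.single_le_sum (f := fun k => |B k|) (fun _ _ => abs_nonneg _) (Finset.mem_range.2 hk)))
  set θ := M * ∑ a, p a ^ 2
  set c := |T n| + M * (A * b)
  have hc : 0 ≤ c := by positivity
  have hθ : 0 ≤ θ := mul_nonneg hM (Finset.sum_nonneg fun a _ => sq_nonneg _)
  refine ⟨c / (1 - θ), fun K => ?_⟩
  induction K with
  | zero => rw [hx0]; exact div_nonneg hc (by linarith)
  | succ K ihK =>
    refine (hrec K n hn).trans ?_
    rw [Ex_sum]
    have h1 : ∑ a, Ex p n (fun N => x K (N a)) ≤ ∑ a, (b + p a ^ n * x K n) :=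
      Finset.sum_le_sum fun a _ => Ex_top_le hp0 hp n a _ b hb0 (hxb K) (hx K n)
    rw [Finset.sum_add_distrib, ← Finset.sum_mul] at h1
    have h2 := mul_le_mul_of_nonneg_right (sum_pow_le hp0 hp hn) (hx K n)
    simp only [Finset.sum_const, Finset.card_univ, Fintype.card_fin, nsmul_eq_mul] at h1
    have h3 : M * ∑ a, Ex p n (fun N => x K (N a)) ≤ M * (A * b) + θ * x K n := by
      have := mul_le_mul_of_nonneg_left (h1.trans (add_le_add_right h2 _)) hM
      calc _ ≤ _ := this
        _ = _ := by simp only [θ]; ring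
    have h4 := mul_le_mul_of_nonneg_left ihK hθ
    have h5 : c + θ * (c / (1 - θ)) = c / (1 - θ) := by
      have : 1 - θ ≠ 0 := by linarith
      field_simp; ring
    have := le_abs_self (T n)
    simp only [c] at *
    linarith

lemma tendsto_Ex {E : Type} [NormedAddCommGroup E] [NormedSpace ℝ E] (n : ℕ)
    {F : ℕ → (Fin A → ℕ) → E} {G : (Fin A → ℕ) → E}
    (h : ∀ N, Tendsto (fun K => F K N) atTop (𝓝 (G N))) :
    Tendsto (fun K => Ex p n (F K)) atTop (𝓝 (Ex p n G)) := by
  simp only [Ex_eq_sum]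
  exact tendsto_finsetSum _ fun ℓ _ => (h _).const_smul _

end

open MeasureTheory ProbabilityTheory Filter Topology

/-- Occurrence of a word in a labeling of the non-root nodes `(m, u) ~ m :: u`. -/
def gOcc {M A : ℕ} : (Fin M × List (Fin M) → Fin A) → List (Fin M × Fin A) → Prop
  | _, [] => True
  | x, (m, a) :: w => x (m, []) = a ∧ gOcc (fun q => x (m, q.1 :: q.2)) w

lemma occurs_iff_gOcc {M A : ℕ} (w : List (Fin M × Fin A)) :
    ∀ L : List (Fin M) → Fin A, Occurs L w ↔ gOcc (fun q => L (q.1 :: q.2)) w := by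
  induction w with
  | nil => intro L; simp [Occurs, gOcc]
  | cons x w ih =>
    intro L
    obtain ⟨m, a⟩ := x
    simp only [gOcc]
    rw [← ih (fun u => L (m :: u))]
    unfold Occurs
    constructor
    · intro h
      refine ⟨by simpa using h ⟨0, by simp⟩, fun t => ?_⟩
      simpa using h ⟨t.1 + 1, by simp⟩
    · rintro ⟨h0, h⟩ ⟨t, ht⟩
      cases t with
      | zero => simpa using h0
      | succ t => simpa using h ⟨t, by simpa using ht⟩

lemma measurableSet_gOcc {M A : ℕ} (w : List (Fin M × Fin A)) :
    MeasurableSet {x : Fin M × List (Fin M) → Fin A | gOcc x w} := by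
  induction w with
  | nil => simp [gOcc]
  | cons x w ih =>
    obtain ⟨m, a⟩ := x
    simp only [gOcc, Set.ofPred_and]
    refine MeasurableSet.inter ?_ ?_
    · exact measurableSet_eq_fun (measurable_pi_apply _) measurable_const
    · have : Measurable (fun (x : Fin M × List (Fin M) → Fin A) (q : Fin M × List (Fin M)) =>
        x (m, q.1 :: q.2)) := by fun_prop
      exact this ih

/-- number of labelings in which the word occurs -/
noncomputable def gCnt {M A : ℕ} {ι : Type} (ω : ι × Fin M × List (Fin M) → Fin A)
    (w : List (Fin M × Fin A)) : ℕ := Nat.card {i : ι // gOcc (fun q => ω (i, q)) w}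

open Classical in
/-- number of words of length `< K` occurring at least twice -/
noncomputable def gSz {M A : ℕ} {ι : Type} (K : ℕ) (ω : ι × Fin M × List (Fin M) → Fin A) : ℝ :=
  ∑ k ∈ Finset.range K, ∑ w : Fin k → Fin M × Fin A,
    if 2 ≤ gCnt ω (List.ofFn w) then 1 else 0

open Classical in
lemma measurable_gCnt {M A : ℕ} {ι : Type} [Finite ι] (w : List (Fin M × Fin A)) :
    Measurable (fun ω : ι × Fin M × List (Fin M) → Fin A => gCnt ω w) := by
  have := Fintype.ofFinite ι
  unfold gCnt
  simp_rw [Nat.card_eq_fintype_card, Fintype.card_subtype, Finset.card_filter]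
  refine Finset.measurable_sum _ fun i _ => ?_
  refine Measurable.ite ?_ measurable_const measurable_const
  have : Measurable (fun (x : ι × Fin M × List (Fin M) → Fin A) (q : Fin M × List (Fin M)) =>
        x (i, q)) := by fun_prop
  exact this (measurableSet_gOcc w)

lemma measurable_gSz {M A : ℕ} {ι : Type} [Finite ι] (K : ℕ) :
    Measurable (fun ω : ι × Fin M × List (Fin M) → Fin A => gSz K ω) := by
  classical
  unfold gSz
  refine Finset.measurable_sum _ fun k _ => Finset.measurable_sum _ fun w _ => ?_
  refine Measurable.ite ?_ measurable_const measurable_const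
  exact (measurable_gCnt (List.ofFn w)) (measurableSet_Ici (a := 2))

lemma gSz_nonneg {M A : ℕ} {ι : Type} (K : ℕ) (ω : ι × Fin M × List (Fin M) → Fin A) :
    0 ≤ gSz K ω := by
  unfold gSz
  refine Finset.sum_nonneg fun k _ => Finset.sum_nonneg fun w _ => ?_
  split_ifs <;> simp

lemma gSz_le {M A : ℕ} (K : ℕ) : ∃ C : ℝ, ∀ {ι : Type} (ω : ι × Fin M × List (Fin M) → Fin A),
    gSz K ω ≤ C := by
  refine ⟨∑ k ∈ Finset.range K, ∑ w : Fin k → Fin M × Fin A, 1, fun ω => ?_⟩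
  unfold gSz
  refine Finset.sum_le_sum fun k _ => Finset.sum_le_sum fun w _ => ?_
  split_ifs <;> simp

/-- sub-labelings at child `m` of the labelings having letter `a` there -/
def gSub {M A : ℕ} {ι : Type} (m : Fin M) (I : ι → Prop)
    (ω : ι × Fin M × List (Fin M) → Fin A) : {i // I i} × Fin M × List (Fin M) → Fin A :=
  fun q => ω (q.1.1, m, q.2.1 :: q.2.2)

lemma gCnt_cons {M A : ℕ} {ι : Type} (ω : ι × Fin M × List (Fin M) → Fin A) (m : Fin M)
    (a : Fin A) (w : List (Fin M × Fin A)) :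
    gCnt ω ((m, a) :: w) = gCnt (gSub m (fun i => ω (i, m, []) = a) ω) w := by
  unfold gCnt
  simp only [gOcc]
  exact (Nat.card_congr (Equiv.subtypeSubtypeEquivSubtypeInter
    (fun i => ω (i, m, []) = a) (fun i => gOcc (fun q => ω (i, m, q.1 :: q.2)) w))).symm

lemma gSz_succ {M A : ℕ} {ι : Type} (hι : 2 ≤ Nat.card ι) (K : ℕ)
    (ω : ι × Fin M × List (Fin M) → Fin A) :
    gSz (K + 1) ω = 1 + ∑ m : Fin M, ∑ a : Fin A,
      gSz K (gSub m (fun i => ω (i, m, []) = a) ω) := by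
  classical
  unfold gSz
  rw [Finset.sum_range_succ', add_comm]
  congr 1
  · have : gCnt ω [] = Nat.card ι := by simp [gCnt, gOcc]
    simp [this, hι]
  · simp_rw [Finset.sum_comm (t := Finset.range K)]
    refine Finset.sum_congr rfl fun k _ => ?_
    rw [← Fintype.sum_prod_type' (fun m a => ∑ w : Fin k → Fin M × Fin A,
      if 2 ≤ gCnt (gSub m (fun i => ω (i, m, []) = a) ω) (List.ofFn w) then (1:ℝ) else 0),
      ← Fintype.sum_prod_type' (fun (x : Fin M × Fin A) w =>
      if 2 ≤ gCnt (gSub x.1 (fun i => ω (i, x.1, []) = x.2) ω) (List.ofFn w) then (1:ℝ) else 0)]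
    refine (Fintype.sum_equiv (Fin.consEquiv (fun _ => Fin M × Fin A)) _ _ fun x => ?_).symm
    obtain ⟨⟨m, a⟩, w⟩ := x
    simp [Fin.consEquiv, List.ofFn_succ, gCnt_cons]

lemma gSz_small {M A : ℕ} {ι : Type} [Finite ι] (hι : Nat.card ι ≤ 1) (K : ℕ)
    (ω : ι × Fin M × List (Fin M) → Fin A) : gSz K ω = 0 := by
  classical
  unfold gSz
  refine Finset.sum_eq_zero fun k _ => Finset.sum_eq_zero fun w _ => ?_
  have : gCnt ω (List.ofFn w) ≤ Nat.card ι := by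
    unfold gCnt; exact Nat.card_le_card_of_injective _ Subtype.val_injective
  rw [if_neg (by omega)]

open MeasureTheory ProbabilityTheory Filter Topology

lemma map_blocks {A : ℕ} (P : Measure (Fin A)) [IsProbabilityMeasure P] {J α : Type} [Fintype J]
    {X : J → Type} {E : J → Type} [∀ j, MeasurableSpace (E j)] (f : (Σ j, X j) → α)
    (hf : Function.Injective f) (g : ∀ j, (X j → Fin A) → E j) (hg : ∀ j, Measurable (g j)) :
    (Measure.infinitePi (fun _ : α => P)).map (fun ω j => g j (fun x => ω (f ⟨j, x⟩))) =
      Measure.pi (fun j => (Measure.infinitePi (fun _ : X j => P)).map (g j)) := by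
  have h1 := Measure.map_infinitePi_infinitePi_of_inj (P := fun _ : α => P) hf
  have h2 := Measure.infinitePi_map_piCurry (fun (j : J) (_ : X j) => P)
  have h3 := Measure.infinitePi_map_pi (fun j : J => Measure.infinitePi (fun _ : X j => P)) hg
  have : ∀ j, IsProbabilityMeasure ((Measure.infinitePi (fun _ : X j => P)).map (g j)) :=
    fun j => Measure.isProbabilityMeasure_map (hg j).aemeasurable
  have hg' : Measurable (fun (x : ∀ j, X j → Fin A) (j : J) => g j (x j)) :=
    measurable_pi_lambda _ fun j => (hg j).comp (measurable_pi_apply j)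
  rw [← h2, ← h1, Measure.map_map hg' (by fun_prop),
    Measure.map_map (by fun_prop) (by fun_prop), 
    Measure.infinitePi_eq_pi (μ := fun j => (Measure.infinitePi (fun _ : X j => P)).map (g j))] at h3
  rw [← h3]
  rfl

lemma gSz_reindex {M A : ℕ} {ι κ : Type} (e : κ ≃ ι) (K : ℕ)
    (ω : ι × Fin M × List (Fin M) → Fin A) :
    gSz K (fun q : κ × Fin M × List (Fin M) => ω (e q.1, q.2)) = gSz K ω := by
  have : ∀ w, gCnt (fun q : κ × Fin M × List (Fin M) => ω (e q.1, q.2)) w = gCnt ω w := by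
    intro w
    unfold gCnt
    exact Nat.card_congr (e.subtypeEquiv (fun k => Iff.rfl))
  unfold gSz
  simp_rw [this]

/-- law of the truncated size -/
noncomputable def lawS {A : ℕ} (M : ℕ) (P : Measure (Fin A)) [IsProbabilityMeasure P] (K n : ℕ) :
    Measure ℝ :=
  (Measure.infinitePi (fun _ : Fin n × Fin M × List (Fin M) => P)).map (gSz K)

instance lawS_prob {A M : ℕ} (P : Measure (Fin A)) [IsProbabilityMeasure P] (K n : ℕ) :
    IsProbabilityMeasure (lawS M P K n) :=
  Measure.isProbabilityMeasure_map (measurable_gSz K).aemeasurable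

lemma lawS_reindex {A M : ℕ} (P : Measure (Fin A)) [IsProbabilityMeasure P] (K : ℕ)
    {ι : Type} [Fintype ι] :
    (Measure.infinitePi (fun _ : ι × Fin M × List (Fin M) => P)).map (gSz K)
      = lawS M P K (Fintype.card ι) := by
  unfold lawS
  let e := Fintype.equivFin ι
  have hinj : Function.Injective (fun q : ι × Fin M × List (Fin M) => (e q.1, q.2)) := by
    rintro ⟨a, b⟩ ⟨c, d⟩ h; simp_all
  have h1 := Measure.map_infinitePi_infinitePi_of_inj
    (P := fun _ : Fin (Fintype.card ι) × Fin M × List (Fin M) => P) hinj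
  rw [← h1, Measure.map_map (measurable_gSz K) (by fun_prop)]
  congr 1
  funext ω
  exact gSz_reindex e K ω

/-- sum of sizes of the sub-tries, given first letters `ℓ` -/
noncomputable def gT {M A : ℕ} {ι : Type} (K : ℕ) (ℓ : ι → Fin A)
    (ω : ι × Fin M × List (Fin M) → Fin A) : ℝ :=
  ∑ a, gSz K (fun q : {i // ℓ i = a} × Fin M × List (Fin M) => ω (q.1.1, q.2))

lemma measurable_gT {M A : ℕ} {ι : Type} [Finite ι] (K : ℕ) (ℓ : ι → Fin A) :
    Measurable (gT (M := M) K ℓ) := by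
  unfold gT
  refine Finset.measurable_sum _ fun a _ => ?_
  exact (measurable_gSz K).comp (by fun_prop)

lemma measurable_gT' {M A : ℕ} {ι : Type} [Finite ι] (K : ℕ) :
    Measurable (fun x : (ι → Fin A) × (ι × Fin M × List (Fin M) → Fin A) => gT K x.1 x.2) :=
  measurable_from_prod_countable_right fun ℓ => measurable_gT K ℓ

lemma map_gT {A M : ℕ} (P : Measure (Fin A)) [IsProbabilityMeasure P] (K n : ℕ)
    (ℓ : Fin n → Fin A) :
    (Measure.infinitePi (fun _ : Fin n × Fin M × List (Fin M) => P)).map (gT K ℓ) =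
      (Measure.pi (fun a => lawS M P K (Fintype.card {i // ℓ i = a}))).map (fun x => ∑ a, x a) := by
  have h := map_blocks P (J := Fin A) (α := Fin n × Fin M × List (Fin M))
    (X := fun a => {i // ℓ i = a} × Fin M × List (Fin M)) (E := fun _ => ℝ)
    (fun x => (x.2.1.1, x.2.2)) (by
      rintro ⟨a, ⟨i, hi⟩, q⟩ ⟨b, ⟨j, hj⟩, r⟩ h
      simp only [Prod.mk.injEq] at h
      obtain ⟨rfl, rfl⟩ := h
      subst hi; subst hj; rfl)
    (fun a => gSz K) (fun a => measurable_gSz K)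
  simp_rw [lawS_reindex] at h
  rw [← h, Measure.map_map (by fun_prop)]
  · rfl
  · refine measurable_pi_lambda _ fun a => (measurable_gSz K).comp (by fun_prop)

/-- first letters and the rest -/
def gSplit {M A n : ℕ} (η : Fin n × List (Fin M) → Fin A) :
    (Fin n → Fin A) × (Fin n × Fin M × List (Fin M) → Fin A) :=
  ((fun i : Fin n => η (i, [])), (fun q : Fin n × Fin M × List (Fin M) => η (q.1, q.2.1 :: q.2.2)))

lemma measurable_gSplit {M A n : ℕ} : Measurable (gSplit (M := M) (A := A) (n := n)) := by
  unfold gSplit; fun_prop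

/-- sum of sizes of the subtries -/
noncomputable def gT2 {M A n : ℕ} (K : ℕ) (η : Fin n × List (Fin M) → Fin A) : ℝ :=
  gT (M := M) K (gSplit η).1 (gSplit η).2

/-- law of the total size of a child's subtries -/
noncomputable def lawT {A : ℕ} (M : ℕ) (P : Measure (Fin A)) [IsProbabilityMeasure P] (K n : ℕ) :
    Measure ℝ :=
  (Measure.infinitePi (fun _ : Fin n × List (Fin M) => P)).map (gT2 K)

lemma measurable_T {A M : ℕ} (K n : ℕ) : Measurable (gT2 (M := M) (A := A) (n := n) K) := by
  unfold gT2
  exact Measurable.comp (g := fun x : (Fin n → Fin A) × (Fin n × Fin M × List (Fin M) → Fin A) => gT K x.1 x.2)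
    (measurable_gT' (M := M) (A := A) (ι := Fin n) K) measurable_gSplit

instance lawT_prob {A M : ℕ} (P : Measure (Fin A)) [IsProbabilityMeasure P] (K n : ℕ) :
    IsProbabilityMeasure (lawT M P K n) :=
  Measure.isProbabilityMeasure_map (measurable_T K n).aemeasurable

lemma roots_prod {A M n : ℕ} (P : Measure (Fin A)) [IsProbabilityMeasure P] :
    (Measure.infinitePi (fun _ : Fin n × List (Fin M) => P)).map
      (fun η => ((fun i => η (i, [])), (fun q : Fin n × Fin M × List (Fin M) => η (q.1, q.2.1 :: q.2.2))))
    = (Measure.pi (fun _ : Fin n => P)).prod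
      (Measure.infinitePi (fun _ : Fin n × Fin M × List (Fin M) => P)) := by
  have hi : IndepFun (fun η : Fin n × List (Fin M) → Fin A => (fun i => η (i, [])))
     (fun η => (fun q : Fin n × Fin M × List (Fin M) => η (q.1, q.2.1 :: q.2.2)))
     (Measure.infinitePi (fun _ : Fin n × List (Fin M) => P)) := by
    let X : Bool → Type := fun b => bif b then Fin n else Fin n × Fin M × List (Fin M)
    let f : (Σ b, X b) → Fin n × List (Fin M) := fun x => match x with
      | ⟨true, (i : Fin n)⟩ => (i, [])
      | ⟨false, (q : Fin n × Fin M × List (Fin M))⟩ => (q.1, q.2.1 :: q.2.2)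
    have hf : Function.Injective f := by
      rintro ⟨b, x⟩ ⟨c, y⟩ h
      cases b <;> cases c
      · change (x.1, x.2.1 :: x.2.2) = (y.1, y.2.1 :: y.2.2) at h
        simp only [Prod.mk.injEq, List.cons.injEq] at h
        congr 1
        exact Prod.ext h.1 (Prod.ext h.2.1 h.2.2)
      · change (x.1, x.2.1 :: x.2.2) = ((y : Fin n), []) at h
        simp at h
      · change ((x : Fin n), []) = (y.1, y.2.1 :: y.2.2) at h
        simp at h
      · change ((x : Fin n), ([] : List (Fin M))) = ((y : Fin n), []) at h
        simp only [Prod.mk.injEq, and_true] at h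
        congr 1
    have h := map_blocks P f hf (fun j (x : X j → Fin A) => x) (fun j => measurable_id)
    have h2 : iIndepFun (fun (j : Bool) (η : Fin n × List (Fin M) → Fin A) (x : X j) => η (f ⟨j, x⟩))
      (Measure.infinitePi (fun _ : Fin n × List (Fin M) => P)) := by
      rw [iIndepFun_iff_map_fun_eq_pi_map (fun j => Measurable.aemeasurable (by fun_prop))]
      rw [h]
      congr 1
      funext j
      rw [Measure.map_id']
      have := Measure.map_infinitePi_infinitePi_of_inj
        (P := fun _ : Fin n × List (Fin M) => P) (f := fun x : X j => f ⟨j, x⟩)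
        (hf.comp sigma_mk_injective)
      rw [← this]
    exact h2.indepFun (i := true) (j := false) (by simp)
  rw [indepFun_iff_map_prod_eq_prod_map_map (Measurable.aemeasurable (by fun_prop))
    (Measurable.aemeasurable (by fun_prop))] at hi
  rw [hi]
  congr 1
  · have := Measure.map_infinitePi_infinitePi_of_inj
        (P := fun _ : Fin n × List (Fin M) => P) (f := fun i : Fin n => (i, []))
        (fun a b h => by simpa using h)
    rw [this, Measure.infinitePi_eq_pi]
  · have := Measure.map_infinitePi_infinitePi_of_inj
        (P := fun _ : Fin n × List (Fin M) => P)
        (f := fun q : Fin n × Fin M × List (Fin M) => (q.1, q.2.1 :: q.2.2))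
        (fun a b h => by
          simp only [Prod.mk.injEq, List.cons.injEq] at h
          exact Prod.ext h.1 (Prod.ext h.2.1 h.2.2))
    rw [this]

lemma lawT_eq {A M : ℕ} (P : Measure (Fin A)) [IsProbabilityMeasure P] (K n : ℕ) :
    lawT M P K n = ∑ ℓ : Fin n → Fin A, (∏ i, P {ℓ i}) •
      (Measure.pi (fun a => lawS M P K (Fintype.card {i // ℓ i = a}))).map (fun x => ∑ a, x a) := by
  have h : lawT M P K n = ((Measure.pi (fun _ : Fin n => P)).prod
      (Measure.infinitePi (fun _ : Fin n × Fin M × List (Fin M) => P))).map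
        (fun x => gT K x.1 x.2) := by
    rw [← roots_prod]
    exact (Measure.map_map (measurable_gT' K) measurable_gSplit).symm
  rw [h]
  ext B hB
  rw [Measure.map_apply (measurable_gT' K) hB, Measure.prod_apply (measurable_gT' K hB),
    lintegral_fintype]
  rw [Measure.finsetSum_apply]
  refine Finset.sum_congr rfl fun ℓ _ => ?_
  rw [Measure.smul_apply, ← map_gT, Measure.map_apply (measurable_gT K ℓ) hB, Measure.pi_singleton,
    smul_eq_mul, mul_comm]
  rfl

lemma lawS_succ {A M : ℕ} (P : Measure (Fin A)) [IsProbabilityMeasure P] (K n : ℕ) (hn : 2 ≤ n) :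
    lawS M P (K + 1) n = (Measure.pi (fun _ : Fin M => lawT M P K n)).map
      (fun x => 1 + ∑ m, x m) := by
  have h := map_blocks P (J := Fin M) (α := Fin n × Fin M × List (Fin M))
    (X := fun _ => Fin n × List (Fin M)) (E := fun _ => ℝ)
    (fun x => (x.2.1, x.1, x.2.2)) (by
      rintro ⟨a, i, q⟩ ⟨b, j, r⟩ h
      simp only [Prod.mk.injEq] at h
      obtain ⟨rfl, rfl, rfl⟩ := h
      rfl)
    (fun _ => gT2 K)
    (fun _ => measurable_T K n)
  unfold lawT
  rw [← h, Measure.map_map (by fun_prop)]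
  · unfold lawS
    congr 1
    funext ω
    simp only [Function.comp]
    rw [gSz_succ (by simpa using hn)]
    rfl
  · exact measurable_pi_lambda _ fun m => (measurable_T (M := M) (A := A) K n).comp
      (measurable_pi_lambda _ fun q => measurable_pi_apply _)

lemma lawS_small {A M : ℕ} (P : Measure (Fin A)) [IsProbabilityMeasure P] (K n : ℕ) (hn : n ≤ 1) :
    lawS M P K n = Measure.dirac 0 := by
  unfold lawS
  have : gSz (ι := Fin n) (M := M) (A := A) K = fun _ => 0 := by
    funext ω; exact gSz_small (by simpa using hn) K ω
  rw [this, Measure.map_const]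
  simp

lemma lawS_zero {A M : ℕ} (P : Measure (Fin A)) [IsProbabilityMeasure P] (n : ℕ) :
    lawS M P 0 n = Measure.dirac 0 := by
  unfold lawS
  have : gSz (ι := Fin n) (M := M) (A := A) 0 = fun _ => 0 := by
    funext ω; simp [gSz]
  rw [this, Measure.map_const]
  simp

open MeasureTheory ProbabilityTheory Filter Topology

lemma gT_abs_le {M A : ℕ} (K : ℕ) : ∃ C : ℝ, ∀ {n : ℕ} (ℓ : Fin n → Fin A)
    (ω : Fin n × Fin M × List (Fin M) → Fin A), |gT K ℓ ω| ≤ C := by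
  obtain ⟨C, hC⟩ := gSz_le (M := M) (A := A) K
  refine ⟨∑ _a : Fin A, C, fun ℓ ω => ?_⟩
  rw [abs_of_nonneg]
  · exact Finset.sum_le_sum fun a _ => hC _
  · exact Finset.sum_nonneg fun a _ => gSz_nonneg _ _

lemma integrable_of_cont_bdd {Ω : Type} [MeasurableSpace Ω] {μ : Measure Ω} [IsFiniteMeasure μ]
    {E : Type} [NormedAddCommGroup E] [SecondCountableTopology E] [MeasurableSpace E] [BorelSpace E]
    {X : Ω → ℝ} (hX : Measurable X) {C : ℝ} (hC : ∀ ω, |X ω| ≤ C) {f : ℝ → E} (hf : Continuous f) :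
    Integrable f (μ.map X) := by
  rw [integrable_map_measure hf.aestronglyMeasurable hX.aemeasurable]
  obtain ⟨D, hD⟩ := isCompact_Icc.exists_bound_of_continuousOn (s := Set.Icc (-C) C) hf.continuousOn
  refine Integrable.of_bound (hf.measurable.comp hX).aestronglyMeasurable D ?_
  exact Eventually.of_forall fun ω => hD _ (abs_le.1 (hC ω))

lemma integrable_lawS {A M : ℕ} (P : Measure (Fin A)) [IsProbabilityMeasure P] (K n : ℕ)
    {E : Type} [NormedAddCommGroup E] [SecondCountableTopology E] [MeasurableSpace E] [BorelSpace E]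
    {f : ℝ → E} (hf : Continuous f) : Integrable f (lawS M P K n) := by
  obtain ⟨C, hC⟩ := gSz_le (M := M) (A := A) K
  refine integrable_of_cont_bdd (measurable_gSz K) (C := C) (fun ω => ?_) hf
  rw [abs_of_nonneg (gSz_nonneg _ _)]; exact hC ω

lemma integrable_lawT {A M : ℕ} (P : Measure (Fin A)) [IsProbabilityMeasure P] (K n : ℕ)
    {E : Type} [NormedAddCommGroup E] [SecondCountableTopology E] [MeasurableSpace E] [BorelSpace E]
    {f : ℝ → E} (hf : Continuous f) : Integrable f (lawT M P K n) := by
  obtain ⟨C, hC⟩ := gT_abs_le (M := M) (A := A) K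
  exact integrable_of_cont_bdd (measurable_T K n) (C := C) (fun ω => hC _ _) hf

lemma integral_lawT {A M : ℕ} {p : Fin A → ℝ} (hp0 : ∀ a, 0 ≤ p a)
    (P : Measure (Fin A)) [IsProbabilityMeasure P]
    (hP : ∀ a, P {a} = ENNReal.ofReal (p a)) (K n : ℕ)
    {E : Type} [NormedAddCommGroup E] [NormedSpace ℝ E] [SecondCountableTopology E]
    [MeasurableSpace E] [BorelSpace E] {f : ℝ → E} (hf : Continuous f) :
    ∫ x, f x ∂(lawT M P K n) =
      Ex p n (fun N => ∫ x, f (∑ a, x a) ∂(Measure.pi (fun a => lawS M P K (N a)))) := by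
  rw [lawT_eq, Ex_eq_sum, integral_finsetSum_measure]
  · refine Finset.sum_congr rfl fun ℓ _ => ?_
    rw [integral_smul_measure]
    simp_rw [hP]
    rw [← ENNReal.ofReal_prod_of_nonneg (fun i _ => hp0 _),
      ENNReal.toReal_ofReal (Finset.prod_nonneg fun i _ => hp0 _),
      integral_map (by fun_prop) hf.aestronglyMeasurable]
  · intro ℓ _
    refine Integrable.smul_measure ?_ ?_
    · rw [← map_gT]
      obtain ⟨C, hC⟩ := gT_abs_le (M := M) (A := A) K
      exact integrable_of_cont_bdd (measurable_gT K ℓ) (C := C) (fun ω => hC _ _) hf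
    · simp_rw [hP]
      rw [← ENNReal.ofReal_prod_of_nonneg (fun i _ => hp0 _)]
      exact ENNReal.ofReal_ne_top

section rec
variable {A M : ℕ} {p : Fin A → ℝ}

/-- truncated mean -/
noncomputable def nuK (M : ℕ) (P : Measure (Fin A)) [IsProbabilityMeasure P] (K n : ℕ) : ℝ :=
  ∫ x, x ∂(lawS M P K n)
/-- truncated variance -/
noncomputable def vK (M : ℕ) (P : Measure (Fin A)) [IsProbabilityMeasure P] (K n : ℕ) : ℝ :=
  variance id (lawS M P K n)

variable (P : Measure (Fin A)) [IsProbabilityMeasure P]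

lemma memLp_lawS (K n : ℕ) : MemLp id 2 (lawS M P K n) := by
  rw [memLp_two_iff_integrable_sq aestronglyMeasurable_id]
  exact integrable_lawS P K n (f := fun x => x ^ 2) (by fun_prop)

lemma memLp_lawT (K n : ℕ) : MemLp id 2 (lawT M P K n) := by
  rw [memLp_two_iff_integrable_sq aestronglyMeasurable_id]
  exact integrable_lawT P K n (f := fun x => x ^ 2) (by fun_prop)

lemma integral_sum_pi {J : Type} [Fintype J] (μ : J → Measure ℝ) [∀ j, IsProbabilityMeasure (μ j)]
    (h : ∀ j, MemLp id 2 (μ j)) :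
    ∫ x, ∑ j, x j ∂(Measure.pi μ) = ∑ j, ∫ x, x ∂(μ j) := by
  rw [integral_finsetSum]
  · refine Finset.sum_congr rfl fun j _ => ?_
    exact integral_comp_eval (μ := μ) (f := fun x : ℝ => x) aestronglyMeasurable_id
  · intro j _
    exact ((h j).comp_measurePreserving (measurePreserving_eval μ j)).integrable (by norm_num)

lemma memLp_sum_pi {J : Type} [Fintype J] (μ : J → Measure ℝ) [∀ j, IsProbabilityMeasure (μ j)]
    (h : ∀ j, MemLp id 2 (μ j)) : MemLp (fun x : J → ℝ => ∑ j, x j) 2 (Measure.pi μ) := 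
  memLp_finsetSum _ fun j _ => (h j).comp_measurePreserving (measurePreserving_eval μ j)

lemma variance_sum_pi' {J : Type} [Fintype J] (μ : J → Measure ℝ) [∀ j, IsProbabilityMeasure (μ j)]
    (h : ∀ j, MemLp id 2 (μ j)) :
    variance (fun x => ∑ j, x j) (Measure.pi μ) = ∑ j, variance id (μ j) := by
  have := variance_sum_pi (μ := μ) (X := fun _ => id) h
  rw [← this]
  congr 1
  funext x; simp

lemma nuK_succ (hp0 : ∀ a, 0 ≤ p a) (hP : ∀ a, P {a} = ENNReal.ofReal (p a)) (K n : ℕ) (hn : 2 ≤ n) :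
    nuK M P (K + 1) n = 1 + M * Ex p n (fun N => ∑ a, nuK M P K (N a)) := by
  unfold nuK
  rw [lawS_succ P K n hn, integral_map (by fun_prop) (by fun_prop), integral_add (by simp)
    ((memLp_sum_pi _ fun _ => memLp_lawT P K n).integrable (by norm_num)),
    integral_sum_pi _ (fun _ => memLp_lawT P K n)]
  simp only [integral_const, probReal_univ, one_smul, Finset.sum_const, Finset.card_univ,
    Fintype.card_fin, nsmul_eq_mul]
  rw [integral_lawT hp0 P hP K n (f := fun x => x) (by fun_prop)]
  simp_rw [integral_sum_pi _ (fun a => memLp_lawS P K _)]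

lemma vK_succ (hp0 : ∀ a, 0 ≤ p a) (hp : ∑ a, p a = 1)
    (hP : ∀ a, P {a} = ENNReal.ofReal (p a)) (K n : ℕ) (hn : 2 ≤ n) :
    vK M P (K + 1) n = M * (Ex p n (fun N => ∑ a, vK M P K (N a)) +
      Vx p n (fun N => ∑ a, nuK M P K (N a))) := by
  unfold vK
  rw [lawS_succ P K n hn, variance_id_map (by fun_prop), variance_const_add (by fun_prop),
    variance_sum_pi' _ (fun _ => memLp_lawT P K n)]
  simp only [Finset.sum_const, Finset.card_univ, Fintype.card_fin, nsmul_eq_mul]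
  congr 1
  rw [variance_eq_sub (memLp_lawT P K n), Vx_eq hp]
  simp only [id, Pi.pow_apply]
  rw [integral_lawT hp0 P hP K n (f := fun x => x) (by fun_prop),
    integral_lawT hp0 P hP K n (f := fun x => x ^ 2) (by fun_prop)]
  simp_rw [integral_sum_pi _ (fun a => memLp_lawS P K _)]
  have : ∀ N : Fin A → ℕ, ∫ x, (∑ a, x a) ^ 2 ∂(Measure.pi fun a => lawS M P K (N a)) =
      ∑ a, variance id (lawS M P K (N a)) + (∑ a, nuK M P K (N a)) ^ 2 := by
    intro N
    have h := variance_eq_sub (memLp_sum_pi _ fun a => memLp_lawS (M := M) P K (N a))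
    rw [variance_sum_pi' _ (fun a => memLp_lawS P K _),
      integral_sum_pi _ (fun a => memLp_lawS P K _)] at h
    rw [h]
    simp [nuK]
  simp_rw [this, Ex_add]
  unfold nuK
  ring

lemma phK_succ (hp0 : ∀ a, 0 ≤ p a) 
    (hP : ∀ a, P {a} = ENNReal.ofReal (p a)) (K n : ℕ) (hn : 2 ≤ n) (t : ℝ) :
    charFun (lawS M P (K + 1) n) t = Complex.exp (t * Complex.I) *
      (Ex p n (fun N => ∏ a, charFun (lawS M P K (N a)) t)) ^ M := by
  have h1 : (Measure.pi (fun _ : Fin M => lawT M P K n)).map (fun x => 1 + ∑ m, x m) =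
      ((Measure.pi (fun _ : Fin M => lawT M P K n)).map (fun x => ∑ m, x m)).map
        (fun x => 1 + x) := by
    rw [Measure.map_map (by fun_prop) (by fun_prop)]; rfl
  rw [lawS_succ P K n hn, h1, charFun_map_const_add, charFun_map_sum_pi_eq_prod]
  simp only [Finset.prod_const, Finset.card_univ, Fintype.card_fin, Pi.pow_apply]
  have h2 : charFun (lawT M P K n) t = Ex p n (fun N => ∏ a, charFun (lawS M P K (N a)) t) := by
    rw [charFun_apply_real, integral_lawT hp0 P hP K n
      (f := fun x : ℝ => Complex.exp (t * x * Complex.I)) (by fun_prop)]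
    congr 1
    funext N
    have := congrFun (charFun_map_sum_pi_eq_prod (fun a => lawS M P K (N a))) t
    rw [Finset.prod_apply] at this
    rw [← this, charFun_apply_real, integral_map (by fun_prop) (by fun_prop)]
  rw [h2, mul_comm]
  simp

lemma nuK_small (K n : ℕ) (hn : n ≤ 1) : nuK M P K n = 0 := by
  simp [nuK, lawS_small P K n hn]
lemma vK_small (K n : ℕ) (hn : n ≤ 1) : vK M P K n = 0 := by
  simp [vK, lawS_small P K n hn, variance_dirac]
lemma phK_small (K n : ℕ) (hn : n ≤ 1) (t : ℝ) : charFun (lawS M P K n) t = 1 := by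
  simp [lawS_small P K n hn]
lemma nuK_zero (n : ℕ) : nuK M P 0 n = 0 := by
  simp [nuK, lawS_zero P n]
lemma vK_zero (n : ℕ) : vK M P 0 n = 0 := by
  simp [vK, lawS_zero P n, variance_dirac]
lemma nuK_nonneg (K n : ℕ) : 0 ≤ nuK M P K n := by
  unfold nuK lawS
  rw [integral_map (measurable_gSz K).aemeasurable (by fun_prop)]
  exact integral_nonneg fun ω => gSz_nonneg K ω
lemma vK_nonneg (K n : ℕ) : 0 ≤ vK M P K n := variance_nonneg _ _

end rec

open MeasureTheory ProbabilityTheory Filter Topology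

/-- the set of words occurring twice -/
def gSet {M A : ℕ} {ι : Type} (ω : ι × Fin M × List (Fin M) → Fin A) :
    Set (List (Fin M × Fin A)) := {w | 2 ≤ gCnt ω w}

lemma gSz_eq {M A : ℕ} {ι : Type} (K : ℕ) (ω : ι × Fin M × List (Fin M) → Fin A) :
    gSz K ω = ((gSet ω ∩ {w | w.length < K}).ncard : ℝ) := by
  classical
  unfold gSz
  have h : (gSet ω ∩ {w | w.length < K}) = 
      ((Finset.range K).biUnion (fun k =>
        ((Finset.univ : Finset (Fin k → Fin M × Fin A)).filter
          (fun w => 2 ≤ gCnt ω (List.ofFn w))).image List.ofFn) : Finset _) := by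
    ext w
    simp only [gSet, Set.mem_inter_iff, Set.mem_ofPred_eq, Finset.coe_biUnion, Set.mem_iUnion,
      Finset.coe_image, Set.mem_image, Finset.mem_coe, Finset.mem_range, Finset.mem_filter,
      Finset.mem_univ, true_and]
    constructor
    · rintro ⟨h1, h2⟩
      exact ⟨w.length, h2, w.get, by simpa using h1, by simp⟩
    · rintro ⟨k, hk, w', h1, rfl⟩
      exact ⟨h1, by simpa using hk⟩
  rw [h, Set.ncard_coe_finset, Finset.card_biUnion]
  · push_cast
    refine Finset.sum_congr rfl fun k _ => ?_
    rw [Finset.card_image_of_injective _ List.ofFn_injective, Finset.card_filter]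
    push_cast
    rfl
  · intro k _ l _ hkl
    rw [Function.onFun, Finset.disjoint_left]
    intro w hw hw'
    simp only [Finset.mem_image, Finset.mem_filter] at hw hw'
    obtain ⟨a, _, rfl⟩ := hw
    obtain ⟨b, _, hb⟩ := hw'
    have := congrArg List.length hb
    simp at this
    omega

lemma finite_len {M A : ℕ} (K : ℕ) (s : Set (List (Fin M × Fin A))) :
    (s ∩ {w | w.length < K}).Finite := (List.finite_length_lt _ K).subset Set.inter_subset_right

lemma gSz_mono {M A : ℕ} {ι : Type} (ω : ι × Fin M × List (Fin M) → Fin A) :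
    Monotone (fun K => gSz K ω) := by
  intro K L h
  simp only [gSz_eq]
  have h1 : gSet ω ∩ {w | w.length < K} ⊆ gSet ω ∩ {w | w.length < L} :=
    fun w hw => ⟨hw.1, lt_of_lt_of_le hw.2 h⟩
  exact_mod_cast Set.ncard_le_ncard h1 (finite_len L _)

lemma gSet_finite_of_bdd {M A : ℕ} {ι : Type} (ω : ι × Fin M × List (Fin M) → Fin A) (C : ℝ)
    (h : ∀ K, gSz K ω ≤ C) : (gSet ω).Finite := by
  by_contra hinf
  obtain ⟨m, hm⟩ := exists_nat_gt C
  obtain ⟨t, ht, hc⟩ := Set.Infinite.exists_subset_card_eq hinf m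
  set K := t.sup List.length + 1
  have : (t : Set (List (Fin M × Fin A))) ⊆ gSet ω ∩ {w | w.length < K} := fun w hw =>
    ⟨ht hw, Nat.lt_succ_of_le (Finset.le_sup (f := List.length) hw)⟩
  have h2 := Set.ncard_le_ncard this (finite_len K _)
  rw [Set.ncard_coe_finset, hc] at h2
  have h3 := h K
  rw [gSz_eq] at h3
  have : (m : ℝ) ≤ ((gSet ω ∩ {w | w.length < K}).ncard : ℝ) := by exact_mod_cast h2
  linarith

lemma gSz_tendsto {M A : ℕ} {ι : Type} (ω : ι × Fin M × List (Fin M) → Fin A)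
    (h : (gSet ω).Finite) : Tendsto (fun K => gSz K ω) atTop (𝓝 ((gSet ω).ncard : ℝ)) := by
  refine tendsto_const_nhds.congr' ?_
  filter_upwards [eventually_ge_atTop (h.toFinset.sup List.length + 1)] with K hK
  rw [gSz_eq, Set.inter_eq_left.2]
  intro w hw
  exact lt_of_lt_of_le (Nat.lt_succ_of_le (Finset.le_sup (f := List.length) (h.mem_toFinset.2 hw))) hK

lemma gSz_le_ncard {M A : ℕ} {ι : Type} (ω : ι × Fin M × List (Fin M) → Fin A)
    (h : (gSet ω).Finite) (K : ℕ) : gSz K ω ≤ ((gSet ω).ncard : ℝ) := by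
  rw [gSz_eq]; exact_mod_cast Set.ncard_le_ncard Set.inter_subset_left h

section lim
variable {A M : ℕ} {p : Fin A → ℝ} (P : Measure (Fin A)) [IsProbabilityMeasure P]

lemma nuK_bdd (hp0 : ∀ a, 0 ≤ p a) (hp : ∑ a, p a = 1) (hq : M * ∑ a, p a ^ 2 < 1)
    (hP : ∀ a, P {a} = ENNReal.ofReal (p a)) : ∃ B : ℕ → ℝ, ∀ K n, nuK M P K n ≤ B n :=
  rec_bdd (p := p) hp0 hp (M := M) (by positivity) hq (T := fun _ => 1)
    (nuK_nonneg P) (nuK_zero P) (nuK_small P) (fun K n hn => (nuK_succ P hp0 hP K n hn).le)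

lemma vK_bdd (hp0 : ∀ a, 0 ≤ p a) (hp : ∑ a, p a = 1) (hq : M * ∑ a, p a ^ 2 < 1)
    (hP : ∀ a, P {a} = ENNReal.ofReal (p a)) : ∃ B : ℕ → ℝ, ∀ K n, vK M P K n ≤ B n := by
  obtain ⟨B, hB⟩ := nuK_bdd P hp0 hp hq hP
  refine rec_bdd (p := p) hp0 hp (M := M) (by positivity) hq
    (T := fun n => M * Ex p n (fun N => (∑ a, B (N a)) ^ 2))
    (vK_nonneg P) (vK_zero P) (vK_small P) (fun K n hn => ?_)
  rw [vK_succ P hp0 hp hP K n hn, mul_add, add_comm]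
  refine add_le_add_left (mul_le_mul_of_nonneg_left ?_ (by positivity)) _
  refine (Vx_le hp n _ 0).trans (Ex_mono hp0 fun N _ => ?_)
  rw [sub_zero]
  exact pow_le_pow_left₀ (Finset.sum_nonneg fun a _ => nuK_nonneg P _ _)
    (Finset.sum_le_sum fun a _ => hB _ _) 2

/-- flat probability space -/
noncomputable abbrev flatP (M n : ℕ) : Measure (Fin n × Fin M × List (Fin M) → Fin A) :=
  Measure.infinitePi (fun _ => P)

lemma second_moment (K n : ℕ) : ∫ ω, gSz K ω ^ 2 ∂(flatP P M n) = vK M P K n + nuK M P K n ^ 2 := by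
  have h := variance_eq_sub (memLp_lawS (M := M) P K n)
  unfold vK nuK
  rw [h]
  simp only [id, Pi.pow_apply]
  unfold lawS
  rw [integral_map (measurable_gSz K).aemeasurable (by fun_prop)]
  ring

lemma integrable_gSz_sq (K n : ℕ) : Integrable (fun ω => gSz K ω ^ 2) (flatP P M n) := by
  have := (memLp_lawS (M := M) P K n).integrable_sq
  unfold lawS at this
  exact (integrable_map_measure (by fun_prop) (measurable_gSz K).aemeasurable).1 this

lemma lim_facts (hp0 : ∀ a, 0 ≤ p a) (hp : ∑ a, p a = 1) (hq : M * ∑ a, p a ^ 2 < 1)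
    (hP : ∀ a, P {a} = ENNReal.ofReal (p a)) (n : ℕ) :
    (∀ᵐ ω ∂(flatP P M n), (gSet ω).Finite) ∧
    MemLp (fun ω => ((gSet ω).ncard : ℝ)) 2 (flatP P M n) := by
  obtain ⟨B, hB⟩ := nuK_bdd P hp0 hp hq hP
  obtain ⟨D, hD⟩ := vK_bdd P hp0 hp hq hP
  have hbd : ∀ K, ∫⁻ ω, ENNReal.ofReal (gSz K ω ^ 2) ∂(flatP P M n)
      ≤ ENNReal.ofReal (D n + B n ^ 2) := by
    intro K
    rw [← ofReal_integral_eq_lintegral_ofReal (integrable_gSz_sq P K n)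
      (Eventually.of_forall fun ω => sq_nonneg _), second_moment]
    exact ENNReal.ofReal_le_ofReal (add_le_add (hD K n)
      (pow_le_pow_left₀ (nuK_nonneg P K n) (hB K n) 2))
  have hmc := lintegral_iSup (μ := flatP P M n) (f := fun K ω => ENNReal.ofReal (gSz K ω ^ 2))
    (fun K => ((measurable_gSz K).pow_const 2).ennreal_ofReal)
    (fun K L h ω => ENNReal.ofReal_le_ofReal (pow_le_pow_left₀ (gSz_nonneg _ _) (gSz_mono ω h) 2))
  have hlt : ∫⁻ ω, ⨆ K, ENNReal.ofReal (gSz K ω ^ 2) ∂(flatP P M n) < ⊤ := by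
    rw [hmc]; exact lt_of_le_of_lt (iSup_le hbd) ENNReal.ofReal_lt_top
  have hfin : ∀ᵐ ω ∂(flatP P M n), (gSet ω).Finite := by
    have := ae_lt_top (Measurable.iSup (fun K => ((measurable_gSz (M := M) (A := A) (ι := Fin n) K).pow_const 2).ennreal_ofReal)) hlt.ne
    filter_upwards [this] with ω hω
    refine gSet_finite_of_bdd ω (1 + (⨆ K, ENNReal.ofReal (gSz K ω ^ 2)).toReal) fun K => ?_
    have h1 : ENNReal.ofReal (gSz K ω ^ 2) ≤ ⨆ K, ENNReal.ofReal (gSz K ω ^ 2) := le_iSup (fun K => ENNReal.ofReal (gSz K ω ^ 2)) K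
    have h2 := ENNReal.toReal_mono hω.ne h1
    rw [ENNReal.toReal_ofReal (sq_nonneg _)] at h2
    nlinarith [sq_nonneg (gSz K ω - 1)]
  refine ⟨hfin, ?_⟩
  have hmeas : AEMeasurable (fun ω => ((gSet ω).ncard : ℝ)) (flatP P M n) :=
    aemeasurable_of_tendsto_metrizable_ae atTop (fun K => (measurable_gSz K).aemeasurable)
      (hfin.mono fun ω h => gSz_tendsto ω h)
  rw [memLp_two_iff_integrable_sq hmeas.aestronglyMeasurable]
  refine ⟨(hmeas.pow_const 2).aestronglyMeasurable, ?_⟩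
  rw [hasFiniteIntegral_iff_ofReal (Eventually.of_forall fun ω => sq_nonneg _)]
  refine lt_of_le_of_lt (lintegral_mono_ae ?_) hlt
  filter_upwards [hfin] with ω h
  have ht := (ENNReal.continuous_ofReal.tendsto _).comp ((gSz_tendsto ω h).pow 2)
  exact le_of_tendsto ht (Eventually.of_forall fun K => le_iSup (fun K => ENNReal.ofReal (gSz K ω ^ 2)) K)

/-- law of the size -/
noncomputable def lawG (M : ℕ) (P : Measure (Fin A)) [IsProbabilityMeasure P] (n : ℕ) : Measure ℝ :=
  (flatP P M n).map (fun ω => ((gSet ω).ncard : ℝ))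

end lim

open MeasureTheory ProbabilityTheory Filter Topology

section lim2
variable {A M : ℕ} {p : Fin A → ℝ} (P : Measure (Fin A)) [IsProbabilityMeasure P]

lemma lawG_facts (hp0 : ∀ a, 0 ≤ p a) (hp : ∑ a, p a = 1) (hq : M * ∑ a, p a ^ 2 < 1)
    (hP : ∀ a, P {a} = ENNReal.ofReal (p a)) (n : ℕ) :
    IsProbabilityMeasure (lawG M P n) ∧ MemLp id 2 (lawG M P n) ∧
    Tendsto (fun K => nuK M P K n) atTop (𝓝 (∫ x, x ∂(lawG M P n))) ∧
    Tendsto (fun K => vK M P K n) atTop (𝓝 (variance id (lawG M P n))) ∧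
    ∀ t, Tendsto (fun K => charFun (lawS M P K n) t) atTop (𝓝 (charFun (lawG M P n) t)) := by
  obtain ⟨hfin, hL⟩ := lim_facts P hp0 hp hq hP n
  have hm : AEMeasurable (fun ω => ((gSet ω).ncard : ℝ)) (flatP P M n) :=
    hL.aestronglyMeasurable.aemeasurable
  have hpr : IsProbabilityMeasure (lawG M P n) := Measure.isProbabilityMeasure_map hm
  have hL2 : MemLp id 2 (lawG M P n) := by
    unfold lawG
    rw [memLp_map_measure_iff aestronglyMeasurable_id hm]
    exact hL
  have h1 : Tendsto (fun K => nuK M P K n) atTop (𝓝 (∫ x, x ∂(lawG M P n))) := by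
    unfold nuK lawS lawG
    rw [integral_map hm (by fun_prop)]
    simp_rw [fun K => integral_map (μ := flatP P M n) (measurable_gSz (M := M) (A := A) (ι := Fin n) K).aemeasurable
      (f := fun x : ℝ => x) (by fun_prop)]
    refine tendsto_integral_of_dominated_convergence (fun ω => ((gSet ω).ncard : ℝ))
      (fun K => (measurable_gSz K).aestronglyMeasurable) (hL.integrable (by norm_num)) ?_ ?_
    · intro K
      filter_upwards [hfin] with ω h
      rw [Real.norm_of_nonneg (gSz_nonneg _ _)]
      exact gSz_le_ncard ω h K
    · filter_upwards [hfin] with ω h using gSz_tendsto ω h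
  have h2 : Tendsto (fun K => ∫ ω, gSz K ω ^ 2 ∂(flatP P M n)) atTop
      (𝓝 (∫ x, x ^ 2 ∂(lawG M P n))) := by
    unfold lawG
    rw [integral_map hm (by fun_prop)]
    refine tendsto_integral_of_dominated_convergence (fun ω => ((gSet ω).ncard : ℝ) ^ 2)
      (fun K => ((measurable_gSz K).pow_const 2).aestronglyMeasurable) hL.integrable_sq ?_ ?_
    · intro K
      filter_upwards [hfin] with ω h
      rw [Real.norm_of_nonneg (sq_nonneg _)]
      exact pow_le_pow_left₀ (gSz_nonneg _ _) (gSz_le_ncard ω h K) 2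
    · filter_upwards [hfin] with ω h using (gSz_tendsto ω h).pow 2
  refine ⟨hpr, hL2, h1, ?_, ?_⟩
  · rw [variance_eq_sub hL2]
    have : ∀ K, vK M P K n = ∫ ω, gSz K ω ^ 2 ∂(flatP P M n) - nuK M P K n ^ 2 := by
      intro K; rw [second_moment]; ring
    simp_rw [this]
    exact h2.sub (h1.pow 2)
  · intro t
    simp_rw [charFun_apply_real]
    unfold lawS lawG
    rw [integral_map hm (by fun_prop)]
    simp_rw [fun K => integral_map (μ := flatP P M n) (measurable_gSz (M := M) (A := A) (ι := Fin n) K).aemeasurable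
      (f := fun x : ℝ => Complex.exp (t * x * Complex.I)) (by fun_prop)]
    refine tendsto_integral_of_dominated_convergence (fun ω => 1)
      (fun K => ?_) (by simp) ?_ ?_
    · exact (by fun_prop : Measurable (fun x : ℝ => Complex.exp (t * x * Complex.I))).comp
        (measurable_gSz K) |>.aestronglyMeasurable
    · intro K
      refine Eventually.of_forall fun ω => ?_
      rw [← Complex.ofReal_mul, Complex.norm_exp_ofReal_mul_I]
    · filter_upwards [hfin] with ω h
      have hc : Continuous (fun x : ℝ => Complex.exp (t * x * Complex.I)) := by fun_prop
      exact (hc.tendsto _).comp (gSz_tendsto ω h)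

lemma lawG_rec (hp0 : ∀ a, 0 ≤ p a) (hp : ∑ a, p a = 1) (hq : M * ∑ a, p a ^ 2 < 1)
    (hP : ∀ a, P {a} = ENNReal.ofReal (p a)) (n : ℕ) (hn : 2 ≤ n) :
    (∫ x, x ∂(lawG M P n)) = 1 + M * Ex p n (fun N => ∑ a, ∫ x, x ∂(lawG M P (N a))) ∧
    variance id (lawG M P n) = M * (Ex p n (fun N => ∑ a, variance id (lawG M P (N a))) +
      Vx p n (fun N => ∑ a, ∫ x, x ∂(lawG M P (N a)))) ∧
    ∀ t : ℝ, charFun (lawG M P n) t = Complex.exp (t * Complex.I) *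
      (Ex p n (fun N => ∏ a, charFun (lawG M P (N a)) t)) ^ M := by
  have H := lawG_facts P hp0 hp hq hP
  have hν : ∀ N : Fin A → ℕ, Tendsto (fun K => ∑ a, nuK M P K (N a)) atTop
      (𝓝 (∑ a, ∫ x, x ∂(lawG M P (N a)))) :=
    fun N => tendsto_finsetSum _ fun a _ => (H (N a)).2.2.1
  refine ⟨?_, ?_, fun t => ?_⟩
  · refine tendsto_nhds_unique ((H n).2.2.1.comp (tendsto_add_atTop_nat 1)) ?_
    simp_rw [Function.comp_def, fun K => nuK_succ (M := M) P hp0 hP K n hn]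
    exact ((tendsto_Ex n hν).const_mul _).const_add _
  · refine tendsto_nhds_unique ((H n).2.2.2.1.comp (tendsto_add_atTop_nat 1)) ?_
    simp_rw [Function.comp_def, fun K => vK_succ (M := M) P hp0 hp hP K n hn]
    refine Tendsto.const_mul _ (Tendsto.add (tendsto_Ex n fun N => tendsto_finsetSum _
      fun a _ => (H (N a)).2.2.2.1) ?_)
    simp_rw [Vx_eq hp]
    exact (tendsto_Ex n fun N => (hν N).pow 2).sub ((tendsto_Ex n hν).pow 2)
  · refine tendsto_nhds_unique (((H n).2.2.2.2 t).comp (tendsto_add_atTop_nat 1)) ?_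
    simp_rw [Function.comp_def, fun K => phK_succ (M := M) P hp0 hP K n hn t]
    refine Tendsto.const_mul _ (Tendsto.pow (tendsto_Ex n fun N => tendsto_finsetProd _
      fun a _ => (H (N a)).2.2.2.2 t) M)

lemma lawG_small (n : ℕ) (hn : n ≤ 1) : lawG M P n = Measure.dirac 0 := by
  unfold lawG
  have : (fun ω : Fin n × Fin M × List (Fin M) → Fin A => ((gSet ω).ncard : ℝ)) = fun _ => 0 := by
    funext ω
    have : gSet ω = ∅ := by
      ext w
      have : gCnt ω w ≤ Nat.card (Fin n) := by
        unfold gCnt; exact Nat.card_le_card_of_injective _ Subtype.val_injective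
      simp only [Nat.card_eq_fintype_card, Fintype.card_fin] at this
      simp only [gSet, Set.mem_ofPred_eq, Set.mem_empty_iff_false, iff_false]
      omega
    simp [this]
  rw [this, Measure.map_const]; simp

end lim2

lemma gtrieSize_eq {M A n : ℕ} (Ls : Fin n → List (Fin M) → Fin A) :
    gtrieSize Ls = ((gSet (fun q : Fin n × Fin M × List (Fin M) => Ls q.1 (q.2.1 :: q.2.2))).ncard : ℝ) := by
  unfold gtrieSize GTrie gSet occCount gCnt
  simp_rw [occurs_iff_gOcc]

lemma labeling_eq {M A : ℕ} {p : Fin A → ℝ} 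
    {μL : Measure (List (Fin M) → Fin A)} [IsProbabilityMeasure μL]
    (hμL : IsLabelingMeasure p μL) (P : Measure (Fin A)) [IsProbabilityMeasure P]
    (hP : ∀ a, P {a} = ENNReal.ofReal (p a)) :
    μL = Measure.infinitePi (fun _ => P) := by
  refine (Measure.isProjectiveLimit_infinitePi (fun _ : List (Fin M) => P)).unique ?_ |>.symm
  intro s
  refine Measure.ext_of_singleton fun f => ?_
  rw [Measure.map_apply (by fun_prop) (measurableSet_singleton _), Measure.pi_singleton]
  simp_rw [hP]
  rcases isEmpty_or_nonempty (Fin A) with hA | ⟨⟨a0⟩⟩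
  · have : (Set.univ : Set (List (Fin M) → Fin A)) = ∅ := by
      ext L; exact (hA.false (L [])).elim
    have h := measure_univ (μ := μL)
    rw [this] at h
    simp at h
  · classical
    have h := hμL s (fun w => if h : w ∈ s then f ⟨w, h⟩ else a0)
    have e : s.restrict (π := fun _ => Fin A) ⁻¹' {f} = {L | ∀ w ∈ s, L w = (fun w => if h : w ∈ s then f ⟨w, h⟩ else a0) w} := by
      ext L
      simp only [Set.mem_preimage, Set.mem_singleton_iff, Set.mem_ofPred_eq]
      constructor
      · rintro rfl w hw
        simp [hw]
      · intro h
        funext ⟨w, hw⟩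
        simpa [hw] using h w hw
    rw [e, h, ← Finset.prod_attach]
    rw [← Finset.univ_eq_attach]
    refine Finset.prod_congr rfl fun w _ => ?_
    simp

lemma flat_law {M A n : ℕ} (P : Measure (Fin A)) [IsProbabilityMeasure P] :
    (Measure.pi (fun _ : Fin n => Measure.infinitePi (fun _ : List (Fin M) => P))).map
      (fun Ls (q : Fin n × Fin M × List (Fin M)) => Ls q.1 (q.2.1 :: q.2.2)) = flatP P M n := by
  have h1 := Measure.infinitePi_map_curry_symm (fun (_ : Fin n) (_ : List (Fin M)) => P)
  have h2 := Measure.map_infinitePi_infinitePi_of_inj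
        (P := fun _ : Fin n × List (Fin M) => P)
        (f := fun q : Fin n × Fin M × List (Fin M) => (q.1, q.2.1 :: q.2.2))
        (fun a b h => by
          simp only [Prod.mk.injEq, List.cons.injEq] at h
          exact Prod.ext h.1 (Prod.ext h.2.1 h.2.2))
  rw [flatP, ← h2, ← h1, Measure.map_map (by fun_prop) (by fun_prop),
    Measure.infinitePi_eq_pi (fun _ : Fin n => Measure.infinitePi (fun _ : List (Fin M) => P))]
  rfl

/-- letter measure -/
noncomputable def letterP {A : ℕ} (p : Fin A → ℝ) : Measure (Fin A) :=
  ∑ a, ENNReal.ofReal (p a) • Measure.dirac a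

lemma letterP_apply {A : ℕ} (p : Fin A → ℝ) (a : Fin A) : letterP p {a} = ENNReal.ofReal (p a) := by
  classical
  unfold letterP
  rw [Measure.finsetSum_apply, Finset.sum_eq_single a]
  · simp
  · intro b _ hb; simp [hb]
  · simp

lemma letterP_prob {A : ℕ} {p : Fin A → ℝ} (hp0 : ∀ a, 0 ≤ p a) (hp : ∑ a, p a = 1) :
    IsProbabilityMeasure (letterP p) := by
  refine ⟨?_⟩
  unfold letterP
  rw [Measure.finsetSum_apply]
  simp only [Measure.smul_apply, measure_univ, smul_eq_mul, mul_one]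
  rw [← ENNReal.ofReal_sum_of_nonneg (fun a _ => hp0 a), hp, ENNReal.ofReal_one]

open Filter Topology

section A1
variable {A : ℕ} {p : Fin A → ℝ}

/-- size-bias identity -/
lemma Ex_sb (n : ℕ) (a : Fin A) (F : (Fin A → ℕ) → ℝ) :
    Ex p (n + 1) (fun N => (N a : ℝ) * F (N - Pi.single a 1)) = (n + 1 : ℝ) * p a * Ex p n F := by
  induction n generalizing F with
  | zero =>
    simp only [Ex, zero_add, smul_eq_mul, Nat.cast_zero, one_mul]
    rw [Finset.sum_eq_single a]
    · simp
    · intro b _ hb; simp [hb.symm]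
    · simp
  | succ n ih =>
    obtain ⟨G, hG⟩ : ∃ G : (Fin A → ℕ) → ℝ, G = fun N => ∑ b, p b * F (N + Pi.single b 1) := ⟨_, rfl⟩
    have key : Ex p (n + 1 + 1) (fun N => (N a : ℝ) * F (N - Pi.single a 1)) =
        Ex p (n + 1) (fun N => p a * F N + (N a : ℝ) * G (N - Pi.single a 1)) := by
      rw [Ex_succ, hG]
      congr 1; funext N
      simp only [smul_eq_mul, Finset.mul_sum]
      rw [← Finset.add_sum_erase _ _ (Finset.mem_univ a)]
      refine Eq.trans ?_ (congrArg (p a * F N + ·)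
        (Finset.add_sum_erase Finset.univ _ (Finset.mem_univ a)))
      rw [← add_assoc]
      congr 1
      · have e1 : N + Pi.single a 1 - Pi.single a 1 = N := add_tsub_cancel_right _ _
        rw [e1]
        rcases Nat.eq_zero_or_pos (N a) with h | h
        · simp [h]
        · have e2 : N - Pi.single a 1 + Pi.single a 1 = N := by
            refine tsub_add_cancel_of_le ?_
            intro b
            by_cases hb : b = a
            · subst hb; simpa using Nat.succ_le_of_lt h
            · simp [hb]
          rw [e2]; simp; ring
      · refine Finset.sum_congr rfl fun b hb => ?_
        have hb' : b ≠ a := (Finset.mem_erase.1 hb).1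
        have e3 : (N + Pi.single b 1 : Fin A → ℕ) a = N a := by simp [hb'.symm]
        have e4 : N + Pi.single b 1 - Pi.single a 1 = N - Pi.single a 1 + Pi.single b 1 := by
          funext c
          simp only [Pi.sub_apply, Pi.add_apply]
          by_cases hc : c = a
          · subst hc; simp [hb'.symm]
          · simp [hc]
        rw [e3, e4]; ring
    rw [key, Ex_add, Ex_mul, ih]
    have : Ex p (n + 1) F = Ex p n G := by
      rw [Ex_succ, hG]; simp
    rw [← this]
    push_cast; ring

lemma Ex_sb' (n : ℕ) (a : Fin A) (f : ℕ → ℝ) :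
    Ex p (n + 1) (fun N => (N a : ℝ) * f (N a - 1)) = (n + 1 : ℝ) * p a * Ex p n (fun N => f (N a)) := by
  rw [← Ex_sb n a (fun N => f (N a))]
  simp

/-- exponential identity, real -/
lemma Ex_exp (n : ℕ) (c : Fin A → ℝ) :
    Ex p n (fun N => Real.exp (∑ a, c a * N a)) = (∑ a, p a * Real.exp (c a)) ^ n := by
  induction n with
  | zero => simp [Ex]
  | succ n ih =>
    rw [Ex_succ, pow_succ, ← ih, ← Ex_mul']
    congr 1; funext N
    rw [Finset.mul_sum]
    refine Finset.sum_congr rfl fun a _ => ?_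
    simp only [Pi.add_apply, Nat.cast_add, mul_add, Finset.sum_add_distrib, smul_eq_mul]
    have : ∑ b, c b * ((Pi.single a 1 : Fin A → ℕ) b : ℝ) = c a := by
      rw [Finset.sum_eq_single a]
      · simp
      · intro b _ hb; simp [hb]
      · simp
    rw [this, Real.exp_add]; ring

lemma Ex_cexp (n : ℕ) (c : Fin A → ℂ) :
    Ex p n (fun N => Complex.exp (∑ a, c a * N a)) = (∑ a, (p a : ℂ) * Complex.exp (c a)) ^ n := by
  induction n with
  | zero => simp [Ex]
  | succ n ih =>
    have hm : ∀ (d : ℂ) (F : (Fin A → ℕ) → ℂ), Ex p n F * d = Ex p n (fun N => F N * d) := by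
      intro d F
      simp only [Ex_eq_sum, Finset.sum_mul, smul_mul_assoc]
    rw [Ex_succ, pow_succ, ← ih, hm]
    congr 1; funext N
    rw [Finset.mul_sum]
    refine Finset.sum_congr rfl fun a _ => ?_
    simp only [Pi.add_apply, Nat.cast_add, mul_add, Finset.sum_add_distrib, Complex.real_smul]
    have : ∑ b, c b * ((Pi.single a 1 : Fin A → ℕ) b : ℂ) = c a := by
      rw [Finset.sum_eq_single a]
      · simp
      · intro b _ hb; simp [hb]
      · simp
    rw [this, Complex.exp_add]; ring

lemma exp_le_quad {x : ℝ} (hx : |x| ≤ 1) : Real.exp x ≤ 1 + x + x ^ 2 := by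
  have := Real.abs_exp_sub_one_sub_id_le hx
  linarith [abs_le.1 this]

lemma pow_le_fact_cosh (k : ℕ) (x : ℝ) : x ^ (2 * k) ≤ (2 * k).factorial * (Real.exp x + Real.exp (-x)) := by
  have h1 := Real.pow_div_factorial_le_exp |x| (abs_nonneg x) (2 * k)
  rw [div_le_iff₀ (by positivity)] at h1
  have h2 : |x| ^ (2 * k) = x ^ (2 * k) := by rw [pow_mul, sq_abs, ← pow_mul]
  rw [h2] at h1
  have h3 : Real.exp |x| ≤ Real.exp x + Real.exp (-x) := by
    rcases abs_cases x with ⟨h, _⟩ | ⟨h, _⟩ <;> rw [h] <;> linarith [Real.exp_pos x, Real.exp_pos (-x)]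
  calc _ ≤ _ := h1
    _ ≤ (Real.exp x + Real.exp (-x)) * _ := by gcongr
    _ = _ := by ring

/-- moment bound for centered linear statistics -/
lemma Ex_moment (hp0 : ∀ a, 0 ≤ p a) (hp : ∑ a, p a = 1) (k n : ℕ) (ξ : Fin A → ℝ) (B : ℝ)
    (hξ : ∀ a, |ξ a| ≤ B) (hc : ∑ a, p a * ξ a = 0) :
    Ex p n (fun N => (∑ a, ξ a * N a) ^ (2 * k)) ≤
      2 * Real.exp 1 * (2 * k).factorial * ((n : ℝ) * B ^ 2) ^ k := by
  rcases Nat.eq_zero_or_pos k with rfl | hk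
  · simp only [mul_zero, pow_zero, Nat.factorial_zero, Nat.cast_one, mul_one, Ex_const hp]
    have := Real.add_one_le_exp 1; linarith
  rcases Nat.eq_zero_or_pos n with rfl | hn
  · simp [Ex, hk.ne']
  have hB0 : 0 ≤ B := by
    rcases isEmpty_or_nonempty (Fin A) with h | ⟨⟨a⟩⟩
    · simp at hp
    · exact (abs_nonneg _).trans (hξ a)
  rcases hB0.eq_or_lt with rfl | hB
  · have : ∀ a, ξ a = 0 := fun a => abs_nonpos_iff.1 (hξ a)
    simp [this, hk.ne', Ex_zero']
  have hn' : (0 : ℝ) < n := by exact_mod_cast hn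
  have hn1 : (1 : ℝ) ≤ n := by exact_mod_cast hn
  set θ : ℝ := 1 / (B * √n) with hθ
  have hs : 0 < √(n : ℝ) := Real.sqrt_pos.2 hn'
  have hθ0 : 0 < θ := by positivity
  have hθ2 : θ ^ 2 * (n * B ^ 2) = 1 := by
    rw [hθ, div_pow, mul_pow, Real.sq_sqrt hn'.le]; field_simp
  have hB2 : θ ^ 2 * B ^ 2 = 1 / n := by field_simp; linarith
  have hexp : ∀ ε : ℝ, |ε| = 1 → Ex p n (fun N => Real.exp (ε * (θ * ∑ a, ξ a * N a))) ≤ Real.exp 1 := by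
    intro ε hε
    have e1 : (fun N : Fin A → ℕ => Real.exp (ε * (θ * ∑ a, ξ a * N a))) =
        fun N => Real.exp (∑ a, (ε * θ * ξ a) * N a) := by
      funext N; rw [Finset.mul_sum, Finset.mul_sum]; congr 1
      exact Finset.sum_congr rfl fun a _ => by ring
    rw [e1, Ex_exp]
    have hε2 : ε ^ 2 = 1 := by rw [← sq_abs, hε]; norm_num
    have hb : ∀ a, (ε * θ * ξ a) ^ 2 ≤ 1 / n := by
      intro a
      rw [← hB2, mul_pow, mul_pow, hε2, one_mul]
      have : ξ a ^ 2 ≤ B ^ 2 := by rw [← sq_abs]; exact pow_le_pow_left₀ (abs_nonneg _) (hξ a) 2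
      gcongr
    have h1 : ∑ a, p a * Real.exp (ε * θ * ξ a) ≤ 1 + 1 / n := by
      calc _ ≤ ∑ a, p a * (1 + (ε * θ * ξ a) + 1 / n) := by
            refine Finset.sum_le_sum fun a _ => mul_le_mul_of_nonneg_left ?_ (hp0 a)
            refine (exp_le_quad ?_).trans (by linarith [hb a])
            rw [← sq_le_one_iff_abs_le_one]
            refine (hb a).trans ?_
            rw [div_le_one hn']; exact hn1
        _ = ∑ a, (p a * (1 + 1 / n) + ε * θ * (p a * ξ a)) :=
            Finset.sum_congr rfl fun a _ => by ring
        _ = _ := by rw [Finset.sum_add_distrib, ← Finset.sum_mul, ← Finset.mul_sum, hp, hc]; ring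
    calc _ ≤ (1 + 1 / (n : ℝ)) ^ n := by
          refine pow_le_pow_left₀ (Finset.sum_nonneg fun a _ => mul_nonneg (hp0 a) (Real.exp_pos _).le) h1 n
      _ ≤ Real.exp (1 / n) ^ n := by
          gcongr
          linarith [Real.add_one_le_exp (1 / (n : ℝ))]
      _ = Real.exp 1 := by rw [← Real.exp_nat_mul]; congr 1; field_simp
  have h2 : Ex p n (fun N => (θ * ∑ a, ξ a * N a) ^ (2 * k)) ≤ (2 * k).factorial * (Real.exp 1 + Real.exp 1) := by
    refine (Ex_mono hp0 (fun N _ => pow_le_fact_cosh k _)).trans ?_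
    rw [Ex_mul, Ex_add]
    have a1 := hexp 1 (by simp)
    have a2 := hexp (-1) (by simp)
    simp only [one_mul, neg_mul] at a1 a2
    gcongr
  simp_rw [mul_pow θ] at h2
  rw [Ex_mul] at h2
  have h3 := mul_le_mul_of_nonneg_left h2 (show 0 ≤ ((n : ℝ) * B ^ 2) ^ k by positivity)
  have h4 : ((n : ℝ) * B ^ 2) ^ k * (θ ^ (2 * k) * Ex p n (fun N => (∑ a, ξ a * N a) ^ (2 * k))) = Ex p n (fun N => (∑ a, ξ a * N a) ^ (2 * k)) := by
    rw [← mul_assoc, pow_mul θ, ← mul_pow, mul_comm _ (θ ^ 2), hθ2]; simp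
  rw [h4] at h3
  calc _ ≤ _ := h3
    _ = _ := by ring

lemma Ex_delta_moment (hp0 : ∀ a, 0 ≤ p a) (hp : ∑ a, p a = 1) (k n : ℕ) (a : Fin A) :
    Ex p n (fun N => ((N a : ℝ) - n * p a) ^ (2 * k)) ≤
      2 * Real.exp 1 * (2 * k).factorial * (n : ℝ) ^ k := by
  have hle : ∀ a, p a ≤ 1 := fun a => by
    rw [← hp]; exact Finset.single_le_sum (fun b _ => hp0 b) (Finset.mem_univ a)
  have := Ex_moment hp0 hp k n (fun b => (if b = a then 1 else 0) - p a) 1 ?_ ?_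
  · rw [one_pow, mul_one] at this
    refine le_of_eq_of_le (Ex_congr fun N hN => ?_) this
    congr 1
    simp only [sub_mul, Finset.sum_sub_distrib, ite_mul, one_mul, zero_mul, Finset.sum_ite_eq',
      Finset.mem_univ, if_true, ← Finset.mul_sum]
    rw [← hN]; push_cast; ring
  · intro b
    have := hle a; have := hp0 a
    rw [abs_le]; split_ifs <;> constructor <;> linarith
  · simp only [mul_sub, Finset.sum_sub_distrib, ← Finset.sum_mul, hp]
    simp

lemma Ex_mean (n : ℕ) (a : Fin A) (hp : ∑ a, p a = 1) : Ex p n (fun N => (N a : ℝ)) = n * p a := by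
  rcases n with _ | n
  · simp [Ex]
  · have := Ex_sb' (p := p) n a (fun _ => 1)
    rw [Ex_const hp] at this
    simpa using this

/-- law of large numbers for powers -/
lemma Ex_pow_tendsto (hp0 : ∀ a, 0 ≤ p a) (hp : ∑ a, p a = 1) (a : Fin A) {τ : ℝ} (hτ : 0 < τ) :
    Tendsto (fun n : ℕ => Ex p n (fun N => ((N a : ℝ) / n) ^ τ)) atTop (𝓝 (p a ^ τ)) := by
  rw [Metric.tendsto_atTop]
  intro ε hε
  have hle : p a ≤ 1 := by
    rw [← hp]; exact Finset.single_le_sum (fun b _ => hp0 b) (Finset.mem_univ a)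
  obtain ⟨d, hd, hd'⟩ := Metric.continuousAt_iff.1
    (Real.continuousAt_rpow_const (p a) τ (Or.inr hτ.le)) (ε / 2) (by positivity)
  have key : ∀ x : ℝ, 0 ≤ x → x ≤ 1 → |x ^ τ - p a ^ τ| ≤ ε / 2 + (1 / d ^ 2) * (x - p a) ^ 2 := by
    intro x h0 h1
    by_cases h : dist x (p a) < d
    · have := (hd' h).le
      rw [Real.dist_eq] at this
      have : 0 ≤ (1 / d ^ 2) * (x - p a) ^ 2 := by positivity
      linarith
    · push Not at h
      rw [Real.dist_eq] at h
      have a1 := Real.rpow_nonneg h0 τ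
      have a2 := Real.rpow_le_one h0 h1 hτ.le
      have a3 := Real.rpow_nonneg (hp0 a) τ
      have a4 := Real.rpow_le_one (hp0 a) hle hτ.le
      have : 1 ≤ (1 / d ^ 2) * (x - p a) ^ 2 := by
        rw [one_div, inv_mul_eq_div, le_div_iff₀ (by positivity), one_mul, ← sq_abs (x - p a)]
        exact pow_le_pow_left₀ hd.le h 2
      have : |x ^ τ - p a ^ τ| ≤ 1 := by rw [abs_le]; constructor <;> linarith
      linarith
  set C : ℝ := (1 / d ^ 2) * (2 * Real.exp 1 * 2) with hC
  have hC0 : 0 < C := by positivity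
  obtain ⟨n0, hn0⟩ := exists_nat_gt (C / (ε / 2))
  refine ⟨n0 + 1, fun n hn => ?_⟩
  have hnpos : 0 < n := by omega
  have hn' : (0 : ℝ) < n := by exact_mod_cast hnpos
  rw [Real.dist_eq]
  have e1 : Ex p n (fun N => ((N a : ℝ) / n) ^ τ) - p a ^ τ =
      Ex p n (fun N => ((N a : ℝ) / n) ^ τ - p a ^ τ) := by rw [Ex_sub, Ex_const hp]
  rw [e1]
  refine (abs_Ex_le hp0 n _).trans_lt ?_
  have h2 : Ex p n (fun N => |((N a : ℝ) / n) ^ τ - p a ^ τ|) ≤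
      Ex p n (fun N => ε / 2 + ((1 / d ^ 2) * (1 / n ^ 2)) * ((N a : ℝ) - n * p a) ^ (2 * 1)) := by
    refine Ex_mono hp0 fun N hN => (key _ (by positivity) ?_).trans (le_of_eq ?_)
    · rw [div_le_one hn']; exact_mod_cast le_of_sum_eq hN a
    · congr 1; field_simp
  refine h2.trans_lt ?_
  rw [Ex_add, Ex_const hp, Ex_mul]
  have h3 := Ex_delta_moment hp0 hp 1 n a
  have h4 := mul_le_mul_of_nonneg_left h3 (show 0 ≤ (1 / d ^ 2) * (1 / (n : ℝ) ^ 2) by positivity)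
  have h5 : (1 / d ^ 2) * (1 / (n : ℝ) ^ 2) * (2 * Real.exp 1 * (2 * 1).factorial * (n : ℝ) ^ 1) = C / n := by
    rw [hC]; simp [Nat.factorial]; field_simp
  rw [h5] at h4
  have h6 : C / n < ε / 2 := by
    rw [div_lt_iff₀ (by positivity)] at hn0
    rw [div_lt_iff₀ hn']
    have : (n0 : ℝ) < n := by exact_mod_cast hn
    nlinarith
  linarith

end A1

open Filter Topology

section A2
variable {A : ℕ} {p : Fin A → ℝ} {M : ℝ}

lemma core_up (hp0 : ∀ a, 0 ≤ p a) (hp : ∑ a, p a = 1) (hM : 0 ≤ M) {n : ℕ} (hn : 2 ≤ n)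
    (x f : ℕ → ℝ) (h : ∀ k < n, x k ≤ f k) (hd : f n ≤ x n) :
    M * ∑ a, Ex p n (fun N => x (N a)) ≤ M * ∑ a, Ex p n (fun N => f (N a))
      + M * ∑ a, p a ^ 2 * (x n - f n) := by
  rw [← mul_add, ← Finset.sum_add_distrib]
  refine mul_le_mul_of_nonneg_left (Finset.sum_le_sum fun a _ => ?_) hM
  have h1 : p a ^ n * (x n - f n) ≤ p a ^ 2 * (x n - f n) := by
    refine mul_le_mul_of_nonneg_right (pow_le_pow_of_le_one (hp0 a) ?_ hn) (by linarith)
    rw [← hp]; exact Finset.single_le_sum (fun b _ => hp0 b) (Finset.mem_univ a)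
  refine le_trans ?_ (add_le_add_right h1 _)
  rw [← Ex_top, ← Ex_mul', ← Ex_add]
  refine Ex_mono hp0 fun N hN => ?_
  split_ifs with hh
  · rw [hh]; linarith
  · have := h (N a) (lt_of_le_of_ne (le_of_sum_eq hN a) hh)
    linarith

lemma Gpos (hp0 : ∀ a, 0 ≤ p a) (hp : ∑ a, p a = 1) (hM : 0 ≤ M)
    (hq : M * ∑ a, p a ^ 2 < 1) (x : ℕ → ℝ) (h0 : 0 ≤ x 0) (h1 : 0 ≤ x 1)
    (hx : ∀ n, 2 ≤ n → M * ∑ a, Ex p n (fun N => x (N a)) ≤ x n) (n : ℕ) : 0 ≤ x n := by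
  induction n using Nat.strong_induction_on with
  | _ n ih =>
  rcases n with _ | _ | n
  · exact h0
  · exact h1
  by_contra hneg
  push Not at hneg
  have := core_up hp0 hp hM (n := n + 2) (by omega) (fun k => - x k) (fun _ => 0)
    (fun k hk => by have := ih k hk; linarith) (by linarith)
  simp only [Ex_zero', Finset.sum_const_zero, mul_zero, zero_add, Ex_neg, Finset.sum_neg_distrib,
    ← Finset.sum_mul, sub_zero] at this
  have h3 := hx (n + 2) (by omega)
  nlinarith

lemma Ex_pow_scale {τ : ℝ} {n : ℕ} (hn : 0 < n) (a : Fin A) :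
    Ex p n (fun N => (N a : ℝ) ^ τ) = (n : ℝ) ^ τ * Ex p n (fun N => ((N a : ℝ) / n) ^ τ) := by
  rw [← Ex_mul]
  congr 1; funext N
  rw [← Real.mul_rpow (by positivity) (by positivity)]
  congr 1
  have : (n : ℝ) ≠ 0 := by positivity
  field_simp

lemma sum_pow_tendsto (hp0 : ∀ a, 0 ≤ p a) (hp : ∑ a, p a = 1) {τ : ℝ} (hτ : 0 < τ) :
    Tendsto (fun n : ℕ => M * ∑ a, Ex p n (fun N => ((N a : ℝ) / n) ^ τ)) atTop
      (𝓝 (M * ∑ a, p a ^ τ)) :=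
  (tendsto_finsetSum _ fun a _ => Ex_pow_tendsto hp0 hp a hτ).const_mul M

/-- upper growth lemma -/
lemma GU (hp0 : ∀ a, 0 ≤ p a) (hp : ∑ a, p a = 1) (hM : 0 ≤ M)
    (hq : M * ∑ a, p a ^ 2 < 1) {τ : ℝ} (hτ0 : 0 < τ) (hτ : M * ∑ a, p a ^ τ < 1) :
    ∃ C1 : ℝ, 0 < C1 ∧ ∀ (x : ℕ → ℝ) (C0 : ℝ), 0 ≤ C0 → (∀ n, 0 ≤ x n) → x 0 = 0 → x 1 ≤ C0 →
      (∀ n : ℕ, 2 ≤ n → x n ≤ M * ∑ a, Ex p n (fun N => x (N a)) + C0 * (n : ℝ) ^ τ) →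
      ∀ n : ℕ, x n ≤ C1 * C0 * (n : ℝ) ^ τ := by
  set θ := M * ∑ a, p a ^ 2 with hθ
  have hθ0 : 0 ≤ θ := mul_nonneg hM (Finset.sum_nonneg fun a _ => sq_nonneg _)
  -- one step
  have step : ∀ (x : ℕ → ℝ) (C0 : ℝ), 0 ≤ C0 → 
      (∀ n : ℕ, 2 ≤ n → x n ≤ M * ∑ a, Ex p n (fun N => x (N a)) + C0 * (n : ℝ) ^ τ) →
      ∀ (K : ℝ), 0 ≤ K → ∀ n : ℕ, 2 ≤ n → (∀ k < n, x k ≤ K * C0 * (k : ℝ) ^ τ) →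
      (M * ∑ a, Ex p n (fun N => ((N a : ℝ) / n) ^ τ)) * K + 1 ≤ K → x n ≤ K * C0 * (n : ℝ) ^ τ := by
    intro x C0 hC0 hx K hK n hn hk hle
    by_contra hneg
    push Not at hneg
    have h1 := core_up hp0 hp hM hn x (fun k => K * C0 * (k : ℝ) ^ τ) hk hneg.le
    rw [← Finset.sum_mul, ← mul_assoc, ← hθ] at h1
    have h2 := hx n hn
    simp only [Ex_mul] at h1
    rw [← Finset.mul_sum] at h1
    simp_rw [Ex_pow_scale (show 0 < n by omega)] at h1
    rw [← Finset.mul_sum] at h1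
    set Y := ∑ a, Ex p n (fun N => ((N a : ℝ) / n) ^ τ)
    have hnτ : 0 ≤ (n : ℝ) ^ τ := by positivity
    have h3 : M * (K * C0 * ((n : ℝ) ^ τ * Y)) + C0 * (n : ℝ) ^ τ ≤ K * C0 * (n : ℝ) ^ τ := by
      have := mul_le_mul_of_nonneg_right hle (mul_nonneg hC0 hnτ)
      linarith
    have : θ * (x n - K * C0 * (n : ℝ) ^ τ) < 1 * (x n - K * C0 * (n : ℝ) ^ τ) :=
      mul_lt_mul_of_pos_right hq (by linarith)
    linarith
  have step2 : ∀ (x : ℕ → ℝ) (C0 : ℝ), 0 ≤ C0 → (∀ n, 0 ≤ x n) →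
      (∀ n : ℕ, 2 ≤ n → x n ≤ M * ∑ a, Ex p n (fun N => x (N a)) + C0 * (n : ℝ) ^ τ) →
      ∀ (K : ℝ), 0 ≤ K → ∀ n : ℕ, 2 ≤ n → (∀ k < n, x k ≤ K * C0 * (k : ℝ) ^ τ) →
      x n ≤ ((M * (A * K) + 1) / (1 - θ)) * C0 * (n : ℝ) ^ τ := by
    intro x C0 hC0 hx0 hx K hK n hn hk
    have h1 := core_up hp0 hp hM hn x (fun k => if k < n then K * C0 * (n : ℝ) ^ τ else 0) 
      (fun k hkn => by
        simp only [hkn, if_true]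
        refine (hk k hkn).trans ?_
        gcongr) (by simpa using hx0 n)
    rw [← Finset.sum_mul, ← mul_assoc, ← hθ] at h1
    have h3 : ∑ a, Ex p n (fun N => if N a < n then K * C0 * (n : ℝ) ^ τ else 0) ≤ ∑ a : Fin A, (K * C0 * (n : ℝ) ^ τ) := by
      refine Finset.sum_le_sum fun a _ => ?_
      refine (Ex_mono hp0 (G := fun _ => K * C0 * (n : ℝ) ^ τ) fun N _ => ?_).trans_eq
        (Ex_const hp n _)
      split_ifs
      · exact le_rfl
      · positivity
    simp only [Finset.sum_const, Finset.card_univ, Fintype.card_fin, nsmul_eq_mul] at h3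
    have h4 := mul_le_mul_of_nonneg_left h3 hM
    have h2 := hx n hn
    simp only [lt_irrefl, if_false, sub_zero] at h1
    have h5 : (1 - θ) * x n ≤ (M * (A * K) + 1) * C0 * (n : ℝ) ^ τ := by linarith
    rw [div_mul_eq_mul_div, div_mul_eq_mul_div, le_div_iff₀ (by linarith)]
    linarith
  -- small n
  have small : ∀ n : ℕ, ∃ K : ℝ, 1 ≤ K ∧ ∀ (x : ℕ → ℝ) (C0 : ℝ), 0 ≤ C0 → (∀ n, 0 ≤ x n) → x 0 = 0 → x 1 ≤ C0 →
      (∀ n : ℕ, 2 ≤ n → x n ≤ M * ∑ a, Ex p n (fun N => x (N a)) + C0 * (n : ℝ) ^ τ) →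
      ∀ k < n, x k ≤ K * C0 * (k : ℝ) ^ τ := by
    intro n
    induction n with
    | zero => exact ⟨1, le_rfl, fun _ _ _ _ _ _ _ k hk => by omega⟩
    | succ n ih =>
      obtain ⟨K, hK, h⟩ := ih
      refine ⟨max K ((M * (A * K) + 1) / (1 - θ)), le_max_of_le_left hK, ?_⟩
      intro x C0 hC0 hx0 h0 h1 hx k hk
      rcases Nat.lt_succ_iff_lt_or_eq.1 hk with hk | rfl
      · refine (h x C0 hC0 hx0 h0 h1 hx k hk).trans ?_
        gcongr; exact le_max_left _ _
      · rcases k with _ | _ | k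
        · rw [h0]; positivity
        · simp only [zero_add, Nat.cast_one, Real.one_rpow, mul_one]
          have : 1 ≤ max K ((M * (A * K) + 1) / (1 - θ)) := le_max_of_le_left hK
          nlinarith
        · refine (step2 x C0 hC0 hx0 hx K (by linarith) _ (by omega) (h x C0 hC0 hx0 h0 h1 hx)).trans ?_
          gcongr; exact le_max_right _ _
  set lam := (M * ∑ a, p a ^ τ + 1) / 2 with hlam
  have hlam1 : lam < 1 := by rw [hlam]; linarith
  have hev := (sum_pow_tendsto (M := M) hp0 hp hτ0).eventually (gt_mem_nhds (show M * ∑ a, p a ^ τ < lam by rw [hlam]; linarith))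
  obtain ⟨n0, hn0⟩ := eventually_atTop.1 hev
  obtain ⟨K, hK, h⟩ := small (n0 + 2)
  refine ⟨max K (1 / (1 - lam)), lt_max_of_lt_left (by linarith), ?_⟩
  intro x C0 hC0 hx0 h0 h1 hx n
  have hK' : K ≤ max K (1 / (1 - lam)) := le_max_left _ _
  have hK2 : 1 / (1 - lam) ≤ max K (1 / (1 - lam)) := le_max_right _ _
  generalize max K (1 / (1 - lam)) = K' at hK' hK2 ⊢
  rw [div_le_iff₀ (by linarith)] at hK2
  induction n using Nat.strong_induction_on with
  | _ n ih =>
  by_cases hn : n < n0 + 2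
  · refine (h x C0 hC0 hx0 h0 h1 hx n hn).trans ?_
    gcongr
  · refine step x C0 hC0 hx K' (by linarith) n (by omega) ih ?_
    have := hn0 n (by omega)
    nlinarith

lemma Ex_next (hp0 : ∀ a, 0 ≤ p a) (n : ℕ) {a b : Fin A} (hab : a ≠ b) (f : ℕ → ℝ)
    (hf : ∀ k, k ≤ n + 1 → 0 ≤ f k) :
    p b * p a ^ n * f n ≤ Ex p (n + 1) (fun N => f (N a)) := by
  rw [Ex_succ, mul_assoc, ← Ex_top, ← Ex_mul', ← Ex_mul]
  refine Ex_mono hp0 fun N hN => ?_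
  have hs : ∀ c : Fin A, (N + Pi.single c 1 : Fin A → ℕ) a ≤ n + 1 := fun c =>
    le_of_sum_eq (by simp [Finset.sum_add_distrib, hN]) a
  refine le_trans ?_ (Finset.single_le_sum (f := fun c => p c • f ((N + Pi.single c 1 : Fin A → ℕ) a))
    (fun c _ => mul_nonneg (hp0 c) (hf _ (hs c))) (Finset.mem_univ b))
  simp only [smul_eq_mul]
  refine mul_le_mul_of_nonneg_left ?_ (hp0 b)
  have h2 : (N + Pi.single b 1 : Fin A → ℕ) a = N a := by simp [hab]
  rw [h2]
  split_ifs with hh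
  · rw [hh]; simp
  · simpa using hf _ ((le_of_sum_eq hN a).trans (by omega))

/-- lower growth lemma -/
lemma GrL (hp0 : ∀ a, 0 < p a) (hA : 2 ≤ A) (hp : ∑ a, p a = 1) (hM : 0 < M)
    (hq : M * ∑ a, p a ^ 2 < 1) {τ : ℝ} (hτ0 : 0 < τ) (hτ : 1 < M * ∑ a, p a ^ τ)
    (x : ℕ → ℝ) (hx : ∀ n, 0 ≤ x n) (hx2 : 0 < x 2)
    (hrec : ∀ n, 3 ≤ n → M * ∑ a, Ex p n (fun N => x (N a)) ≤ x n) :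
    ∃ c : ℝ, 0 < c ∧ ∀ n : ℕ, 2 ≤ n → c * (n : ℝ) ^ τ ≤ x n := by
  have hp0' : ∀ a, 0 ≤ p a := fun a => (hp0 a).le
  have hpos : ∀ n, 2 ≤ n → 0 < x n := by
    intro n hn
    induction n, hn using Nat.le_induction with
    | base => exact hx2
    | succ n hn ih =>
      refine lt_of_lt_of_le ?_ (hrec (n + 1) (by omega))
      refine mul_pos hM (Finset.sum_pos' (fun a _ => Ex_nonneg hp0' fun N _ => hx _) ?_)
      refine ⟨⟨0, by omega⟩, Finset.mem_univ _, ?_⟩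
      refine lt_of_lt_of_le ?_ (Ex_next hp0' n (b := ⟨1, by omega⟩) (by simp) x (fun k _ => hx k))
      have := hp0 ⟨0, by omega⟩
      have := hp0 ⟨1, by omega⟩
      positivity
  set lam := (M * ∑ a, p a ^ τ + 1) / 2 with hlam
  have hlam1 : 1 < lam := by rw [hlam]; linarith
  have hev := (sum_pow_tendsto (M := M) hp0' hp hτ0).eventually (lt_mem_nhds (show lam < M * ∑ a, p a ^ τ by rw [hlam]; linarith))
  have hev2 : ∀ᶠ n : ℕ in atTop, M * A ≤ (lam - 1) * (n : ℝ) ^ τ := by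
    have : Tendsto (fun n : ℕ => (lam - 1) * (n : ℝ) ^ τ) atTop atTop :=
      ((tendsto_rpow_atTop hτ0).comp tendsto_natCast_atTop_atTop).const_mul_atTop (by linarith)
    exact this.eventually_ge_atTop _
  obtain ⟨n0, hn0⟩ := eventually_atTop.1 (hev.and hev2)
  -- constant
  obtain ⟨c, hc, hcs⟩ : ∃ c : ℝ, 0 < c ∧ ∀ n : ℕ, 2 ≤ n → n < n0 + 3 → c * (n : ℝ) ^ τ ≤ x n := by
    have : (Finset.Icc 2 (n0 + 2)).Nonempty := ⟨2, by simp⟩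
    obtain ⟨m, hm, hmin⟩ := Finset.exists_min_image (Finset.Icc 2 (n0 + 2)) (fun n => x n / (n : ℝ) ^ τ) this
    have hm2 := (Finset.mem_Icc.1 hm).1
    refine ⟨x m / (m : ℝ) ^ τ, div_pos (hpos m hm2) (by positivity), fun n h1 h2 => ?_⟩
    have := hmin n (Finset.mem_Icc.2 ⟨h1, by omega⟩)
    rwa [le_div_iff₀ (by positivity)] at this
  refine ⟨c, hc, fun n hn => ?_⟩
  induction n using Nat.strong_induction_on with
  | _ n ih =>
  by_cases hns : n < n0 + 3
  · exact hcs n hn hns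
  by_contra hneg
  push Not at hneg
  obtain ⟨h1, h2⟩ := hn0 n (by omega)
  have hnτ : 0 < (n : ℝ) ^ τ := by positivity
  have h3 := core_up hp0' hp hM.le hn (fun k => - x k)
    (fun k => (if k ≤ 1 then c else 0) - c * (k : ℝ) ^ τ) (fun k hk => by
      by_cases hk2 : 2 ≤ k
      · have := ih k hk hk2
        rw [if_neg (by omega)]; linarith
      · have : (k : ℝ) ^ τ ≤ 1 :=
          Real.rpow_le_one (by positivity) (by exact_mod_cast (by omega : k ≤ 1)) hτ0.le
        have := hx k
        rw [if_pos (by omega)]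
        nlinarith) (by rw [if_neg (by omega)]; linarith)
  have h6 : ∑ a, Ex p n (fun N => if N a ≤ 1 then c else 0) ≤ ∑ a : Fin A, c := by
    refine Finset.sum_le_sum fun a _ => ?_
    refine (Ex_mono hp0' (G := fun _ => c) fun N _ => ?_).trans_eq (Ex_const hp n _)
    split_ifs
    · exact le_rfl
    · exact hc.le
  simp only [Finset.sum_const, Finset.card_univ, Fintype.card_fin, nsmul_eq_mul] at h6
  simp only [Ex_sub, Ex_mul, Ex_neg, Finset.sum_neg_distrib, Finset.sum_sub_distrib,
    ← Finset.mul_sum, ← Finset.sum_mul] at h3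
  simp_rw [Ex_pow_scale (show 0 < n by omega)] at h3
  rw [if_neg (by omega), ← Finset.mul_sum, ← mul_assoc M (∑ a, p a ^ 2)] at h3
  have h5 := hrec n (by omega)
  set Y := ∑ a, Ex p n (fun N => ((N a : ℝ) / n) ^ τ)
  have h7 := mul_le_mul_of_nonneg_left h6 hM.le
  have h8 : lam * (c * (n : ℝ) ^ τ) ≤ M * Y * (c * (n : ℝ) ^ τ) :=
    mul_le_mul_of_nonneg_right h1.le (by positivity)
  have h9 := mul_le_mul_of_nonneg_left h2 hc.le
  have : M * ∑ a, p a ^ 2 * (c * (n : ℝ) ^ τ - x n) < 1 * (c * (n : ℝ) ^ τ - x n) := by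
    rw [← Finset.sum_mul, ← mul_assoc]
    exact mul_lt_mul_of_pos_right hq (by linarith)
  rw [← Finset.sum_mul, ← mul_assoc] at this
  linarith

end A2

open Filter Topology

/-- mean / variance sequence data -/
structure Dat {A : ℕ} (p : Fin A → ℝ) (M : ℝ) (ν v : ℕ → ℝ) : Prop where
  hp0 : ∀ a, 0 < p a
  hp : ∑ a, p a = 1
  hA : 2 ≤ A
  hM : 1 ≤ M
  hq : M * ∑ a, p a ^ 2 < 1
  ν0 : ν 0 = 0
  ν1 : ν 1 = 0
  v0 : v 0 = 0
  v1 : v 1 = 0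
  νr : ∀ n, 2 ≤ n → ν n = 1 + M * Ex p n (fun N => ∑ a, ν (N a))
  vr : ∀ n, 2 ≤ n → v n = M * (Ex p n (fun N => ∑ a, v (N a)) + Vx p n (fun N => ∑ a, ν (N a)))

section A3
variable {A : ℕ} {p : Fin A → ℝ} {M : ℝ}

lemma Ex_succ_one (hp : ∑ a, p a = 1) (n : ℕ) (a : Fin A) (f : ℕ → ℝ) :
    Ex p (n + 1) (fun N => f (N a)) = Ex p n (fun N => f (N a)) + 
      p a * Ex p n (fun N => f (N a + 1) - f (N a)) := by
  rw [Ex_succ, ← Ex_mul, ← Ex_add]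
  congr 1; funext N
  rw [← Finset.add_sum_erase _ _ (Finset.mem_univ a)]
  have h1 : ∑ x ∈ Finset.univ.erase a, p x • f ((N + Pi.single x 1 : Fin A → ℕ) a) =
      ∑ x ∈ Finset.univ.erase a, p x * f (N a) := by
    refine Finset.sum_congr rfl fun b hb => ?_
    have hb' : b ≠ a := (Finset.mem_erase.1 hb).1
    simp [hb'.symm]
  rw [h1, ← Finset.sum_mul]
  have h2 := Finset.add_sum_erase Finset.univ p (Finset.mem_univ a)
  rw [hp] at h2
  have h3 : ∑ x ∈ Finset.univ.erase a, p x = 1 - p a := by linarith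
  rw [h3]; simp; ring

lemma diff_rec (hp : ∑ a, p a = 1) (r : ℕ) (X T : ℕ → ℝ)
    (h : ∀ n, X n = T n + M * ∑ a, p a ^ r * Ex p n (fun N => X (N a))) (n : ℕ) :
    X (n + 1) - X n = (T (n + 1) - T n) + 
      M * ∑ a, p a ^ (r + 1) * Ex p n (fun N => X (N a + 1) - X (N a)) := by
  conv_lhs => rw [h (n + 1), h n]
  simp_rw [Ex_succ_one hp, mul_add, Finset.sum_add_distrib]
  have : ∀ a, p a ^ r * (p a * Ex p n (fun N => X (N a + 1) - X (N a))) = 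
    p a ^ (r + 1) * Ex p n (fun N => X (N a + 1) - X (N a)) := fun a => by ring
  simp_rw [this]; ring

lemma Z1_rec (X T : ℕ → ℝ)
    (h : ∀ n, X n = T n + M * ∑ a, p a ^ 1 * Ex p n (fun N => X (N a))) (n : ℕ) (hn : 1 ≤ n) :
    (n : ℝ) * X (n - 1) = n * T (n - 1) + 
      M * ∑ a, Ex p n (fun N => (N a : ℝ) * X (N a - 1)) := by
  obtain ⟨n, rfl⟩ : ∃ k, n = k + 1 := ⟨n - 1, by omega⟩
  simp_rw [Ex_sb']
  simp only [Nat.add_sub_cancel]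
  conv_lhs => rw [h n]
  simp_rw [mul_assoc, ← Finset.mul_sum]
  push_cast; simp only [pow_one]; ring

lemma Z2_rec (X T : ℕ → ℝ)
    (h : ∀ n, X n = T n + M * ∑ a, p a ^ 2 * Ex p n (fun N => X (N a))) (n : ℕ) (hn : 2 ≤ n) :
    (n : ℝ) * ((n - 1 : ℕ) * X (n - 2)) = n * ((n - 1 : ℕ) * T (n - 2)) + 
      M * ∑ a, Ex p n (fun N => (N a : ℝ) * ((N a - 1 : ℕ) * X (N a - 2))) := by
  obtain ⟨n, rfl⟩ : ∃ k, n = k + 2 := ⟨n - 2, by omega⟩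
  have e : ∀ a, Ex p (n + 2) (fun N => (N a : ℝ) * ((N a - 1 : ℕ) * X (N a - 2))) =
      ((n : ℝ) + 2) * p a * ((n + 1) * p a * Ex p n (fun N => X (N a))) := by
    intro a
    have h1 := Ex_sb' (p := p) (n + 1) a (fun k => (k : ℝ) * X (k - 1))
    have h2 := Ex_sb' (p := p) n a X
    rw [h2] at h1
    simp only [Nat.sub_sub] at h1
    rw [h1]; push_cast; ring
  simp_rw [e]
  simp only [Nat.add_sub_cancel, show n + 2 - 1 = n + 1 from rfl]
  conv_lhs => rw [h n]
  have e2 : ∀ a, ((n : ℝ) + 2) * p a * ((n + 1) * p a * Ex p n (fun N => X (N a))) =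
    ((n : ℝ) + 2) * (n + 1) * (p a ^ 2 * Ex p n (fun N => X (N a))) := fun a => by ring
  simp_rw [e2, ← Finset.mul_sum]
  push_cast; ring

lemma abs_rec (hp0 : ∀ a, 0 ≤ p a) (hM : 0 ≤ M) {X : ℕ → ℝ} {n : ℕ} {T : ℝ} 
    (h : X n = T + M * ∑ a, Ex p n (fun N => X (N a))) :
    |X n| ≤ M * ∑ a, Ex p n (fun N => |X (N a)|) + |T| := by
  rw [h, add_comm]
  refine (abs_add_le _ _).trans (add_le_add_left ?_ _)
  rw [abs_mul, abs_of_nonneg hM]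
  refine mul_le_mul_of_nonneg_left ((Finset.abs_sum_le_sum_abs _ _).trans
    (Finset.sum_le_sum fun a _ => abs_Ex_le hp0 n _)) hM

variable {ν v : ℕ → ℝ} 

/-- first differences of the mean -/
def du (ν : ℕ → ℝ) (n : ℕ) : ℝ := ν (n + 1) - ν n

namespace Dat
variable (D : Dat p M ν v)
include D

lemma hp0' : ∀ a, 0 ≤ p a := fun a => (D.hp0 a).le
lemma hM0 : 0 < M := lt_of_lt_of_le one_pos D.hM

lemma ν_small {k : ℕ} (hk : k ≤ 1) : ν k = 0 := by
  interval_cases k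
  · exact D.ν0
  · exact D.ν1

lemma v_small {k : ℕ} (hk : k ≤ 1) : v k = 0 := by
  interval_cases k
  · exact D.v0
  · exact D.v1

lemma ν_all (n : ℕ) : ν n = (if 2 ≤ n then 1 else 0) + M * ∑ a, p a ^ 0 * Ex p n (fun N => ν (N a)) := by
  simp only [pow_zero, one_mul]
  split_ifs with h
  · rw [D.νr n h, Ex_sum]
  · have : ∀ a, Ex p n (fun N => ν (N a)) = 0 := by
      intro a
      rw [← Ex_zero' (p := p) n]
      refine Ex_congr fun N hN => D.ν_small ?_
      have := le_of_sum_eq hN a; omega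
    simp [this, D.ν_small (show n ≤ 1 by omega)]

lemma u_rec (n : ℕ) : du ν n = (if n = 1 then 1 else 0) + M * ∑ a, p a ^ 1 * Ex p n (fun N => du ν (N a)) := by
  unfold du
  rw [diff_rec D.hp 0 ν _ D.ν_all n]
  congr 1
  rcases n with _ | _ | n <;> simp

lemma z_rec (n : ℕ) (hn : 1 ≤ n) : (n : ℝ) * du ν (n - 1) = (if n = 2 then 2 else 0) +
      M * ∑ a, Ex p n (fun N => (N a : ℝ) * du ν (N a - 1)) := by
  rw [Z1_rec _ _ D.u_rec n hn]
  congr 1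
  rcases n with _ | _ | _ | n <;> simp

lemma u_bound {σ : ℝ} (hσ : 0 < σ) (h : M * ∑ a, p a ^ (1 + σ) < 1) :
    ∃ C, 0 < C ∧ ∀ n : ℕ, |du ν n| ≤ C * ((n : ℝ) + 1) ^ σ := by
  obtain ⟨C1, hC1, H⟩ := GU D.hp0' D.hp D.hM0.le D.hq (by linarith : 0 < 1 + σ) h
  have := H (fun n => |(n : ℝ) * du ν (n - 1)|) 2 (by norm_num) (fun n => abs_nonneg _) (by simp)
    (by simp [du, D.ν0, D.ν1]) (fun n hn => by
      refine (abs_rec D.hp0' D.hM0.le (X := fun n => (n : ℝ) * du ν (n - 1)) (D.z_rec n (by omega))).trans ?_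
      gcongr
      have : (1 : ℝ) ≤ (n : ℝ) ^ (1 + σ) := Real.one_le_rpow (by exact_mod_cast (by omega : 1 ≤ n)) (by linarith)
      split_ifs <;> simp <;> linarith)
  refine ⟨C1 * 2, by positivity, fun n => ?_⟩
  have h1 := this (n + 1)
  simp only [Nat.add_sub_cancel] at h1
  have hn : (0 : ℝ) < (n : ℝ) + 1 := by positivity
  push_cast at h1
  rw [abs_mul, abs_of_pos hn, Real.rpow_add hn, Real.rpow_one] at h1
  have : ((n : ℝ) + 1) * |du ν n| ≤ (n + 1) * (C1 * 2 * ((n : ℝ) + 1) ^ σ) := by linarith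
  exact le_of_mul_le_mul_left this hn

lemma w_rec (n : ℕ) : du ν (n + 1) - du ν n = ((if n = 0 then 1 else 0) - (if n = 1 then 1 else 0))
    + M * ∑ a, p a ^ 2 * Ex p n (fun N => du ν (N a + 1) - du ν (N a)) := by
  rw [diff_rec D.hp 1 (du ν) _ D.u_rec n]
  simp

lemma w_bound {σ : ℝ} (hσ : 0 < σ) (hσ1 : σ < 1) (h : M * ∑ a, p a ^ (1 + σ) < 1) :
    ∃ C, 0 < C ∧ ∀ n : ℕ, |du ν (n + 1) - du ν n| ≤ C * ((n : ℝ) + 1) ^ (σ - 1) := by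
  obtain ⟨C1, hC1, H⟩ := GU D.hp0' D.hp D.hM0.le D.hq (by linarith : 0 < 1 + σ) h
  set X : ℕ → ℝ := fun n => du ν (n + 1) - du ν n with hX
  have hZ := Z2_rec X _ D.w_rec
  have := H (fun n => |(n : ℝ) * ((n - 1 : ℕ) * X (n - 2))|) 6 (by norm_num) (fun n => abs_nonneg _) (by simp)
    (by simp) (fun n hn => by
      refine (abs_rec D.hp0' D.hM0.le (X := fun n => (n : ℝ) * ((n - 1 : ℕ) * X (n - 2))) (hZ n (by omega))).trans ?_
      gcongr
      have : (1 : ℝ) ≤ (n : ℝ) ^ (1 + σ) := Real.one_le_rpow (by exact_mod_cast (by omega : 1 ≤ n)) (by linarith)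
      rcases n with _ | _ | _ | _ | n
      · omega
      · omega
      · norm_num at this ⊢; linarith
      · norm_num at this ⊢; linarith
      · simp; positivity)
  refine ⟨C1 * 6 * 4, by positivity, fun n => ?_⟩
  have h1 := this (n + 2)
  simp only [Nat.add_sub_cancel, show n + 2 - 1 = n + 1 from rfl] at h1
  have hn : (0 : ℝ) < (n : ℝ) + 1 := by positivity
  have hn2 : (0 : ℝ) < (n : ℝ) + 2 := by positivity
  push_cast at h1
  rw [abs_mul, abs_mul, abs_of_pos hn, abs_of_pos hn2, Real.rpow_add hn2, Real.rpow_one] at h1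
  have h2 : (n + 2 : ℝ) * (((n : ℝ) + 1) * |X n|) ≤ (n + 2) * (C1 * 6 * ((n : ℝ) + 2) ^ σ) := by linarith
  have h3 := le_of_mul_le_mul_left h2 hn2
  have h4 : ((n : ℝ) + 2) ^ σ ≤ 4 * ((n : ℝ) + 1) ^ σ := by
    calc ((n : ℝ) + 2) ^ σ ≤ (2 * ((n : ℝ) + 1)) ^ σ := by gcongr; linarith
      _ = 2 ^ σ * ((n : ℝ) + 1) ^ σ := Real.mul_rpow (by norm_num) hn.le
      _ ≤ _ := by
        gcongr
        calc (2 : ℝ) ^ σ ≤ 2 ^ (1 : ℝ) := Real.rpow_le_rpow_of_exponent_le (by norm_num) hσ1.le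
          _ ≤ 4 := by norm_num
  rw [Real.rpow_sub hn, Real.rpow_one, mul_div_assoc', le_div_iff₀ hn]
  calc _ = ((n : ℝ) + 1) * |X n| := by ring
    _ ≤ _ := h3
    _ ≤ C1 * 6 * (4 * ((n : ℝ) + 1) ^ σ) := by gcongr
    _ = _ := by ring

end Dat
end A3

open Filter Topology

section A4
variable {A : ℕ} {p : Fin A → ℝ} {M : ℝ}

/-- fluctuation size -/
noncomputable def chi (p : Fin A → ℝ) (n : ℕ) (N : Fin A → ℕ) : ℝ :=
  ∑ a, ((N a : ℝ) - n * p a) ^ 2 / n + 1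

lemma one_le_chi (n : ℕ) (N : Fin A → ℕ) : 1 ≤ chi p n N := by
  unfold chi
  have : 0 ≤ ∑ a, ((N a : ℝ) - n * p a) ^ 2 / n := Finset.sum_nonneg fun a _ => by positivity
  linarith

lemma chi_moment (hp0 : ∀ a, 0 ≤ p a) (hp : ∑ a, p a = 1) :
    ∃ K : ℝ, 1 ≤ K ∧ ∀ n : ℕ, 1 ≤ n → ∀ j ≤ 4, Ex p n (fun N => chi p n N ^ j) ≤ K := by
  set c : ℝ := 2 * Real.exp 1 * (2 * 4).factorial with hc
  set K : ℝ := 8 * ((A : ℝ) ^ 3 * (A * c) + 1) with hK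
  have hc0 : 0 < c := by positivity
  have hA0 : (0:ℝ) ≤ (A : ℝ) ^ 3 * (A * c) := by positivity
  refine ⟨K, by rw [hK]; linarith, fun n hn j hj => ?_⟩
  have hn' : (0 : ℝ) < n := by exact_mod_cast hn
  have h1 : ∀ N : Fin A → ℕ, chi p n N ^ j ≤ 8 * ((A : ℝ) ^ 3 * ∑ a, (1 / (n : ℝ) ^ 4) * ((N a : ℝ) - n * p a) ^ (2 * 4) + 1) := by
    intro N
    refine (pow_le_pow_right₀ (one_le_chi n N) hj).trans ?_
    unfold chi
    set y : Fin A → ℝ := fun a => ((N a : ℝ) - n * p a) ^ 2 / n with hy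
    have hy0 : ∀ a, 0 ≤ y a := fun a => by positivity
    have hS0 : 0 ≤ ∑ a, y a := Finset.sum_nonneg fun a _ => hy0 a
    have e : ∑ a, (1 / (n : ℝ) ^ 4) * ((N a : ℝ) - n * p a) ^ (2 * 4) = ∑ a, y a ^ 4 := by
      refine Finset.sum_congr rfl fun a _ => ?_
      rw [hy]; simp only; rw [div_pow, pow_mul]; ring
    rw [e]
    have h2 : (∑ a, y a) ^ 4 ≤ (A : ℝ) ^ 3 * ∑ a, y a ^ 4 := by
      have := pow_sum_div_card_le_sum_pow (s := Finset.univ) (f := y) (fun a _ => hy0 a) 3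
      simp only [Finset.card_univ, Fintype.card_fin] at this
      rcases Nat.eq_zero_or_pos A with rfl | hA
      · simp
      · rw [div_le_iff₀ (by positivity)] at this
        have h5 : (∑ a, y a) ^ 4 ≤ (∑ a, y a ^ 4) * (A : ℝ) ^ 3 := this
        linarith
    have h3 : ∀ S : ℝ, 0 ≤ S → (S + 1) ^ 4 ≤ 8 * (S ^ 4 + 1) := by
      intro S hS
      nlinarith [sq_nonneg (S - 1), sq_nonneg (S ^ 2 - 1), mul_nonneg hS (sq_nonneg (S - 1)), sq_nonneg (S * (S-1))]
    have := h3 _ hS0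
    linarith
  refine (Ex_mono hp0 fun N _ => h1 N).trans ?_
  rw [Ex_mul, Ex_add, Ex_mul, Ex_const hp, Ex_sum, hK]
  have h4 : ∑ a, Ex p n (fun N => (1 / (n : ℝ) ^ 4) * ((N a : ℝ) - n * p a) ^ (2 * 4)) ≤ ∑ a : Fin A, c := by
    refine Finset.sum_le_sum fun a _ => ?_
    rw [Ex_mul]
    have := Ex_delta_moment hp0 hp 4 n a
    rw [one_div, inv_mul_le_iff₀ (by positivity)]
    rw [← hc] at this; linarith
  simp only [Finset.sum_const, Finset.card_univ, Fintype.card_fin, nsmul_eq_mul] at h4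
  gcongr

lemma delta_le_chi {n : ℕ} (hn : 1 ≤ n) (N : Fin A → ℕ) (a : Fin A) :
    |(N a : ℝ) - n * p a| ≤ √n * chi p n N := by
  have hn' : (0 : ℝ) < n := by exact_mod_cast hn
  have hs : 0 < √(n : ℝ) := Real.sqrt_pos.2 hn'
  have h1 : ((N a : ℝ) - n * p a) ^ 2 / n + 1 ≤ chi p n N := by
    unfold chi
    gcongr
    exact Finset.single_le_sum (f := fun a => ((N a : ℝ) - n * p a) ^ 2 / n) (fun b _ => by positivity) (Finset.mem_univ a)
  refine le_trans ?_ (mul_le_mul_of_nonneg_left h1 hs.le)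
  set d := (N a : ℝ) - n * p a
  have h2 : d ^ 2 / n = (|d| / √n) ^ 2 := by rw [div_pow, Real.sq_sqrt hn'.le, sq_abs]
  rw [h2]
  have h3 : |d| = √n * (|d| / √n) := by field_simp
  calc |d| = √n * (|d| / √n) := h3
    _ ≤ _ := by
      gcongr
      nlinarith [sq_nonneg (|d| / √n - 1), sq_nonneg (|d| / √n)]

lemma delta_sq_le_chi {n : ℕ} (hn : 1 ≤ n) (N : Fin A → ℕ) (a : Fin A) :
    ((N a : ℝ) - n * p a) ^ 2 ≤ n * chi p n N := by
  have hn' : (0 : ℝ) < n := by exact_mod_cast hn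
  have h1 : ((N a : ℝ) - n * p a) ^ 2 / n ≤ chi p n N := by
    unfold chi
    have := Finset.single_le_sum (f := fun a => ((N a : ℝ) - n * p a) ^ 2 / n) (fun b _ => by positivity) (Finset.mem_univ a)
    linarith
  rw [div_le_iff₀ hn'] at h1; linarith

/-- rounded mean -/
noncomputable def mm (p : Fin A → ℝ) (n : ℕ) (a : Fin A) : ℕ := ⌈(n : ℝ) * p a⌉₊

lemma mm_ge (n : ℕ) (a : Fin A) : (n : ℝ) * p a ≤ mm p n a := Nat.le_ceil _

lemma mm_lt (hp0 : ∀ a, 0 < p a) (n : ℕ) (a : Fin A) : (mm p n a : ℝ) < n * p a + 1 :=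
  Nat.ceil_lt_add_one (mul_nonneg (by positivity) (hp0 a).le)

lemma mm_pos (hp0 : ∀ a, 0 < p a) {n : ℕ} (hn : 1 ≤ n) (a : Fin A) : 1 ≤ mm p n a := by
  refine Nat.one_le_ceil_iff.2 (mul_pos (by exact_mod_cast hn) (hp0 a))

lemma mm_le (hp0 : ∀ a, 0 < p a) (hp : ∑ a, p a = 1) (n : ℕ) (a : Fin A) : mm p n a ≤ n := by
  refine Nat.ceil_le.2 ?_
  have : p a ≤ 1 := by
    rw [← hp]; exact Finset.single_le_sum (fun b _ => (hp0 b).le) (Finset.mem_univ a)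
  nlinarith [show (0 : ℝ) ≤ n by positivity]

lemma sub_mm_le (hp0 : ∀ a, 0 < p a) {n : ℕ} (hn : 1 ≤ n) (N : Fin A → ℕ) (a : Fin A) :
    |(N a : ℝ) - mm p n a| ≤ 2 * √n * chi p n N := by
  have h1 := delta_le_chi (p := p) hn N a
  have h2 := mm_ge (p := p) n a
  have h3 := mm_lt hp0 n a
  have h4 : (1 : ℝ) ≤ √n := Real.one_le_sqrt.2 (by exact_mod_cast hn)
  have h5 := one_le_chi (p := p) n N
  have h6 : 1 ≤ √(n : ℝ) * chi p n N := by nlinarith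
  rw [abs_le] at h1 ⊢
  constructor <;> linarith

lemma sub_mm_sq_le (hp0 : ∀ a, 0 < p a) {n : ℕ} (hn : 1 ≤ n) (N : Fin A → ℕ) (a : Fin A) :
    ((N a : ℝ) - mm p n a) ^ 2 ≤ 4 * n * chi p n N := by
  have h1 := delta_sq_le_chi (p := p) hn N a
  have h2 := mm_ge (p := p) n a
  have h3 := mm_lt hp0 n a
  have h4 : (1 : ℝ) ≤ n := by exact_mod_cast hn
  have h5 := one_le_chi (p := p) n N
  have h6 : 1 ≤ (n : ℝ) * chi p n N := by nlinarith
  have : ((mm p n a : ℝ) - n * p a) ^ 2 ≤ 1 := by nlinarith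
  have : ((N a : ℝ) - mm p n a) ^ 2 ≤ 2 * ((N a : ℝ) - n * p a) ^ 2 + 2 * ((mm p n a : ℝ) - n * p a) ^ 2 := by
    nlinarith [sq_nonneg (((N a : ℝ) - n * p a) + ((mm p n a : ℝ) - n * p a))]
  linarith

lemma mm_rpow_le (hp0 : ∀ a, 0 < p a) {σ : ℝ} (hσ : σ ≤ 1) :
    ∃ C : ℝ, 0 < C ∧ ∀ n : ℕ, 1 ≤ n → ∀ a, (mm p n a : ℝ) ^ (σ - 1) ≤ C * (n : ℝ) ^ (σ - 1) := by
  refine ⟨∑ a, p a ^ (σ - 1) + 1, ?_, fun n hn a => ?_⟩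
  · have : 0 ≤ ∑ a, p a ^ (σ - 1) := Finset.sum_nonneg fun a _ => Real.rpow_nonneg (hp0 a).le _
    linarith
  · have hn' : (0 : ℝ) < n := by exact_mod_cast hn
    have h1 : (mm p n a : ℝ) ^ (σ - 1) ≤ ((n : ℝ) * p a) ^ (σ - 1) :=
      Real.rpow_le_rpow_of_nonpos (mul_pos hn' (hp0 a)) (mm_ge n a) (by linarith)
    rw [Real.mul_rpow hn'.le (hp0 a).le, mul_comm] at h1
    refine h1.trans ?_
    gcongr
    have := Finset.single_le_sum (f := fun a => p a ^ (σ - 1)) (fun b _ => Real.rpow_nonneg (hp0 b).le _) (Finset.mem_univ a)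
    linarith

/-- centering -/
lemma center_chi (hp0 : ∀ a, 0 ≤ p a) (hp : ∑ a, p a = 1) {K : ℝ} (hK : 1 ≤ K)
    {n : ℕ} (hE : Ex p n (fun N => chi p n N) ≤ K) (F : (Fin A → ℕ) → ℝ) (c B : ℝ) (hB : 0 ≤ B)
    (h : ∀ N, ∑ a, N a = n → |F N - c| ≤ B * chi p n N) (N : Fin A → ℕ) (hN : ∑ a, N a = n) :
    |F N - Ex p n F| ≤ 2 * K * B * chi p n N := by
  have h1 : |Ex p n F - c| ≤ B * K := by
    rw [← Ex_const hp n c, ← Ex_sub]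
    refine (abs_Ex_le hp0 n _).trans ((Ex_mono hp0 h).trans ?_)
    rw [Ex_mul]; gcongr
  have h2 := h N hN
  have h3 := one_le_chi (p := p) n N
  have h4 : |F N - Ex p n F| ≤ |F N - c| + |Ex p n F - c| := by
    have := abs_sub_le (F N) c (Ex p n F)
    rwa [abs_sub_comm c] at this
  have h5 : B * chi p n N ≤ K * B * chi p n N := by
    have : 0 ≤ B * chi p n N := by positivity
    nlinarith
  have h6 : B * K ≤ K * B * chi p n N := by
    have : 0 ≤ B * K := by positivity
    nlinarith
  linarith

lemma rpow_step {σ : ℝ} (hσ : 0 < σ) (hσ1 : σ ≤ 1) (j : ℕ) :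
    ((j : ℝ) + 1) ^ (σ - 1) ≤ (1 / σ) * (((j : ℝ) + 1) ^ σ - (j : ℝ) ^ σ) := by
  set x : ℝ := (j : ℝ) + 1 with hx
  have hx0 : 0 < x := by positivity
  have hj : (j : ℝ) = x * (1 + (- (1 / x))) := by rw [hx]; field_simp; ring
  have hx1 : 1 / x ≤ 1 := by rw [div_le_one hx0, hx]; linarith [show (0:ℝ) ≤ j by positivity]
  have h1 : (1 + (- (1 / x))) ^ σ ≤ 1 + σ * (- (1 / x)) :=
    rpow_one_add_le_one_add_mul_self (by linarith) hσ.le hσ1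
  rw [hj, Real.mul_rpow hx0.le (by linarith), Real.rpow_sub hx0, Real.rpow_one]
  have h2 := mul_le_mul_of_nonneg_left h1 (Real.rpow_nonneg hx0.le σ)
  have : x ^ σ / x = 1 / σ * (x ^ σ - x ^ σ * (1 + σ * (-(1 / x)))) := by field_simp; ring
  rw [this]
  gcongr

lemma rpow_diff {σ : ℝ} (hσ : 0 < σ) (hσ1 : σ ≤ 1) (l m : ℕ) (hm : 1 ≤ m) :
    |(l : ℝ) ^ σ - (m : ℝ) ^ σ| ≤ |(l : ℝ) - m| * (m : ℝ) ^ (σ - 1) := by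
  have hm0 : (0 : ℝ) < m := by exact_mod_cast hm
  have em : (m : ℝ) ^ σ = m * (m : ℝ) ^ (σ - 1) := by
    rw [Real.rpow_sub hm0, Real.rpow_one]; field_simp
  rcases Nat.eq_zero_or_pos l with rfl | hl
  · simp only [Nat.cast_zero, Real.zero_rpow hσ.ne', zero_sub, abs_neg]
    rw [abs_of_pos hm0, abs_of_pos (by positivity), em]
  have hl0 : (0 : ℝ) < l := by exact_mod_cast hl
  have el : (l : ℝ) ^ σ = l * (l : ℝ) ^ (σ - 1) := by
    rw [Real.rpow_sub hl0, Real.rpow_one]; field_simp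
  rcases le_total m l with h | h
  · have hml : (m : ℝ) ≤ l := by exact_mod_cast h
    rw [abs_of_nonneg (by linarith : 0 ≤ (l : ℝ) - m), abs_of_nonneg (by
      have := Real.rpow_le_rpow hm0.le hml hσ.le; linarith)]
    have : (l : ℝ) ^ (σ - 1) ≤ (m : ℝ) ^ (σ - 1) := Real.rpow_le_rpow_of_nonpos hm0 hml (by linarith)
    rw [el, em]
    nlinarith
  · have hml : (l : ℝ) ≤ m := by exact_mod_cast h
    rw [abs_of_nonpos (by linarith : (l : ℝ) - m ≤ 0), abs_of_nonpos (by
      have := Real.rpow_le_rpow hl0.le hml hσ.le; linarith)]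
    have : (m : ℝ) ^ (σ - 1) ≤ (l : ℝ) ^ (σ - 1) := Real.rpow_le_rpow_of_nonpos hl0 hml (by linarith)
    rw [el, em]
    nlinarith

/-- discrete Taylor -/
lemma taylor_disc (f : ℕ → ℝ) (c K : ℝ) (m : ℕ) (hK : 0 ≤ K)
    (h : ∀ j : ℕ, |f (j + 1) - f j - c| ≤ K * |(j : ℝ) - m|) (l : ℕ) :
    |f l - f m - c * ((l : ℝ) - m)| ≤ K * ((l : ℝ) - m) ^ 2 := by
  have up : ∀ d : ℕ, |f (m + d) - f m - c * d| ≤ K * (d : ℝ) ^ 2 := by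
    intro d
    induction d with
    | zero => simp
    | succ d ih =>
      have h1 := h (m + d)
      push_cast at h1 ⊢
      have e : |(m : ℝ) + d - m| = d := by rw [add_sub_cancel_left]; simp
      rw [e] at h1
      rw [abs_le] at h1 ih ⊢
      have hd : (0 : ℝ) ≤ d := by positivity
      have : K * ((d : ℝ) + 1) ^ 2 = K * (d : ℝ) ^ 2 + K * d + K * (d + 1) := by ring
      have : 0 ≤ K * ((d : ℝ) + 1) := by positivity
      have e2 : f (m + (d + 1)) = f (m + d + 1) := rfl
      rw [e2]
      constructor <;> linarith
  have dn : ∀ d : ℕ, ∀ l : ℕ, l + d = m → |f l - f m - c * (-(d : ℝ))| ≤ K * (d : ℝ) ^ 2 := by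
    intro d
    induction d with
    | zero => intro l hl; simp at hl; subst hl; simp
    | succ d ih =>
      intro l hl
      have h2 := ih (l + 1) (by omega)
      have h1 := h l
      have e : |(l : ℝ) - m| = d + 1 := by
        rw [← hl]; push_cast
        rw [show (l : ℝ) - (l + (d + 1)) = -((d : ℝ) + 1) by ring, abs_neg, abs_of_nonneg (by positivity)]
      rw [e] at h1
      push_cast
      rw [abs_le] at h1 h2 ⊢
      have hd : (0 : ℝ) ≤ d := by positivity
      have : K * ((d : ℝ) + 1) ^ 2 = K * (d : ℝ) ^ 2 + K * (d + 1) + K * d := by ring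
      have : 0 ≤ K * (d : ℝ) := by positivity
      constructor <;> linarith
  rcases le_total m l with hl | hl
  · obtain ⟨d, rfl⟩ := Nat.exists_eq_add_of_le hl
    have := up d
    push_cast
    simpa using this
  · obtain ⟨d, rfl⟩ := Nat.exists_eq_add_of_le hl
    have := dn d l rfl
    push_cast
    rw [show (l : ℝ) - (l + d) = -(d : ℝ) by ring]
    simpa using this

variable {ν v : ℕ → ℝ}
namespace Dat
variable (D : Dat p M ν v)
include D

lemma u_lip {σ : ℝ} (hσ : 0 < σ) (hσ1 : σ < 1) (h : M * ∑ a, p a ^ (1 + σ) < 1) :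
    ∃ C, 0 < C ∧ ∀ l m : ℕ, 1 ≤ m → |du ν l - du ν m| ≤ C * (m : ℝ) ^ (σ - 1) * |(l : ℝ) - m| := by
  obtain ⟨C, hC, hw⟩ := D.w_bound hσ hσ1 h
  refine ⟨C * (1 / σ), by positivity, fun l m hm => ?_⟩
  have hw' : ∀ j : ℕ, |du ν (j + 1) - du ν j| ≤ C * (1 / σ) * ((((j + 1 : ℕ) : ℝ)) ^ σ - (j : ℝ) ^ σ) := by
    intro j
    refine (hw j).trans ?_
    rw [mul_assoc]; push_cast
    exact mul_le_mul_of_nonneg_left (rpow_step hσ hσ1.le j) hC.le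
  have m1 : Monotone (fun j : ℕ => C * (1 / σ) * (j : ℝ) ^ σ - du ν j) :=
    monotone_nat_of_le_succ fun j => by have := (abs_le.1 (hw' j)).2; linarith
  have m2 : Monotone (fun j : ℕ => C * (1 / σ) * (j : ℝ) ^ σ + du ν j) :=
    monotone_nat_of_le_succ fun j => by have := (abs_le.1 (hw' j)).1; linarith
  have key : |du ν l - du ν m| ≤ C * (1 / σ) * |(l : ℝ) ^ σ - (m : ℝ) ^ σ| := by
    rcases le_total l m with hl | hl
    · have h1 := m1 hl
      have h2 := m2 hl
      have : (l : ℝ) ^ σ ≤ (m : ℝ) ^ σ := Real.rpow_le_rpow (by positivity) (by exact_mod_cast hl) hσ.le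
      rw [abs_of_nonpos (by linarith : (l : ℝ) ^ σ - (m : ℝ) ^ σ ≤ 0), abs_le]
      simp only at h1 h2
      constructor <;> linarith
    · have h1 := m1 hl
      have h2 := m2 hl
      have : (m : ℝ) ^ σ ≤ (l : ℝ) ^ σ := Real.rpow_le_rpow (by positivity) (by exact_mod_cast hl) hσ.le
      rw [abs_of_nonneg (by linarith : 0 ≤ (l : ℝ) ^ σ - (m : ℝ) ^ σ), abs_le]
      simp only at h1 h2
      constructor <;> linarith
  calc _ ≤ _ := key
    _ ≤ C * (1 / σ) * (|(l : ℝ) - m| * (m : ℝ) ^ (σ - 1)) := by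
      gcongr; exact rpow_diff hσ hσ1.le l m hm
    _ = _ := by ring

/-- pathwise bounds at the rounded mean -/
lemma u_path {σ : ℝ} (hσ : 0 < σ) (hσ1 : σ < 1) (h : M * ∑ a, p a ^ (1 + σ) < 1) :
    ∃ C, 0 < C ∧ ∀ n : ℕ, 1 ≤ n → ∀ N : Fin A → ℕ, ∀ a,
      |du ν (N a) - du ν (mm p n a)| ≤ C * (n : ℝ) ^ (σ - 1 / 2) * chi p n N := by
  obtain ⟨C, hC, hu⟩ := D.u_lip hσ hσ1 h
  obtain ⟨C2, hC2, hm⟩ := mm_rpow_le D.hp0 hσ1.le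
  refine ⟨C * C2 * 2, by positivity, fun n hn N a => ?_⟩
  have hn' : (0 : ℝ) < n := by exact_mod_cast hn
  refine (hu (N a) (mm p n a) (mm_pos D.hp0 hn a)).trans ?_
  have e : (n : ℝ) ^ (σ - 1 / 2) = (n : ℝ) ^ (σ - 1) * √n := by
    rw [Real.sqrt_eq_rpow, ← Real.rpow_add hn']; congr 1; ring
  calc _ ≤ C * (C2 * (n : ℝ) ^ (σ - 1)) * (2 * √n * chi p n N) := by
        gcongr
        · exact hm n hn a
        · exact sub_mm_le D.hp0 hn N a
    _ = _ := by rw [e]; ring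

lemma ν_path {σ : ℝ} (hσ : 0 < σ) (hσ1 : σ < 1) (h : M * ∑ a, p a ^ (1 + σ) < 1) :
    ∃ C, 0 < C ∧ ∀ n : ℕ, 1 ≤ n → ∀ N : Fin A → ℕ, ∀ a,
      |ν (N a) - ν (mm p n a) - du ν (mm p n a) * ((N a : ℝ) - mm p n a)| ≤ C * (n : ℝ) ^ σ * chi p n N := by
  obtain ⟨C, hC, hu⟩ := D.u_lip hσ hσ1 h
  obtain ⟨C2, hC2, hm⟩ := mm_rpow_le D.hp0 hσ1.le
  refine ⟨C * C2 * 4, by positivity, fun n hn N a => ?_⟩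
  have hn' : (0 : ℝ) < n := by exact_mod_cast hn
  have hmp := mm_pos D.hp0 hn a
  refine (taylor_disc ν (du ν (mm p n a)) (C * (mm p n a : ℝ) ^ (σ - 1)) (mm p n a) (by positivity)
    (fun j => hu j _ hmp) (N a)).trans ?_
  have e : (n : ℝ) ^ σ = (n : ℝ) ^ (σ - 1) * n := by
    rw [Real.rpow_sub hn', Real.rpow_one]; field_simp
  calc _ ≤ C * (C2 * (n : ℝ) ^ (σ - 1)) * (4 * n * chi p n N) := by
        gcongr
        · exact hm n hn a
        · exact sub_mm_sq_le D.hp0 hn N a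
    _ = _ := by rw [e]; ring

end Dat
end A4

open Filter Topology

section A5
variable {A : ℕ} {p : Fin A → ℝ} {M : ℝ}

/-- the split total -/
def GG (ν : ℕ → ℝ) (N : Fin A → ℕ) : ℝ := ∑ a, ν (N a)

/-- linear coefficient -/
noncomputable def xi (p : Fin A → ℝ) (ν : ℕ → ℝ) (n : ℕ) (a : Fin A) : ℝ :=
  du ν (mm p n a) - ∑ b, p b * du ν (mm p n b)

/-- linear part -/
noncomputable def LL (p : Fin A → ℝ) (ν : ℕ → ℝ) (n : ℕ) (N : Fin A → ℕ) : ℝ :=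
  ∑ a, xi p ν n a * N a

lemma xi_sum (hp : ∑ a, p a = 1) (ν : ℕ → ℝ) (n : ℕ) : ∑ a, p a * xi p ν n a = 0 := by
  unfold xi
  simp_rw [mul_sub, Finset.sum_sub_distrib, ← Finset.sum_mul, hp]; ring

lemma LL_eq (hp : ∑ a, p a = 1) (ν : ℕ → ℝ) (n : ℕ) (N : Fin A → ℕ) :
    LL p ν n N = ∑ a, xi p ν n a * ((N a : ℝ) - n * p a) := by
  have := xi_sum hp ν n
  unfold LL
  simp_rw [mul_sub, Finset.sum_sub_distrib]
  have e : ∑ a, xi p ν n a * (n * p a) = n * ∑ a, p a * xi p ν n a := by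
    rw [Finset.mul_sum]; exact Finset.sum_congr rfl fun a _ => by ring
  rw [e, this]; ring

lemma Ex_LL (hp : ∑ a, p a = 1) (ν : ℕ → ℝ) (n : ℕ) : Ex p n (LL p ν n) = 0 := by
  have e : LL p ν n = fun N => ∑ a, xi p ν n a * (N a : ℝ) := rfl
  rw [e, Ex_sum]
  simp_rw [Ex_mul, Ex_mean n _ hp]
  have := xi_sum hp ν n
  have e : ∑ a, xi p ν n a * (n * p a) = n * ∑ a, p a * xi p ν n a := by
    rw [Finset.mul_sum]; exact Finset.sum_congr rfl fun a _ => by ring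
  rw [e, this]; ring

lemma wavg_le (hp0 : ∀ a, 0 ≤ p a) (hp : ∑ a, p a = 1) (f : Fin A → ℝ) (c B : ℝ)
    (h : ∀ b, |c - f b| ≤ B) : |c - ∑ b, p b * f b| ≤ B := by
  have e : c - ∑ b, p b * f b = ∑ b, p b * (c - f b) := by
    simp_rw [mul_sub, Finset.sum_sub_distrib, ← Finset.sum_mul, hp]; ring
  rw [e]
  calc _ ≤ ∑ b, |p b * (c - f b)| := Finset.abs_sum_le_sum_abs _ _
    _ ≤ ∑ b, p b * B := Finset.sum_le_sum fun b _ => by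
        rw [abs_mul, abs_of_nonneg (hp0 b)]; exact mul_le_mul_of_nonneg_left (h b) (hp0 b)
    _ = B := by rw [← Finset.sum_mul, hp, one_mul]

/-- standing hypotheses on exponents -/
structure Xp (p : Fin A → ℝ) (M : ℝ) (ν v : ℕ → ℝ) (σ α η : ℝ) : Prop where
  D : Dat p M ν v
  hσ : 0 < σ
  hσ1 : σ < 1
  h : M * ∑ a, p a ^ (1 + σ) < 1
  hα : σ ≤ α
  hα' : α ≤ σ + 1 / 2
  hx : ∃ C, 0 < C ∧ ∀ n : ℕ, 1 ≤ n → ∀ a b, |du ν (mm p n a) - du ν (mm p n b)| ≤ C * (n : ℝ) ^ (α - 1 / 2)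
  hη1 : 1 ≤ η
  hη : α + σ + 1 / 2 ≤ η
  hη' : M * ∑ a, p a ^ η < 1

namespace Xp
variable {ν v : ℕ → ℝ} {σ α η : ℝ} (X : Xp p M ν v σ α η)
include X

lemma xi_b : ∃ C, 0 < C ∧ ∀ n : ℕ, 1 ≤ n → ∀ a, |xi p ν n a| ≤ C * (n : ℝ) ^ (α - 1 / 2) := by
  obtain ⟨C, hC, h⟩ := X.hx
  exact ⟨C, hC, fun n hn a => wavg_le X.D.hp0' X.D.hp _ _ _ (h n hn a)⟩

lemma LL_b : ∃ C, 0 < C ∧ ∀ n : ℕ, 1 ≤ n → ∀ N : Fin A → ℕ, |LL p ν n N| ≤ C * (n : ℝ) ^ α * chi p n N := by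
  obtain ⟨C, hC, h⟩ := X.xi_b
  have hA : (0 : ℝ) < A := by exact_mod_cast (by have := X.D.hA; omega : 0 < A)
  refine ⟨A * C, by positivity, fun n hn N => ?_⟩
  have hn' : (0 : ℝ) < n := by exact_mod_cast hn
  rw [LL_eq X.D.hp]
  have e : (n : ℝ) ^ α = (n : ℝ) ^ (α - 1 / 2) * √n := by
    rw [Real.sqrt_eq_rpow, ← Real.rpow_add hn']; congr 1; ring
  calc _ ≤ ∑ a, |xi p ν n a * ((N a : ℝ) - n * p a)| := Finset.abs_sum_le_sum_abs _ _
    _ ≤ ∑ a : Fin A, (C * (n : ℝ) ^ (α - 1 / 2)) * (√n * chi p n N) := Finset.sum_le_sum fun a _ => by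
        rw [abs_mul]
        exact mul_le_mul (h n hn a) (delta_le_chi hn N a) (abs_nonneg _) (by positivity)
    _ = _ := by rw [e]; simp; ring

lemma R_b : ∃ C, 0 < C ∧ ∀ n : ℕ, 1 ≤ n → ∀ N : Fin A → ℕ, ∑ a, N a = n →
    |GG ν N - Ex p n (GG ν) - LL p ν n N| ≤ C * (n : ℝ) ^ σ * chi p n N := by
  obtain ⟨C, hC, h⟩ := X.D.ν_path X.hσ X.hσ1 X.h
  obtain ⟨K, hK, hE⟩ := chi_moment X.D.hp0' X.D.hp
  have hA : (0 : ℝ) < A := by exact_mod_cast (by have := X.D.hA; omega : 0 < A)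
  refine ⟨2 * K * (A * C), by positivity, fun n hn N hN => ?_⟩
  have hn' : (0 : ℝ) < n := by exact_mod_cast hn
  have := center_chi X.D.hp0' X.D.hp hK (by simpa using hE n hn 1 (by norm_num)) (fun N => GG ν N - LL p ν n N)
    (∑ a, ν (mm p n a) - ∑ a, du ν (mm p n a) * mm p n a + n * ∑ b, p b * du ν (mm p n b))
    (A * C * (n : ℝ) ^ σ) (by positivity) ?_ N hN
  · rw [Ex_sub, Ex_LL X.D.hp, sub_zero] at this
    have e : GG ν N - Ex p n (GG ν) - LL p ν n N = GG ν N - LL p ν n N - Ex p n (GG ν) := by ring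
    rw [e]; refine this.trans (le_of_eq ?_); ring
  · intro N hN
    have hN' : (n : ℝ) = ∑ a, (N a : ℝ) := by rw [← hN]; push_cast; rfl
    have e : GG ν N - LL p ν n N - (∑ a, ν (mm p n a) - ∑ a, du ν (mm p n a) * mm p n a + n * ∑ b, p b * du ν (mm p n b))
      = ∑ a, (ν (N a) - ν (mm p n a) - du ν (mm p n a) * ((N a : ℝ) - mm p n a)) := by
      unfold GG LL xi
      obtain ⟨q, hq⟩ : ∃ q, q = ∑ b, p b * du ν (mm p n b) := ⟨_, rfl⟩
      rw [← hq]
      simp_rw [sub_mul, mul_sub, Finset.sum_sub_distrib, ← Finset.mul_sum]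
      rw [hN']; ring
    rw [e]
    calc _ ≤ _ := Finset.abs_sum_le_sum_abs _ _
      _ ≤ ∑ a : Fin A, (C * (n : ℝ) ^ σ * chi p n N) := Finset.sum_le_sum fun a _ => h n hn N a
      _ = _ := by simp; ring

lemma Δ_b : ∃ C, 0 < C ∧ ∀ n : ℕ, 1 ≤ n → ∀ N : Fin A → ℕ, ∑ a, N a = n →
    |GG ν N - Ex p n (GG ν)| ≤ C * (n : ℝ) ^ α * chi p n N := by
  obtain ⟨C, hC, h⟩ := X.R_b
  obtain ⟨C', hC', h'⟩ := X.LL_b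
  refine ⟨C + C', by positivity, fun n hn N hN => ?_⟩
  have hn' : (1 : ℝ) ≤ n := by exact_mod_cast hn
  have h1 : (n : ℝ) ^ σ ≤ (n : ℝ) ^ α := Real.rpow_le_rpow_of_exponent_le hn' X.hα
  have h2 := one_le_chi (p := p) n N
  have h3 := abs_add_le (GG ν N - Ex p n (GG ν) - LL p ν n N) (LL p ν n N)
  rw [sub_add_cancel] at h3
  have h4 : C * (n : ℝ) ^ σ * chi p n N ≤ C * (n : ℝ) ^ α * chi p n N := by gcongr
  have := h n hn N hN
  have := h' n hn N
  calc _ ≤ _ := h3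
    _ ≤ C * (n : ℝ) ^ α * chi p n N + C' * (n : ℝ) ^ α * chi p n N := by linarith
    _ = _ := by ring

lemma du_spread : ∃ C, 0 < C ∧ ∀ n : ℕ, 1 ≤ n → ∀ N : Fin A → ℕ, ∀ a,
    |du ν (N a) - ∑ b, p b * du ν (N b)| ≤ C * (n : ℝ) ^ (α - 1 / 2) * chi p n N := by
  obtain ⟨C, hC, h⟩ := X.D.u_path X.hσ X.hσ1 X.h
  obtain ⟨C', hC', h'⟩ := X.hx
  refine ⟨2 * C + C', by positivity, fun n hn N a => wavg_le X.D.hp0' X.D.hp _ _ _ fun b => ?_⟩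
  have hn' : (1 : ℝ) ≤ n := by exact_mod_cast hn
  have h1 : (n : ℝ) ^ (σ - 1 / 2) ≤ (n : ℝ) ^ (α - 1 / 2) := 
    Real.rpow_le_rpow_of_exponent_le hn' (by linarith [X.hα])
  have h2 := one_le_chi (p := p) n N
  have h4 : C * (n : ℝ) ^ (σ - 1 / 2) * chi p n N ≤ C * (n : ℝ) ^ (α - 1 / 2) * chi p n N := by gcongr
  have h5 : C' * (n : ℝ) ^ (α - 1 / 2) ≤ C' * (n : ℝ) ^ (α - 1 / 2) * chi p n N :=
    le_mul_of_one_le_right (by positivity) h2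
  have e1 := h n hn N a
  have e2 := h n hn N b
  have e3 := h' n hn a b
  have e : (2 * C + C') * (n : ℝ) ^ (α - 1 / 2) * chi p n N = 2 * (C * (n : ℝ) ^ (α - 1 / 2) * chi p n N) +
    C' * (n : ℝ) ^ (α - 1 / 2) * chi p n N := by ring
  rw [e]
  rw [abs_le] at *
  constructor <;> linarith

lemma h_b : ∃ C, 0 < C ∧ ∀ n : ℕ, 1 ≤ n → ∀ N : Fin A → ℕ, ∑ a, N a = n →
    |∑ b, p b * du ν (N b) - Ex p n (fun N => ∑ b, p b * du ν (N b))| ≤ C * (n : ℝ) ^ (σ - 1 / 2) * chi p n N := by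
  obtain ⟨C, hC, h⟩ := X.D.u_path X.hσ X.hσ1 X.h
  obtain ⟨K, hK, hE⟩ := chi_moment X.D.hp0' X.D.hp
  refine ⟨2 * K * C, by positivity, fun n hn N hN => ?_⟩
  have hn' : (0 : ℝ) < n := by exact_mod_cast hn
  have := center_chi X.D.hp0' X.D.hp hK (by simpa using hE n hn 1 (by norm_num)) (fun N => ∑ b, p b * du ν (N b))
    (∑ b, p b * du ν (mm p n b)) (C * (n : ℝ) ^ (σ - 1 / 2)) (by positivity) ?_ N hN
  · refine this.trans (le_of_eq ?_); ring
  · intro N hN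
    rw [← Finset.sum_sub_distrib]
    simp_rw [← mul_sub]
    calc _ ≤ _ := Finset.abs_sum_le_sum_abs _ _
      _ ≤ ∑ b, p b * (C * (n : ℝ) ^ (σ - 1 / 2) * chi p n N) := Finset.sum_le_sum fun b _ => by
        rw [abs_mul, abs_of_nonneg (X.D.hp0' b)]; exact mul_le_mul_of_nonneg_left (h n hn N b) (X.D.hp0' b)
      _ = _ := by rw [← Finset.sum_mul, X.D.hp, one_mul]

lemma t_b : ∃ C, 0 < C ∧ ∀ n : ℕ, 1 ≤ n → 
    |Vx p (n + 1) (GG ν) - Vx p n (GG ν)| ≤ C * (n : ℝ) ^ (η - 1) := by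
  obtain ⟨C1, hC1, h1⟩ := X.du_spread
  obtain ⟨C2, hC2, h2⟩ := X.h_b
  obtain ⟨C3, hC3, h3⟩ := X.Δ_b
  obtain ⟨K, hK, hE⟩ := chi_moment X.D.hp0' X.D.hp
  refine ⟨(C1 ^ 2 + C2 * (2 * C3 + C2)) * K, by positivity, fun n hn => ?_⟩
  have hn' : (0 : ℝ) < n := by exact_mod_cast hn
  have hn1 : (1 : ℝ) ≤ n := by exact_mod_cast hn
  have hF : ∀ N : Fin A → ℕ, ∀ a, GG ν (N + Pi.single a 1) = GG ν N + du ν (N a) := by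
    intro N a
    unfold GG
    rw [← Finset.add_sum_erase _ _ (Finset.mem_univ a), ← Finset.add_sum_erase _ (fun b => ν (N b)) (Finset.mem_univ a)]
    have : ∑ x ∈ Finset.univ.erase a, ν ((N + Pi.single a 1 : Fin A → ℕ) x) = ∑ x ∈ Finset.univ.erase a, ν (N x) := by
      refine Finset.sum_congr rfl fun b hb => ?_
      have hb' : b ≠ a := (Finset.mem_erase.1 hb).1
      simp [hb']
    rw [this]; simp [du]; ring
  have hF2 : ∀ N : Fin A → ℕ, ∑ b, p b * GG ν (N + Pi.single b 1) = GG ν N + ∑ b, p b * du ν (N b) := by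
    intro N
    simp_rw [hF, mul_add, Finset.sum_add_distrib, ← Finset.sum_mul, X.D.hp, one_mul]
  rw [Vx_succ X.D.hp]
  simp_rw [hF2, hF]
  obtain ⟨H, hH⟩ : ∃ H : (Fin A → ℕ) → ℝ, H = fun N => ∑ b, p b * du ν (N b) := ⟨_, rfl⟩
  have hH' : ∀ N, ∑ b, p b * du ν (N b) = H N := fun N => by rw [hH]
  simp_rw [hH'] at h1 h2 ⊢
  rw [add_sub_assoc]
  set e := η - 1 with he
  have p1 : (n : ℝ) ^ (α - 1 / 2) * (n : ℝ) ^ (α - 1 / 2) ≤ (n : ℝ) ^ e := by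
    rw [← Real.rpow_add hn']
    exact Real.rpow_le_rpow_of_exponent_le hn1 (by linarith [X.hα', X.hη])
  have p2 : (n : ℝ) ^ (σ - 1 / 2) * (n : ℝ) ^ α ≤ (n : ℝ) ^ e := by
    rw [← Real.rpow_add hn']
    exact Real.rpow_le_rpow_of_exponent_le hn1 (by linarith [X.hα', X.hη])
  have p3 : (n : ℝ) ^ (σ - 1 / 2) * (n : ℝ) ^ (σ - 1 / 2) ≤ (n : ℝ) ^ e := by
    rw [← Real.rpow_add hn']
    exact Real.rpow_le_rpow_of_exponent_le hn1 (by linarith [X.hα', X.hα, X.hη])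
  have k2 := hE n hn 2 (by norm_num)
  have a1 : |Ex p n (fun N => ∑ a, p a * (GG ν N + du ν (N a) - (GG ν N + H N)) ^ 2)| ≤ C1 ^ 2 * K * (n : ℝ) ^ e := by
    rw [abs_of_nonneg (Ex_nonneg X.D.hp0' fun N _ => Finset.sum_nonneg fun a _ => mul_nonneg (X.D.hp0' a) (sq_nonneg _))]
    calc _ ≤ Ex p n (fun N => (C1 ^ 2 * (n : ℝ) ^ e) * chi p n N ^ 2) := by
          refine Ex_mono X.D.hp0' fun N _ => ?_
          calc _ ≤ ∑ a, p a * ((C1 ^ 2 * (n : ℝ) ^ e) * chi p n N ^ 2) := by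
                refine Finset.sum_le_sum fun a _ => mul_le_mul_of_nonneg_left ?_ (X.D.hp0' a)
                rw [add_sub_add_left_eq_sub, ← sq_abs]
                have h0 := h1 n hn N a
                calc _ ≤ (C1 * (n : ℝ) ^ (α - 1 / 2) * chi p n N) ^ 2 := by gcongr
                  _ = C1 ^ 2 * ((n : ℝ) ^ (α - 1 / 2) * (n : ℝ) ^ (α - 1 / 2)) * chi p n N ^ 2 := by ring
                  _ ≤ _ := by gcongr
            _ = _ := by rw [← Finset.sum_mul, X.D.hp, one_mul]
      _ = C1 ^ 2 * (n : ℝ) ^ e * Ex p n (fun N => chi p n N ^ 2) := Ex_mul _ _ _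
      _ ≤ C1 ^ 2 * (n : ℝ) ^ e * K := by gcongr
      _ = _ := by ring
  have a2 : |Vx p n (fun N => GG ν N + H N) - Vx p n (GG ν)| ≤ C2 * (2 * C3 + C2) * K * (n : ℝ) ^ e := by
    unfold Vx
    rw [Ex_add, ← Ex_sub]
    refine (abs_Ex_le X.D.hp0' n _).trans ?_
    calc _ ≤ Ex p n (fun N => (C2 * (2 * C3 + C2) * (n : ℝ) ^ e) * chi p n N ^ 2) := by
          refine Ex_mono X.D.hp0' fun N hN => ?_
          have g2 := h2 n hn N hN
          have g3 := h3 n hn N hN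
          set x := GG ν N - Ex p n (GG ν)
          set y := H N - Ex p n H
          have e1 : (GG ν N + H N - (Ex p n (GG ν) + Ex p n H)) ^ 2 - x ^ 2 = y * (2 * x + y) := by ring
          have hχ : 0 ≤ chi p n N := by linarith [one_le_chi (p := p) n N]
          change |(GG ν N + H N - (Ex p n (GG ν) + Ex p n H)) ^ 2 - x ^ 2| ≤ _
          rw [e1, abs_mul]
          have g4 : |2 * x + y| ≤ 2 * |x| + |y| := by
            refine (abs_add_le _ _).trans ?_
            rw [abs_mul, abs_two]
          calc _ ≤ (C2 * (n : ℝ) ^ (σ - 1 / 2) * chi p n N) * (2 * (C3 * (n : ℝ) ^ α * chi p n N) + C2 * (n : ℝ) ^ (σ - 1 / 2) * chi p n N) := by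
                refine mul_le_mul g2 (g4.trans ?_) (abs_nonneg _) (by positivity)
                linarith
            _ = (C2 * 2 * C3 * ((n : ℝ) ^ (σ - 1 / 2) * (n : ℝ) ^ α) + C2 * C2 * ((n : ℝ) ^ (σ - 1 / 2) * (n : ℝ) ^ (σ - 1 / 2))) * chi p n N ^ 2 := by ring
            _ ≤ (C2 * 2 * C3 * ((n : ℝ) ^ e) + C2 * C2 * ((n : ℝ) ^ e)) * chi p n N ^ 2 := by gcongr
            _ = _ := by ring
      _ = C2 * (2 * C3 + C2) * (n : ℝ) ^ e * Ex p n (fun N => chi p n N ^ 2) := Ex_mul _ _ _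
      _ ≤ C2 * (2 * C3 + C2) * (n : ℝ) ^ e * K := by gcongr
      _ = _ := by ring
  refine (abs_add_le _ _).trans ((add_le_add a1 a2).trans (le_of_eq ?_))
  ring

lemma dv_b : ∃ C, 0 < C ∧ ∀ n : ℕ, |du v n| ≤ C * ((n : ℝ) + 1) ^ (η - 1) := by
  obtain ⟨C, hC, ht⟩ := X.t_b
  have D := X.D
  have hv : ∀ n, v n = M * Vx p n (GG ν) + M * ∑ a, p a ^ 0 * Ex p n (fun N => v (N a)) := by
    intro n
    simp only [pow_zero, one_mul]
    by_cases hn : 2 ≤ n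
    · rw [D.vr n hn, Ex_sum, mul_add, add_comm]; rfl
    · have h1 : ∀ a, Ex p n (fun N => v (N a)) = 0 := by
        intro a
        rw [← Ex_zero' (p := p) n]
        refine Ex_congr fun N hN => D.v_small ?_
        have := le_of_sum_eq hN a; omega
      have h2 : Vx p n (GG ν) = 0 := by
        have e : ∀ N : Fin A → ℕ, ∑ a, N a = n → GG ν N = 0 := fun N hN =>
          Finset.sum_eq_zero fun a _ => D.ν_small (by have := le_of_sum_eq hN a; omega)
        have e1 : Ex p n (GG ν) = 0 := by
          rw [← Ex_zero' (p := p) n]; exact Ex_congr e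
        unfold Vx
        rw [e1]
        exact (Ex_congr fun N hN => by rw [e N hN]; simp).trans (Ex_zero' (p := p) n)
      simp [h1, h2, D.v_small (show n ≤ 1 by omega)]
  have hd := diff_rec D.hp 0 v (fun n => M * Vx p n (GG ν)) hv
  have hZ := Z1_rec (du v) (fun n => M * Vx p (n + 1) (GG ν) - M * Vx p n (GG ν)) hd
  have hη0 : 0 < η := by linarith [X.hη1]
  obtain ⟨C1, hC1, H⟩ := GU D.hp0' D.hp D.hM0.le D.hq hη0 X.hη'
  have hM0 := D.hM0
  have := H (fun n => |(n : ℝ) * du v (n - 1)|) (M * C) (by positivity) (fun n => abs_nonneg _) (by simp)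
    (by simp [du, D.v0, D.v1]; positivity) (fun n hn => by
      refine (abs_rec D.hp0' D.hM0.le (X := fun n => (n : ℝ) * du v (n - 1)) (hZ n (by omega))).trans ?_
      gcongr
      have hn' : (0 : ℝ) < n := by exact_mod_cast (by omega : 0 < n)
      rw [← mul_sub, abs_mul, abs_mul, abs_of_pos hn', abs_of_pos hM0]
      have h1 := ht (n - 1) (by omega)
      have h2 : ((n - 1 : ℕ) : ℝ) ^ (η - 1) ≤ (n : ℝ) ^ (η - 1) :=
        Real.rpow_le_rpow (by positivity) (by exact_mod_cast Nat.sub_le n 1) (by linarith [X.hη1])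
      calc _ ≤ (n : ℝ) * (M * (C * (n : ℝ) ^ (η - 1))) := by
            gcongr
            exact h1.trans (by gcongr)
        _ = _ := by rw [Real.rpow_sub hn', Real.rpow_one]; field_simp)
  refine ⟨C1 * (M * C), by positivity, fun n => ?_⟩
  have h1 := this (n + 1)
  simp only [Nat.add_sub_cancel] at h1
  have hn : (0 : ℝ) < (n : ℝ) + 1 := by positivity
  push_cast at h1
  rw [abs_mul, abs_of_pos hn] at h1
  rw [Real.rpow_sub hn, Real.rpow_one, mul_div_assoc', le_div_iff₀ hn]
  linarith

lemma v_lip : ∃ C, 0 < C ∧ ∀ n l m : ℕ, l ≤ n → m ≤ n → |v l - v m| ≤ C * (n : ℝ) ^ (η - 1) * |(l : ℝ) - m| := by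
  obtain ⟨C, hC, h⟩ := X.dv_b
  refine ⟨C, hC, fun n => ?_⟩
  have key : ∀ d m : ℕ, m + d ≤ n → |v (m + d) - v m| ≤ C * (n : ℝ) ^ (η - 1) * d := by
    intro d m
    induction d with
    | zero => intro _; simp
    | succ d ih =>
      intro hd
      have h1 := ih (by omega)
      have h2 := h (m + d)
      have h3 : ((m + d : ℕ) + 1 : ℝ) ^ (η - 1) ≤ (n : ℝ) ^ (η - 1) :=
        Real.rpow_le_rpow (by positivity) (by exact_mod_cast hd) (by linarith [X.hη1])
      have h4 : |du v (m + d)| ≤ C * (n : ℝ) ^ (η - 1) := h2.trans (by gcongr)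
      have e : v (m + (d + 1)) - v m = du v (m + d) + (v (m + d) - v m) := by
        unfold du; rw [← add_assoc]; ring
      rw [e]
      refine (abs_add_le _ _).trans ((add_le_add h4 h1).trans (le_of_eq ?_))
      push_cast; ring
  intro l m hl hm
  rcases le_total m l with hml | hml
  · obtain ⟨d, rfl⟩ := Nat.exists_eq_add_of_le hml
    have := key d m hl
    have e : |((m + d : ℕ) : ℝ) - m| = d := by push_cast; rw [add_sub_cancel_left, abs_of_nonneg (by positivity)]
    rwa [e]
  · obtain ⟨d, rfl⟩ := Nat.exists_eq_add_of_le hml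
    have := key d l hm
    have e : |(l : ℝ) - ((l + d : ℕ) : ℝ)| = d := by 
      rw [abs_sub_comm]; push_cast; rw [add_sub_cancel_left, abs_of_nonneg (by positivity)]
    rwa [e, abs_sub_comm]

lemma Y_b : ∃ C, 0 < C ∧ ∀ n : ℕ, 1 ≤ n → ∀ N : Fin A → ℕ, ∑ a, N a = n →
    |GG v N - Ex p n (GG v)| ≤ C * (n : ℝ) ^ (η - 1 / 2) * chi p n N := by
  obtain ⟨C, hC, h⟩ := X.v_lip
  obtain ⟨K, hK, hE⟩ := chi_moment X.D.hp0' X.D.hp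
  have hA : (0 : ℝ) < A := by exact_mod_cast (by have := X.D.hA; omega : 0 < A)
  refine ⟨2 * K * (A * C * 2), by positivity, fun n hn N hN => ?_⟩
  have hn' : (0 : ℝ) < n := by exact_mod_cast hn
  have := center_chi X.D.hp0' X.D.hp hK (by simpa using hE n hn 1 (by norm_num)) (GG v)
    (∑ a, v (mm p n a)) (A * C * 2 * (n : ℝ) ^ (η - 1 / 2)) (by positivity) ?_ N hN
  · refine this.trans (le_of_eq ?_); ring
  · intro N hN
    unfold GG
    rw [← Finset.sum_sub_distrib]
    have e : (n : ℝ) ^ (η - 1 / 2) = (n : ℝ) ^ (η - 1) * √n := by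
      rw [Real.sqrt_eq_rpow, ← Real.rpow_add hn']; congr 1; ring
    calc _ ≤ _ := Finset.abs_sum_le_sum_abs _ _
      _ ≤ ∑ a : Fin A, (C * (n : ℝ) ^ (η - 1) * (2 * √n * chi p n N)) := Finset.sum_le_sum fun a _ => by
        refine (h n (N a) (mm p n a) (le_of_sum_eq hN a) (mm_le X.D.hp0 X.D.hp n a)).trans ?_
        gcongr
        exact sub_mm_le X.D.hp0 hn N a
      _ = _ := by rw [e]; simp; ring

end Xp
end A5

open Filter Topology

section A6
variable {A : ℕ} {p : Fin A → ℝ} {M : ℝ}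

lemma Ex_cmul (n : ℕ) (c : ℂ) (F : (Fin A → ℕ) → ℂ) :
    Ex p n (fun N => c * F N) = c * Ex p n F := by
  simp only [Ex_eq_sum, Finset.mul_sum, mul_smul_comm]

lemma Ex_ofReal (n : ℕ) (F : (Fin A → ℕ) → ℝ) :
    Ex p n (fun N => (F N : ℂ)) = ((Ex p n F : ℝ) : ℂ) := by
  simp only [Ex_eq_sum]
  push_cast
  refine Finset.sum_congr rfl fun ℓ _ => ?_
  rw [Complex.real_smul, smul_eq_mul]; push_cast; rfl

/-- `e^{ix}` -/
noncomputable def ei (x : ℝ) : ℂ := Complex.exp ((x : ℂ) * Complex.I)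

lemma ei_norm (x : ℝ) : ‖ei x‖ = 1 := Complex.norm_exp_ofReal_mul_I x

lemma ei_add (x y : ℝ) : ei (x + y) = ei x * ei y := by
  unfold ei; rw [← Complex.exp_add]; push_cast; ring_nf

lemma ei_b1 (x : ℝ) : ‖ei x - 1‖ ≤ |x| := by
  have := Real.norm_exp_I_mul_ofReal_sub_one_le (x := x)
  rwa [mul_comm, Real.norm_eq_abs] at this

lemma ei_b2 (x : ℝ) : ‖ei x - 1 - x * Complex.I‖ ≤ 3 * |x| ^ 2 := by
  have hn : ‖(x : ℂ) * Complex.I‖ = |x| := by simp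
  by_cases h : |x| ≤ 1
  · have := Complex.norm_exp_sub_one_sub_id_le (x := (x : ℂ) * Complex.I) (by rw [hn]; exact h)
    rw [hn] at this
    unfold ei
    nlinarith [sq_nonneg |x|]
  · have h1 := ei_b1 x
    have h2 := norm_sub_le (ei x - 1) (x * Complex.I)
    rw [hn] at h2
    nlinarith

lemma ei_b3 (x : ℝ) : ‖ei x - 1 - x * Complex.I + (x : ℂ) ^ 2 / 2‖ ≤ 4 * |x| ^ 3 := by
  have hn : ‖(x : ℂ) * Complex.I‖ = |x| := by simp
  have e2 : ((x : ℂ) * Complex.I) ^ 2 = - (x : ℂ) ^ 2 := by rw [mul_pow, Complex.I_sq]; ring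
  by_cases h : |x| ≤ 1
  · have := Complex.exp_bound (x := (x : ℂ) * Complex.I) (by rw [hn]; exact h) (n := 3) (by norm_num)
    rw [hn] at this
    simp only [Finset.sum_range_succ, Finset.sum_range_zero, e2] at this
    norm_num [Nat.factorial] at this
    have e : ei x - 1 - x * Complex.I + (x : ℂ) ^ 2 / 2 =
      Complex.exp ((x : ℂ) * Complex.I) - (1 + (x : ℂ) * Complex.I + -(x : ℂ) ^ 2 / 2) := by
      unfold ei; ring
    rw [e]
    have h3 : 0 ≤ |x| ^ 3 := by positivity
    refine this.trans ?_
    linarith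
  · have h1 := ei_b2 x
    have h2 := norm_add_le (ei x - 1 - x * Complex.I) ((x : ℂ) ^ 2 / 2)
    have h3 : ‖(x : ℂ) ^ 2 / 2‖ = |x| ^ 2 / 2 := by simp
    rw [h3] at h2
    have : |x| ^ 3 = |x| ^ 2 * |x| := by ring
    nlinarith [sq_nonneg |x|]

lemma h_diff (L R : ℝ) : ‖(ei (L + R) - 1 - ((L + R : ℝ) : ℂ) * Complex.I + ((L + R : ℝ) : ℂ) ^ 2 / 2) -
    (ei L - 1 - (L : ℂ) * Complex.I + (L : ℂ) ^ 2 / 2)‖ ≤ 4 * |R| ^ 3 + |L| * |R| ^ 2 + 3 * |L| ^ 2 * |R| := by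
  have e : (ei (L + R) - 1 - ((L + R : ℝ) : ℂ) * Complex.I + ((L + R : ℝ) : ℂ) ^ 2 / 2) -
    (ei L - 1 - (L : ℂ) * Complex.I + (L : ℂ) ^ 2 / 2) = 
    ei L * (ei R - 1 - R * Complex.I + (R : ℂ) ^ 2 / 2) - (ei L - 1) * ((R : ℂ) ^ 2 / 2)
      + (ei L - 1 - L * Complex.I) * (R * Complex.I) := by
    rw [ei_add]; push_cast
    ring_nf
    rw [Complex.I_sq]; ring
  rw [e]
  refine (norm_add_le _ _).trans ((add_le_add_left (norm_sub_le _ _) _).trans ?_)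
  rw [norm_mul, norm_mul, norm_mul, ei_norm]
  have h1 : ‖(R : ℂ) ^ 2 / 2‖ = |R| ^ 2 / 2 := by simp
  have h2 : ‖(R : ℂ) * Complex.I‖ = |R| := by simp
  rw [h1, h2]
  have a1 := ei_b3 R
  have a2 : ‖ei L - 1‖ * (|R| ^ 2 / 2) ≤ |L| * |R| ^ 2 := by
    refine mul_le_mul (ei_b1 L) ?_ (by positivity) (abs_nonneg _)
    nlinarith [sq_nonneg |R|]
  have a3 : ‖ei L - 1 - L * Complex.I‖ * |R| ≤ 3 * |L| ^ 2 * |R| := by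
    gcongr; exact ei_b2 L
  linarith

lemma one_sub_exp_le {y : ℝ} (hy : 0 ≤ y) : 1 - Real.exp (-y) ≤ √y := by
  by_cases h : y ≤ 1
  · have h1 : y ≤ √y := by
      have := Real.sq_sqrt hy
      have h2 : √y ≤ 1 := Real.sqrt_le_one.2 h
      nlinarith [Real.sqrt_nonneg y]
    linarith [Real.add_one_le_exp (-y)]
  · have : 1 ≤ √y := Real.one_le_sqrt.2 (by linarith)
    linarith [Real.exp_pos (-y)]

lemma k_diff' {x y : ℝ} (hx : 0 ≤ x) (h : x ≤ y) :
    |(Real.exp (-y) + y) - (Real.exp (-x) + x)| ≤ (y - x) * √y := by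
  have hy : 0 ≤ y := hx.trans h
  have h1 := one_sub_exp_le hy
  have h2 : Real.exp (-x) = Real.exp (-y) * Real.exp (y - x) := by rw [← Real.exp_add]; congr 1; ring
  have h3 := Real.add_one_le_exp (y - x)
  have h4 := Real.exp_pos (-y)
  have h5 : Real.exp (-y) = Real.exp (-x) * Real.exp (-(y - x)) := by rw [← Real.exp_add]; congr 1; ring
  have h6 := Real.add_one_le_exp (-(y - x))
  have h7 : Real.exp (-x) ≤ 1 := Real.exp_le_one_iff.2 (by linarith)
  have h8 := Real.exp_pos (-x)
  rw [abs_of_nonneg]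
  · nlinarith
  · nlinarith

lemma k_diff {x y S : ℝ} (hx : 0 ≤ x) (hy : 0 ≤ y) (hxS : x ≤ S) (hyS : y ≤ S) :
    |(Real.exp (-y) + y) - (Real.exp (-x) + x)| ≤ |y - x| * √S := by
  rcases le_total x y with h | h
  · refine (k_diff' hx h).trans ?_
    rw [abs_of_nonneg (by linarith : 0 ≤ y - x)]
    have := Real.sqrt_le_sqrt hyS
    exact mul_le_mul_of_nonneg_left this (by linarith)
  · rw [abs_sub_comm]
    refine (k_diff' hy h).trans ?_
    rw [abs_of_nonpos (by linarith : y - x ≤ 0)]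
    have := Real.sqrt_le_sqrt hxS
    nlinarith [Real.sqrt_nonneg x]

lemma k_zero {x : ℝ} (hx : 0 ≤ x) : |Real.exp (-x) - 1 + x| ≤ x * √x := by
  have := k_diff' le_rfl hx
  simp only [neg_zero, Real.exp_zero, add_zero, sub_zero] at this
  have e : Real.exp (-x) - 1 + x = Real.exp (-x) + x - 1 := by ring
  rwa [e]

lemma exp_r {x y : ℝ} (hx : 0 ≤ x) (hy : 0 ≤ y) :
    |Real.exp (-x) - Real.exp (-y) + Real.exp (-y) * (x - y)| ≤ |x - y| * √|x - y| := by
  rcases le_total y x with h | h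
  · have hd : 0 ≤ x - y := by linarith
    have e : Real.exp (-x) = Real.exp (-y) * Real.exp (-(x - y)) := by rw [← Real.exp_add]; congr 1; ring
    have h1 := k_zero hd
    have e2 : Real.exp (-x) - Real.exp (-y) + Real.exp (-y) * (x - y) = 
      Real.exp (-y) * (Real.exp (-(x - y)) - 1 + (x - y)) := by rw [e]; ring
    rw [e2, abs_mul, abs_of_pos (Real.exp_pos _), abs_of_nonneg hd]
    have h7 : Real.exp (-y) ≤ 1 := Real.exp_le_one_iff.2 (by linarith)
    have := abs_nonneg (Real.exp (-(x - y)) - 1 + (x - y))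
    nlinarith [Real.exp_pos (-y)]
  · obtain ⟨s, hs⟩ : ∃ s, s = y - x := ⟨_, rfl⟩
    have hs0 : 0 ≤ s := by linarith
    have e : Real.exp (-y) = Real.exp (-x) * Real.exp (-s) := by rw [← Real.exp_add, hs]; congr 1; ring
    have e2 : Real.exp (-x) - Real.exp (-y) + Real.exp (-y) * (x - y) = 
      Real.exp (-x) * (1 - Real.exp (-s) * (1 + s)) := by rw [e, hs]; ring
    rw [e2, abs_mul, abs_of_pos (Real.exp_pos _), abs_sub_comm x y, ← hs, abs_of_nonneg hs0]
    have h1 : 0 ≤ 1 - Real.exp (-s) * (1 + s) := by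
      have := Real.add_one_le_exp s
      have h2 : Real.exp (-s) * Real.exp s = 1 := by rw [← Real.exp_add]; simp
      nlinarith [Real.exp_pos (-s)]
    rw [abs_of_nonneg h1]
    have h7 : Real.exp (-x) ≤ 1 := Real.exp_le_one_iff.2 (by linarith)
    have h8 : 1 - Real.exp (-s) * (1 + s) ≤ s * √s := by
      by_cases hs1 : s ≤ 1
      · have := Real.add_one_le_exp (-s)
        have h2 : √s ≤ 1 := Real.sqrt_le_one.2 hs1
        have h3 := Real.sq_sqrt hs0
        have h4 := Real.sqrt_nonneg s
        have : s ≤ √s := by nlinarith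
        nlinarith
      · have h2 : 1 ≤ √s := Real.one_le_sqrt.2 (by linarith)
        nlinarith [Real.exp_pos (-s)]
    nlinarith [Real.exp_pos (-x)]

lemma pow_sub_le {x y : ℂ} (hx : ‖x‖ ≤ 1) (hy : ‖y‖ ≤ 1) (n : ℕ) : ‖x ^ n - y ^ n‖ ≤ n * ‖x - y‖ := by
  induction n with
  | zero => simp
  | succ n ih =>
    have e : x ^ (n + 1) - y ^ (n + 1) = x ^ n * (x - y) + (x ^ n - y ^ n) * y := by ring
    rw [e]
    refine (norm_add_le _ _).trans ?_
    rw [norm_mul, norm_mul, norm_pow]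
    have h1 : ‖x‖ ^ n ≤ 1 := pow_le_one₀ (norm_nonneg _) hx
    have h2 := norm_nonneg (x - y)
    have h3 := norm_nonneg (x ^ n - y ^ n)
    push_cast
    nlinarith

lemma prod_sub_le {ι : Type} (s : Finset ι) (x y : ι → ℂ) (hx : ∀ i, ‖x i‖ ≤ 1) (hy : ∀ i, ‖y i‖ ≤ 1) :
    ‖∏ i ∈ s, x i - ∏ i ∈ s, y i‖ ≤ ∑ i ∈ s, ‖x i - y i‖ := by
  classical
  induction s using Finset.induction_on with
  | empty => simp
  | insert a s ha ih =>
    rw [Finset.prod_insert ha, Finset.prod_insert ha, Finset.sum_insert ha]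
    have e : x a * ∏ i ∈ s, x i - y a * ∏ i ∈ s, y i = (x a - y a) * ∏ i ∈ s, x i + y a * (∏ i ∈ s, x i - ∏ i ∈ s, y i) := by ring
    rw [e]
    refine (norm_add_le _ _).trans ?_
    rw [norm_mul, norm_mul]
    have h1 : ‖∏ i ∈ s, x i‖ ≤ 1 := by
      rw [norm_prod]; exact Finset.prod_le_one (fun i _ => norm_nonneg _) fun i _ => hx i
    have h2 := norm_nonneg (x a - y a)
    have h3 := norm_nonneg (∏ i ∈ s, x i - ∏ i ∈ s, y i)
    have := hy a
    have := norm_nonneg (y a)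
    nlinarith

/-- variance of a centred linear form -/
lemma Vx_lin (hp : ∑ a, p a = 1) (ξ : Fin A → ℝ) (h : ∑ a, p a * ξ a = 0) (n : ℕ) :
    Vx p n (fun N => ∑ a, ξ a * (N a : ℝ)) = n * ∑ a, p a * ξ a ^ 2 := by
  induction n with
  | zero => simp [Vx, Ex]
  | succ n ih =>
    have hF : ∀ N : Fin A → ℕ, ∀ b, ∑ a, ξ a * (((N + Pi.single b 1 : Fin A → ℕ) a : ℕ) : ℝ) = ∑ a, ξ a * (N a : ℝ) + ξ b := by
      intro N b
      simp only [Pi.add_apply, Nat.cast_add, mul_add, Finset.sum_add_distrib]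
      congr 1
      rw [Finset.sum_eq_single b]
      · simp
      · intro c _ hc; simp [hc]
      · simp
    rw [Vx_succ hp]
    simp_rw [hF, mul_add, Finset.sum_add_distrib, ← Finset.sum_mul, hp, h, one_mul, add_zero, ih]
    simp only [add_sub_cancel_left]
    rw [Ex_const hp]; push_cast; ring

lemma lin_char (hp0 : ∀ a, 0 ≤ p a) (hp : ∑ a, p a = 1) (ξ : Fin A → ℝ) (h : ∑ a, p a * ξ a = 0) (n : ℕ) (t B : ℝ)
    (hB : ∀ a, |ξ a| ≤ B) (hB0 : 0 ≤ B) :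
    ‖Ex p n (fun N => ei (t * ∑ a, ξ a * (N a : ℝ))) - 
      ((Real.exp (-(t ^ 2 * (n * ∑ a, p a * ξ a ^ 2) / 2)) : ℝ) : ℂ)‖ ≤ 5 * n * |t| ^ 3 * B ^ 3 := by
  set s := ∑ a, p a * ξ a ^ 2 with hs
  have hs0 : 0 ≤ s := Finset.sum_nonneg fun a _ => mul_nonneg (hp0 a) (sq_nonneg _)
  have hsB : s ≤ B ^ 2 := by
    calc s ≤ ∑ a, p a * B ^ 2 := Finset.sum_le_sum fun a _ => by
          have := hB a
          rw [← sq_abs]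
          exact mul_le_mul_of_nonneg_left (by gcongr) (hp0 a)
      _ = _ := by rw [← Finset.sum_mul, hp, one_mul]
  set x : ℂ := ∑ a, (p a : ℂ) * ei (t * ξ a) with hx
  have e1 : Ex p n (fun N => ei (t * ∑ a, ξ a * (N a : ℝ))) = x ^ n := by
    rw [hx]
    have := Ex_cexp (p := p) n (fun a => ((t * ξ a : ℝ) : ℂ) * Complex.I)
    unfold ei
    rw [← this]
    congr 1; funext N; congr 1
    rw [Finset.mul_sum]; push_cast; rw [Finset.sum_mul]
    refine Finset.sum_congr rfl fun a _ => by ring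
  set y : ℂ := ((Real.exp (-(t ^ 2 * s / 2)) : ℝ) : ℂ) with hy
  have e2 : ((Real.exp (-(t ^ 2 * (n * s) / 2)) : ℝ) : ℂ) = y ^ n := by
    rw [hy, ← Complex.ofReal_pow, ← Real.exp_nat_mul]; congr 2; ring
  rw [e1, e2]
  have hx1 : ‖x‖ ≤ 1 := by
    refine (norm_sum_le _ _).trans ?_
    rw [← hp]
    refine Finset.sum_le_sum fun a _ => ?_
    rw [norm_mul, ei_norm, Complex.norm_real, Real.norm_eq_abs, abs_of_nonneg (hp0 a), mul_one]
  have hz : 0 ≤ t ^ 2 * s / 2 := by positivity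
  have hy1 : ‖y‖ ≤ 1 := by
    rw [hy, Complex.norm_real, Real.norm_eq_abs, abs_of_pos (Real.exp_pos _)]
    exact Real.exp_le_one_iff.2 (by linarith)
  refine (pow_sub_le hx1 hy1 n).trans ?_
  have e3 : x - y = ∑ a, (p a : ℂ) * (ei (t * ξ a) - 1 - ((t * ξ a : ℝ) : ℂ) * Complex.I + ((t * ξ a : ℝ) : ℂ) ^ 2 / 2)
      - ((Real.exp (-(t ^ 2 * s / 2)) - 1 + t ^ 2 * s / 2 : ℝ) : ℂ) := by
    have c1 : ∑ a, (p a : ℂ) = 1 := by exact_mod_cast hp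
    have c2 : ∑ a, (p a : ℂ) * (((t * ξ a : ℝ) : ℂ) * Complex.I) = 0 := by
      have : ∑ a, (p a : ℂ) * (((t * ξ a : ℝ) : ℂ) * Complex.I) = ((t * ∑ a, p a * ξ a : ℝ) : ℂ) * Complex.I := by
        push_cast; rw [Finset.mul_sum, Finset.sum_mul]
        exact Finset.sum_congr rfl fun a _ => by ring
      rw [this, h]; simp
    have c3 : ∑ a, (p a : ℂ) * (((t * ξ a : ℝ) : ℂ) ^ 2 / 2) = ((t ^ 2 * s / 2 : ℝ) : ℂ) := by
      rw [hs]; push_cast; rw [Finset.mul_sum, Finset.sum_div]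
      exact Finset.sum_congr rfl fun a _ => by ring
    simp_rw [mul_add, mul_sub, Finset.sum_add_distrib, Finset.sum_sub_distrib]
    rw [c2, c3]; simp only [mul_one]; rw [c1, hx, hy]; push_cast; ring
  have b1 : ‖∑ a, (p a : ℂ) * (ei (t * ξ a) - 1 - ((t * ξ a : ℝ) : ℂ) * Complex.I + ((t * ξ a : ℝ) : ℂ) ^ 2 / 2)‖
      ≤ 4 * (|t| ^ 3 * B ^ 3) := by
    calc _ ≤ ∑ a, p a * (4 * (|t| ^ 3 * B ^ 3)) := by
          refine (norm_sum_le _ _).trans (Finset.sum_le_sum fun a _ => ?_)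
          rw [norm_mul, Complex.norm_real, Real.norm_eq_abs, abs_of_nonneg (hp0 a)]
          refine mul_le_mul_of_nonneg_left ((ei_b3 _).trans ?_) (hp0 a)
          rw [abs_mul, mul_pow]
          gcongr; exact hB a
      _ = _ := by rw [← Finset.sum_mul, hp, one_mul]
  have b2 : ‖((Real.exp (-(t ^ 2 * s / 2)) - 1 + t ^ 2 * s / 2 : ℝ) : ℂ)‖ ≤ |t| ^ 3 * B ^ 3 := by
    rw [Complex.norm_real, Real.norm_eq_abs]
    refine (k_zero hz).trans ?_
    have h1 : t ^ 2 * s / 2 ≤ (|t| * B) ^ 2 := by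
      rw [mul_pow, sq_abs]
      have : t ^ 2 * s ≤ t ^ 2 * B ^ 2 := by gcongr
      nlinarith
    have h2 : √(t ^ 2 * s / 2) ≤ |t| * B := Real.sqrt_le_iff.2 ⟨by positivity, h1⟩
    calc _ ≤ (|t| * B) ^ 2 * (|t| * B) := by gcongr
      _ = _ := by ring
  have b3 : ‖x - y‖ ≤ 5 * (|t| ^ 3 * B ^ 3) := by
    rw [e3]; refine (norm_sub_le _ _).trans ?_; linarith
  calc _ ≤ (n : ℝ) * (5 * (|t| ^ 3 * B ^ 3)) := by gcongr
    _ = _ := by ring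

end A6

open Filter Topology

section A7
variable {A : ℕ} {p : Fin A → ℝ} {M : ℝ}

/-- comparison of the characteristic function of `Δ` with the Gaussian one -/
lemma char_cmp (hp0 : ∀ a, 0 ≤ p a) (hp : ∑ a, p a = 1) (ξ : Fin A → ℝ) (h : ∑ a, p a * ξ a = 0) (n : ℕ)
    (Δ : (Fin A → ℕ) → ℝ) (hΔ : Ex p n Δ = 0) {K B b1 b2 : ℝ} (hK : 1 ≤ K)
    (hE : ∀ j ≤ 4, Ex p n (fun N => chi p n N ^ j) ≤ K) (hB0 : 0 ≤ B) (hB : ∀ a, |ξ a| ≤ B) 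
    (hb1 : 0 ≤ b1) (hb2 : 0 ≤ b2) (hb : b2 ≤ b1)
    (hL : ∀ N, |∑ a, ξ a * (N a : ℝ)| ≤ b1 * chi p n N)
    (hR : ∀ N, ∑ a, N a = n → |Δ N - ∑ a, ξ a * (N a : ℝ)| ≤ b2 * chi p n N) (t : ℝ) :
    ‖Ex p n (fun N => ei (t * Δ N)) - ((Real.exp (-(t ^ 2 * (Ex p n (fun N => Δ N ^ 2)) / 2)) : ℝ) : ℂ)‖ ≤
      (|t| ^ 3) * (5 * n * B ^ 3 + 14 * K ^ 2 * (b1 ^ 2 * b2)) := by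
  obtain ⟨L, hLd⟩ : ∃ L : (Fin A → ℕ) → ℝ, L = fun N => ∑ a, ξ a * (N a : ℝ) := ⟨_, rfl⟩
  have hLd' : ∀ N, ∑ a, ξ a * (N a : ℝ) = L N := fun N => by rw [hLd]
  have hEL : Ex p n L = 0 := by
    rw [hLd, Ex_sum]
    simp_rw [Ex_mul, Ex_mean n _ hp]
    have e : ∑ a, ξ a * (n * p a) = n * ∑ a, p a * ξ a := by
      rw [Finset.mul_sum]; exact Finset.sum_congr rfl fun a _ => by ring
    rw [e, h]; ring
  have hVL : Ex p n (fun N => L N ^ 2) = n * ∑ a, p a * ξ a ^ 2 := by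
    rw [← Vx_lin hp ξ h n, ← hLd]; unfold Vx; rw [hEL]; simp
  have hchar := lin_char hp0 hp ξ h n t B hB hB0
  simp_rw [hLd'] at hchar hL hR
  rw [← hVL] at hchar
  -- the expansion
  set hh : ℝ → ℂ := fun x => ei x - 1 - (x : ℂ) * Complex.I + (x : ℂ) ^ 2 / 2 with hhh
  have expand : ∀ F : (Fin A → ℕ) → ℝ, Ex p n F = 0 →
      Ex p n (fun N => ei (t * F N)) = Ex p n (fun N => hh (t * F N)) + 1 - ((t ^ 2 * Ex p n (fun N => F N ^ 2) / 2 : ℝ) : ℂ) := by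
    intro F hF
    have e : (fun N => ei (t * F N)) = fun N => (hh (t * F N) + 1) + 
       (((t : ℂ) * Complex.I) * (F N : ℂ) - ((t : ℂ) ^ 2 / 2) * ((F N ^ 2 : ℝ) : ℂ)) := by
      funext N; rw [hhh]; push_cast; ring
    rw [e, Ex_add, Ex_add, Ex_const hp, Ex_sub, Ex_cmul, Ex_cmul, Ex_ofReal, Ex_ofReal, hF]
    push_cast; ring
  set x := t ^ 2 * Ex p n (fun N => L N ^ 2) / 2 with hx
  set y := t ^ 2 * Ex p n (fun N => Δ N ^ 2) / 2 with hy
  have key : Ex p n (fun N => ei (t * Δ N)) - ((Real.exp (-y) : ℝ) : ℂ) =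
     Ex p n (fun N => hh (t * Δ N) - hh (t * L N)) + (Ex p n (fun N => ei (t * L N)) - ((Real.exp (-x) : ℝ) : ℂ))
      - (((Real.exp (-y) + y) - (Real.exp (-x) + x) : ℝ) : ℂ) := by
    rw [expand Δ hΔ, expand L hEL, Ex_sub, ← hx, ← hy]; push_cast; ring
  have hχ : ∀ N, 0 ≤ chi p n N := fun N => by linarith [one_le_chi (p := p) n N]
  have c1 : ‖Ex p n (fun N => hh (t * Δ N) - hh (t * L N))‖ ≤ |t| ^ 3 * (8 * K * (b1 ^ 2 * b2)) := by
    refine (norm_Ex_le hp0 n _).trans ?_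
    calc _ ≤ Ex p n (fun N => (|t| ^ 3 * (8 * (b1 ^ 2 * b2))) * chi p n N ^ 3) := by
          refine Ex_mono hp0 fun N hN => ?_
          have h1 := h_diff (t * L N) (t * (Δ N - L N))
          have e : t * L N + t * (Δ N - L N) = t * Δ N := by ring
          rw [e] at h1
          refine h1.trans ?_
          have hl := hL N
          have hr := hR N hN
          rw [abs_mul, abs_mul]
          have hχ := hχ N
          calc _ = |t| ^ 3 * (4 * (|Δ N - L N| ^ 2 * |Δ N - L N|) + |L N| * |Δ N - L N| * |Δ N - L N| + 3 * |L N| ^ 2 * |Δ N - L N|) := by ring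
            _ ≤ |t| ^ 3 * (4 * ((b2 * chi p n N) ^ 2 * (b2 * chi p n N)) + (b1 * chi p n N) * (b2 * chi p n N) * (b2 * chi p n N) + 3 * (b1 * chi p n N) ^ 2 * (b2 * chi p n N)) := by gcongr
            _ ≤ |t| ^ 3 * (4 * ((b1 * chi p n N) ^ 2 * (b2 * chi p n N)) + (b1 * chi p n N) * (b1 * chi p n N) * (b2 * chi p n N) + 3 * (b1 * chi p n N) ^ 2 * (b2 * chi p n N)) := by gcongr
            _ = _ := by ring
      _ = |t| ^ 3 * (8 * (b1 ^ 2 * b2)) * Ex p n (fun N => chi p n N ^ 3) := Ex_mul _ _ _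
      _ ≤ |t| ^ 3 * (8 * (b1 ^ 2 * b2)) * K := by gcongr; exact hE 3 (by norm_num)
      _ = _ := by ring
  have sqb : ∀ F : (Fin A → ℕ) → ℝ, (∀ N, ∑ a, N a = n → |F N| ≤ 2 * b1 * chi p n N) → Ex p n (fun N => F N ^ 2) ≤ 4 * b1 ^ 2 * K := by
    intro F hF
    calc _ ≤ Ex p n (fun N => (4 * b1 ^ 2) * chi p n N ^ 2) := by
          refine Ex_mono hp0 fun N hN => ?_
          rw [← sq_abs]
          have := hF N hN
          calc _ ≤ (2 * b1 * chi p n N) ^ 2 := by gcongr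
            _ = _ := by ring
      _ = 4 * b1 ^ 2 * Ex p n (fun N => chi p n N ^ 2) := Ex_mul _ _ _
      _ ≤ _ := by gcongr; exact hE 2 (by norm_num)
  have hΔb : ∀ N, ∑ a, N a = n → |Δ N| ≤ 2 * b1 * chi p n N := by
    intro N hN
    have h1 := abs_add_le (Δ N - L N) (L N)
    rw [sub_add_cancel] at h1
    have h2 := hR N hN
    have h3 := hL N
    have h4 : b2 * chi p n N ≤ b1 * chi p n N := mul_le_mul_of_nonneg_right hb (hχ N)
    linarith
  have hLb : ∀ N, ∑ a, N a = n → |L N| ≤ 2 * b1 * chi p n N := by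
    intro N hN
    have h3 := hL N
    have h4 : 0 ≤ b1 * chi p n N := mul_nonneg hb1 (hχ N)
    linarith
  have sΔ := sqb Δ hΔb
  have sL := sqb L hLb
  have c3 : ‖(((Real.exp (-y) + y) - (Real.exp (-x) + x) : ℝ) : ℂ)‖ ≤ |t| ^ 3 * (6 * K ^ 2 * (b1 ^ 2 * b2)) := by
    rw [Complex.norm_real, Real.norm_eq_abs]
    set S := (2 * |t| * b1 * K) ^ 2 with hS
    have hK2 : K ≤ K ^ 2 := by nlinarith
    have bd : ∀ q, q ≤ 4 * b1 ^ 2 * K → t ^ 2 * q / 2 ≤ S := by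
      intro q hq
      have : t ^ 2 * q ≤ t ^ 2 * (4 * b1 ^ 2 * K) := by gcongr
      have h2 : t ^ 2 * (4 * b1 ^ 2 * K) ≤ t ^ 2 * (4 * b1 ^ 2 * K ^ 2) := by gcongr
      have h3 : S = t ^ 2 * (4 * b1 ^ 2 * K ^ 2) := by rw [hS, mul_pow, mul_pow, mul_pow, sq_abs]; ring
      rw [h3]
      have : 0 ≤ t ^ 2 * (4 * b1 ^ 2 * K ^ 2) := by positivity
      linarith
    have hx0 : 0 ≤ x := by
      have : 0 ≤ Ex p n (fun N => L N ^ 2) := Ex_nonneg hp0 fun N _ => sq_nonneg _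
      positivity
    have hy0 : 0 ≤ y := by
      have : 0 ≤ Ex p n (fun N => Δ N ^ 2) := Ex_nonneg hp0 fun N _ => sq_nonneg _
      positivity
    refine (k_diff hx0 hy0 (bd _ sL) (bd _ sΔ)).trans ?_
    have hsq : √S = 2 * |t| * b1 * K := by rw [hS]; exact Real.sqrt_sq (by positivity)
    rw [hsq]
    have hd : |y - x| ≤ t ^ 2 * (3 * b1 * b2 * K) / 2 := by
      have e : y - x = t ^ 2 * (Ex p n (fun N => Δ N ^ 2 - L N ^ 2)) / 2 := by rw [Ex_sub]; ring
      rw [e, abs_div, abs_mul, abs_of_nonneg (sq_nonneg t), abs_two]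
      gcongr
      refine (abs_Ex_le hp0 n _).trans ?_
      calc _ ≤ Ex p n (fun N => (3 * b1 * b2) * chi p n N ^ 2) := by
            refine Ex_mono hp0 fun N hN => ?_
            have e : Δ N ^ 2 - L N ^ 2 = (Δ N - L N) * (Δ N + L N) := by ring
            rw [e, abs_mul]
            have h1 := hR N hN
            have h2 : |Δ N + L N| ≤ 3 * b1 * chi p n N := by
              have := abs_add_le (Δ N) (L N)
              have := hΔb N hN
              have := hL N
              linarith
            calc _ ≤ (b2 * chi p n N) * (3 * b1 * chi p n N) := by
                  have := hχ N
                  gcongr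
              _ = _ := by ring
        _ = (3 * b1 * b2) * Ex p n (fun N => chi p n N ^ 2) := Ex_mul _ _ _
        _ ≤ _ := by gcongr; exact hE 2 (by norm_num)
    calc _ ≤ t ^ 2 * (3 * b1 * b2 * K) / 2 * (2 * |t| * b1 * K) := by gcongr
      _ = |t| ^ 2 * (3 * b1 * b2 * K) / 2 * (2 * |t| * b1 * K) := by rw [sq_abs]
      _ = |t| ^ 3 * (3 * K ^ 2 * (b1 ^ 2 * b2)) := by ring
      _ ≤ _ := by gcongr; norm_num
  rw [key]
  refine (norm_sub_le _ _).trans ((add_le_add_left (norm_add_le _ _) _).trans ?_)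
  have hK2 : |t| ^ 3 * (8 * K * (b1 ^ 2 * b2)) ≤ |t| ^ 3 * (8 * K ^ 2 * (b1 ^ 2 * b2)) := by
    have : K ≤ K ^ 2 := by nlinarith
    gcongr
  calc _ ≤ |t| ^ 3 * (8 * K ^ 2 * (b1 ^ 2 * b2)) + 5 * n * |t| ^ 3 * B ^ 3 + |t| ^ 3 * (6 * K ^ 2 * (b1 ^ 2 * b2)) := by
        linarith
    _ = _ := by ring

/-- the random variance term -/
lemma var_cmp (hp0 : ∀ a, 0 ≤ p a) (hp : ∑ a, p a = 1) (n : ℕ)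
    (Δ V : (Fin A → ℕ) → ℝ) (hV : ∀ N, 0 ≤ V N) {K b1 b3 : ℝ} (hK : 1 ≤ K)
    (hE : ∀ j ≤ 4, Ex p n (fun N => chi p n N ^ j) ≤ K) (hb1 : 0 ≤ b1) (hb3 : 0 ≤ b3)
    (hΔ : ∀ N, ∑ a, N a = n → |Δ N| ≤ b1 * chi p n N)
    (hY : ∀ N, ∑ a, N a = n → |V N - Ex p n V| ≤ b3 * chi p n N) (t : ℝ) :
    ‖Ex p n (fun N => ei (t * Δ N) * ((Real.exp (-(t ^ 2 * V N / 2)) - Real.exp (-(t ^ 2 * Ex p n V / 2)) : ℝ) : ℂ))‖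
      ≤ |t| ^ 3 * (K * (b1 * b3 + b3 * √b3)) := by
  have hEV : 0 ≤ Ex p n V := Ex_nonneg hp0 fun N _ => hV N
  obtain ⟨m, hm⟩ : ∃ m, m = Ex p n V := ⟨_, rfl⟩
  rw [← hm] at hY hEV ⊢
  set c := Real.exp (-(t ^ 2 * m / 2)) with hc
  set r : (Fin A → ℕ) → ℝ := fun N => Real.exp (-(t ^ 2 * V N / 2)) - c + c * (t ^ 2 * V N / 2 - t ^ 2 * m / 2) with hr
  have e : Ex p n (fun N => ei (t * Δ N) * ((Real.exp (-(t ^ 2 * V N / 2)) - c : ℝ) : ℂ)) =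
     Ex p n (fun N => ei (t * Δ N) * (r N : ℂ)) - Ex p n (fun N => (ei (t * Δ N) - 1) * ((c * (t ^ 2 * (V N - m) / 2) : ℝ) : ℂ)) := by
    have z : Ex p n (fun N => ((c * (t ^ 2 * (V N - m) / 2) : ℝ) : ℂ)) = 0 := by
      rw [Ex_ofReal]
      have : (fun N => c * (t ^ 2 * (V N - m) / 2)) = fun N => (c * t ^ 2 / 2) * (V N - m) := by funext N; ring
      rw [this, Ex_mul, Ex_sub, Ex_const hp, ← hm]; simp
    rw [← Ex_sub, ← sub_eq_zero, ← Ex_sub, ← neg_eq_zero, ← z, ← Ex_neg]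
    congr 1; funext N
    rw [hr]; push_cast; ring
  rw [e]
  have hχ : ∀ N, 0 ≤ chi p n N := fun N => by linarith [one_le_chi (p := p) n N]
  have hc1 : c ≤ 1 := Real.exp_le_one_iff.2 (by have : 0 ≤ t ^ 2 * m / 2 := by positivity
                                                linarith)
  have hc0 : 0 < c := Real.exp_pos _
  have d1 : ‖Ex p n (fun N => ei (t * Δ N) * (r N : ℂ))‖ ≤ |t| ^ 3 * (K * (b3 * √b3)) := by
    refine (norm_Ex_le hp0 n _).trans ?_
    calc _ ≤ Ex p n (fun N => |t| ^ 3 * (b3 * √b3) * chi p n N ^ 2) := by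
          refine Ex_mono hp0 fun N hN => ?_
          rw [norm_mul, ei_norm, one_mul, Complex.norm_real, Real.norm_eq_abs]
          have h0 : 0 ≤ t ^ 2 * V N / 2 := by have := hV N; positivity
          refine (exp_r h0 (by positivity : 0 ≤ t ^ 2 * m / 2)).trans ?_
          have h1 := hY N hN
          have h2 : |t ^ 2 * V N / 2 - t ^ 2 * m / 2| ≤ t ^ 2 * (b3 * chi p n N) := by
            have : t ^ 2 * V N / 2 - t ^ 2 * m / 2 = (t ^ 2 / 2) * (V N - m) := by ring
            rw [this, abs_mul, abs_of_nonneg (by positivity : 0 ≤ t ^ 2 / 2)]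
            have h3 : t ^ 2 / 2 ≤ t ^ 2 := by nlinarith [sq_nonneg t]
            exact mul_le_mul h3 h1 (abs_nonneg _) (sq_nonneg _)
          have h4 : √(t ^ 2 * (b3 * chi p n N)) ≤ |t| * √b3 * chi p n N := by
            rw [Real.sqrt_mul (sq_nonneg _), Real.sqrt_sq_eq_abs, Real.sqrt_mul hb3, mul_assoc]
            gcongr
            refine Real.sqrt_le_iff.2 ⟨hχ N, ?_⟩
            nlinarith [one_le_chi (p := p) n N]
          have := hχ N
          calc _ ≤ t ^ 2 * (b3 * chi p n N) * √(t ^ 2 * (b3 * chi p n N)) := by gcongr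
            _ ≤ t ^ 2 * (b3 * chi p n N) * (|t| * √b3 * chi p n N) := by gcongr
            _ = |t| ^ 2 * (b3 * chi p n N) * (|t| * √b3 * chi p n N) := by rw [sq_abs]
            _ = _ := by ring
      _ = |t| ^ 3 * (b3 * √b3) * Ex p n (fun N => chi p n N ^ 2) := Ex_mul _ _ _
      _ ≤ |t| ^ 3 * (b3 * √b3) * K := by gcongr; exact hE 2 (by norm_num)
      _ = _ := by ring
  have d2 : ‖Ex p n (fun N => (ei (t * Δ N) - 1) * ((c * (t ^ 2 * (V N - m) / 2) : ℝ) : ℂ))‖ ≤ |t| ^ 3 * (K * (b1 * b3)) := by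
    refine (norm_Ex_le hp0 n _).trans ?_
    calc _ ≤ Ex p n (fun N => |t| ^ 3 * (b1 * b3) * chi p n N ^ 2) := by
          refine Ex_mono hp0 fun N hN => ?_
          rw [norm_mul, Complex.norm_real, Real.norm_eq_abs]
          have h1 := hY N hN
          have h2 := hΔ N hN
          have h3 : |c * (t ^ 2 * (V N - m) / 2)| ≤ t ^ 2 * (b3 * chi p n N) := by
            have : c * (t ^ 2 * (V N - m) / 2) = (c * t ^ 2 / 2) * (V N - m) := by ring
            rw [this, abs_mul, abs_of_nonneg (by positivity : 0 ≤ c * t ^ 2 / 2)]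
            have h3 : c * t ^ 2 / 2 ≤ t ^ 2 := by nlinarith [sq_nonneg t]
            exact mul_le_mul h3 h1 (abs_nonneg _) (sq_nonneg _)
          have h4 : ‖ei (t * Δ N) - 1‖ ≤ |t| * (b1 * chi p n N) := by
            refine (ei_b1 _).trans ?_
            rw [abs_mul]; gcongr
          have := hχ N
          calc _ ≤ (|t| * (b1 * chi p n N)) * (t ^ 2 * (b3 * chi p n N)) := by gcongr
            _ = (|t| * (b1 * chi p n N)) * (|t| ^ 2 * (b3 * chi p n N)) := by rw [sq_abs]
            _ = _ := by ring
      _ = |t| ^ 3 * (b1 * b3) * Ex p n (fun N => chi p n N ^ 2) := Ex_mul _ _ _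
      _ ≤ |t| ^ 3 * (b1 * b3) * K := by gcongr; exact hE 2 (by norm_num)
      _ = _ := by ring
  refine (norm_sub_le _ _).trans ((add_le_add d1 d2).trans (le_of_eq ?_))
  ring

namespace Xp
variable {ν v : ℕ → ℝ} {σ α η : ℝ} (X : Xp p M ν v σ α η)
include X

lemma master (m : ℕ) (hm : (m : ℝ) = M) (hv : ∀ n, 0 ≤ v n) {τ : ℝ} (hτ0 : 0 < τ) 
    (hτ : M * ∑ a, p a ^ τ < 1) (h1 : σ + 2 * α ≤ τ) (h2 : 3 * α - 1 / 2 ≤ τ) (h3 : α + η - 1 / 2 ≤ τ)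
    (h4 : 3 * (η - 1 / 2) / 2 ≤ τ) :
    ∃ C, 0 < C ∧ ∀ (t : ℝ) (φ : ℕ → ℂ), φ 0 = 1 → φ 1 = 1 → (∀ n, ‖φ n‖ ≤ 1) →
      (∀ n, 2 ≤ n → φ n = (Ex p n (fun N => ei (t * (GG ν N - Ex p n (GG ν))) * ∏ a, φ (N a))) ^ m) →
      ∀ n, ‖φ n - ((Real.exp (-(t ^ 2 * v n / 2)) : ℝ) : ℂ)‖ ≤ C * |t| ^ 3 * (n : ℝ) ^ τ := by
  obtain ⟨Cx, hCx, bx⟩ := X.xi_b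
  obtain ⟨CL, hCL, bL⟩ := X.LL_b
  obtain ⟨CR, hCR, bR⟩ := X.R_b
  obtain ⟨CD, hCD, bD⟩ := X.Δ_b
  obtain ⟨CY, hCY, bY⟩ := X.Y_b
  have D := X.D
  obtain ⟨K, hK, hE⟩ := chi_moment D.hp0' D.hp
  obtain ⟨C1, hC1, H⟩ := GU D.hp0' D.hp D.hM0.le D.hq hτ0 hτ
  have hM0 := D.hM0
  set T : ℝ := 5 * Cx ^ 3 + 14 * K ^ 2 * ((CL + CR) ^ 2 * CR) + K * (CD * CY + CY * √CY) with hT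
  have hT0 : 0 < T := by positivity
  refine ⟨C1 * (M * T), by positivity, fun t φ φ0 φ1 φn φr => ?_⟩
  have := H (fun n => ‖φ n - ((Real.exp (-(t ^ 2 * v n / 2)) : ℝ) : ℂ)‖) (M * T * |t| ^ 3) (by positivity)
    (fun n => norm_nonneg _) (by simp [φ0, D.v0]) (by simp [φ1, D.v1]; positivity) ?_
  · intro n; refine (this n).trans (le_of_eq ?_); ring
  intro n hn
  have hn1 : 1 ≤ n := by omega
  have hn' : (0 : ℝ) < n := by exact_mod_cast hn1
  have hn1' : (1 : ℝ) ≤ n := by exact_mod_cast hn1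
  set Δ : (Fin A → ℕ) → ℝ := fun N => GG ν N - Ex p n (GG ν) with hΔ
  have hEΔ : Ex p n Δ = 0 := by rw [hΔ, Ex_sub, Ex_const D.hp, sub_self]
  set w := Ex p n (GG v) with hw
  set s := Ex p n (fun N => Δ N ^ 2) with hs
  have hvn : v n = M * (w + s) := D.vr n hn
  have hG : ((Real.exp (-(t ^ 2 * v n / 2)) : ℝ) : ℂ) = ((Real.exp (-(t ^ 2 * w / 2)) * Real.exp (-(t ^ 2 * s / 2)) : ℝ) : ℂ) ^ m := by
    rw [← Complex.ofReal_pow, ← Real.exp_add, ← Real.exp_nat_mul, hvn, hm]; congr 2; ring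
  have hGGv : ∀ N : Fin A → ℕ, 0 ≤ GG v N := fun N => Finset.sum_nonneg fun a _ => hv _
  have hw0 : 0 ≤ w := Ex_nonneg D.hp0' fun N _ => hGGv N
  have hs0 : 0 ≤ s := Ex_nonneg D.hp0' fun N _ => sq_nonneg _
  have el : ∀ q : ℝ, 0 ≤ q → Real.exp (-(t ^ 2 * q / 2)) ≤ 1 := fun q hq => 
    Real.exp_le_one_iff.2 (by have : 0 ≤ t ^ 2 * q / 2 := by positivity
                              linarith)
  have n1 : ‖((Real.exp (-(t ^ 2 * w / 2)) * Real.exp (-(t ^ 2 * s / 2)) : ℝ) : ℂ)‖ ≤ 1 := by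
    rw [Complex.norm_real, Real.norm_eq_abs, abs_of_nonneg (by positivity)]
    exact mul_le_one₀ (el w hw0) (Real.exp_pos _).le (el s hs0)
  have n2 : ‖Ex p n (fun N => ei (t * Δ N) * ∏ a, φ (N a))‖ ≤ 1 := by
    refine (norm_Ex_le D.hp0' n _).trans ?_
    rw [← Ex_const (E := ℝ) D.hp n 1]
    refine Ex_mono D.hp0' fun N _ => ?_
    rw [norm_mul, ei_norm, one_mul, norm_prod]
    exact Finset.prod_le_one (fun i _ => norm_nonneg _) fun i _ => φn _
  show ‖φ n - ((Real.exp (-(t ^ 2 * v n / 2)) : ℝ) : ℂ)‖ ≤ _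
  rw [φr n hn, hG]
  refine (pow_sub_le n2 n1 m).trans ?_
  rw [hm, mul_assoc M T, mul_assoc M _ ((n : ℝ) ^ τ), ← mul_add]
  refine mul_le_mul_of_nonneg_left ?_ hM0.le
  have hprod : ∀ N : Fin A → ℕ, ∏ a, ((Real.exp (-(t ^ 2 * v (N a) / 2)) : ℝ) : ℂ) = ((Real.exp (-(t ^ 2 * GG v N / 2)) : ℝ) : ℂ) := by
    intro N
    rw [← Complex.ofReal_prod, ← Real.exp_sum]
    congr 2; unfold GG
    rw [Finset.sum_neg_distrib, Finset.mul_sum, Finset.sum_div]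
  have split : Ex p n (fun N => ei (t * Δ N) * ∏ a, φ (N a)) - ((Real.exp (-(t ^ 2 * w / 2)) * Real.exp (-(t ^ 2 * s / 2)) : ℝ) : ℂ)
     = Ex p n (fun N => ei (t * Δ N) * (∏ a, φ (N a) - ∏ a, ((Real.exp (-(t ^ 2 * v (N a) / 2)) : ℝ) : ℂ)))
      + Ex p n (fun N => ei (t * Δ N) * ((Real.exp (-(t ^ 2 * GG v N / 2)) - Real.exp (-(t ^ 2 * w / 2)) : ℝ) : ℂ))
      + ((Real.exp (-(t ^ 2 * w / 2)) : ℝ) : ℂ) * (Ex p n (fun N => ei (t * Δ N)) - ((Real.exp (-(t ^ 2 * s / 2)) : ℝ) : ℂ)) := by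
    rw [mul_sub, ← Ex_cmul, ← add_sub_assoc, ← Ex_add, ← Ex_add]
    congr 1
    · congr 1; funext N; rw [hprod]; push_cast; ring
    · push_cast; ring
  rw [split]
  have q1 : ‖Ex p n (fun N => ei (t * Δ N) * (∏ a, φ (N a) - ∏ a, ((Real.exp (-(t ^ 2 * v (N a) / 2)) : ℝ) : ℂ)))‖ ≤
      ∑ a, Ex p n (fun N => ‖φ (N a) - ((Real.exp (-(t ^ 2 * v (N a) / 2)) : ℝ) : ℂ)‖) := by
    refine (norm_Ex_le D.hp0' n _).trans ?_
    rw [← Ex_sum]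
    refine Ex_mono D.hp0' fun N _ => ?_
    rw [norm_mul, ei_norm, one_mul]
    refine prod_sub_le _ _ _ (fun a => φn _) fun a => ?_
    rw [Complex.norm_real, Real.norm_eq_abs, abs_of_pos (Real.exp_pos _)]
    exact el _ (hv _)
  have q2 := var_cmp D.hp0' D.hp n Δ (GG v) hGGv hK (hE n hn1) (b1 := CD * (n : ℝ) ^ α) (b3 := CY * (n : ℝ) ^ (η - 1 / 2)) (by positivity)
    (by positivity) (bD n hn1) (bY n hn1) t
  have hchi : ∀ N, 0 ≤ chi p n N := fun N => by linarith [one_le_chi (p := p) n N]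
  have hασ : (n : ℝ) ^ σ ≤ (n : ℝ) ^ α := Real.rpow_le_rpow_of_exponent_le hn1' X.hα
  have q3 := char_cmp D.hp0' D.hp (xi p ν n) (xi_sum D.hp ν n) n Δ hEΔ hK (hE n hn1) (B := Cx * (n : ℝ) ^ (α - 1 / 2))
    (b1 := (CL + CR) * (n : ℝ) ^ α) (b2 := CR * (n : ℝ) ^ σ) (by positivity) (bx n hn1) (by positivity) (by positivity)
    (by 
      calc CR * (n : ℝ) ^ σ ≤ CR * (n : ℝ) ^ α := by gcongr
        _ ≤ _ := by gcongr; linarith)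
    (fun N => (bL n hn1 N).trans (by have := hchi N; gcongr; linarith)) (bR n hn1) t
  have r0 : ∀ e : ℝ, e ≤ τ → (n : ℝ) ^ e ≤ (n : ℝ) ^ τ := fun e he => Real.rpow_le_rpow_of_exponent_le hn1' he
  have r1 : (n : ℝ) * ((n : ℝ) ^ (α - 1 / 2)) ^ 3 ≤ (n : ℝ) ^ τ := by
    rw [← Real.rpow_natCast, ← Real.rpow_mul hn'.le]
    nth_rewrite 1 [← Real.rpow_one (n : ℝ)]
    rw [← Real.rpow_add hn']
    exact r0 _ (by push_cast; linarith)
  have r2 : ((n : ℝ) ^ α) ^ 2 * (n : ℝ) ^ σ ≤ (n : ℝ) ^ τ := by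
    rw [← Real.rpow_natCast, ← Real.rpow_mul hn'.le, ← Real.rpow_add hn']
    exact r0 _ (by push_cast; linarith)
  have r3 : (n : ℝ) ^ α * (n : ℝ) ^ (η - 1 / 2) ≤ (n : ℝ) ^ τ := by
    rw [← Real.rpow_add hn']
    exact r0 _ (by linarith)
  have r4 : (n : ℝ) ^ (η - 1 / 2) * √((n : ℝ) ^ (η - 1 / 2)) ≤ (n : ℝ) ^ τ := by
    rw [Real.sqrt_eq_rpow, ← Real.rpow_mul hn'.le, ← Real.rpow_add hn']
    exact r0 _ (by linarith)
  have q3' : ‖((Real.exp (-(t ^ 2 * w / 2)) : ℝ) : ℂ) * (Ex p n (fun N => ei (t * Δ N)) - ((Real.exp (-(t ^ 2 * s / 2)) : ℝ) : ℂ))‖ ≤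
     |t| ^ 3 * ((5 * Cx ^ 3 + 14 * K ^ 2 * ((CL + CR) ^ 2 * CR)) * (n : ℝ) ^ τ) := by
    rw [norm_mul, Complex.norm_real, Real.norm_eq_abs, abs_of_pos (Real.exp_pos _)]
    refine (mul_le_of_le_one_left (norm_nonneg _) (el w hw0)).trans (q3.trans ?_)
    gcongr
    calc _ = 5 * Cx ^ 3 * ((n : ℝ) * ((n : ℝ) ^ (α - 1 / 2)) ^ 3) + 14 * K ^ 2 * ((CL + CR) ^ 2 * CR) * (((n : ℝ) ^ α) ^ 2 * (n : ℝ) ^ σ) := by ring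
      _ ≤ 5 * Cx ^ 3 * (n : ℝ) ^ τ + 14 * K ^ 2 * ((CL + CR) ^ 2 * CR) * (n : ℝ) ^ τ := by gcongr
      _ = _ := by ring
  have q2' : ‖Ex p n (fun N => ei (t * Δ N) * ((Real.exp (-(t ^ 2 * GG v N / 2)) - Real.exp (-(t ^ 2 * w / 2)) : ℝ) : ℂ))‖ ≤
     |t| ^ 3 * (K * (CD * CY + CY * √CY) * (n : ℝ) ^ τ) := by
    refine q2.trans ?_
    rw [Real.sqrt_mul hCY.le]
    refine mul_le_mul_of_nonneg_left ?_ (by positivity)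
    calc _ = K * (CD * CY * ((n : ℝ) ^ α * (n : ℝ) ^ (η - 1 / 2)) + CY * √CY * ((n : ℝ) ^ (η - 1 / 2) * √((n : ℝ) ^ (η - 1 / 2)))) := by ring
      _ ≤ K * (CD * CY * (n : ℝ) ^ τ + CY * √CY * (n : ℝ) ^ τ) := by gcongr
      _ = _ := by ring
  refine (norm_add_le _ _).trans ((add_le_add_left (norm_add_le _ _) _).trans ?_)
  calc _ ≤ _ := add_le_add (add_le_add q1 q2') q3'
    _ = _ := by rw [hT]; ring

end Xp
end A7

open Filter Topology

section A8
variable {A : ℕ} {p : Fin A → ℝ} {M : ℝ}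

lemma GG_add (ν : ℕ → ℝ) (N : Fin A → ℕ) (a : Fin A) : GG ν (N + Pi.single a 1) = GG ν N + du ν (N a) := by
  unfold GG
  rw [← Finset.add_sum_erase _ _ (Finset.mem_univ a), ← Finset.add_sum_erase _ (fun b => ν (N b)) (Finset.mem_univ a)]
  have : ∑ x ∈ Finset.univ.erase a, ν ((N + Pi.single a 1 : Fin A → ℕ) x) = ∑ x ∈ Finset.univ.erase a, ν (N x) := by
    refine Finset.sum_congr rfl fun b hb => ?_
    have hb' : b ≠ a := (Finset.mem_erase.1 hb).1
    simp [hb']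
  rw [this]; simp [du]; ring

/-- weighted first differences -/
def zz (ν : ℕ → ℝ) (n : ℕ) : ℝ := (n : ℝ) * du ν (n - 1)

namespace Dat
variable {ν v : ℕ → ℝ} (D : Dat p M ν v)
include D

lemma vr' {n : ℕ} (hn : 2 ≤ n) : v n = M * (∑ a, Ex p n (fun N => v (N a)) + Vx p n (GG ν)) := by
  rw [D.vr n hn, Ex_sum]; rfl

lemma v_rec_ge {n : ℕ} (hn : 2 ≤ n) : M * ∑ a, Ex p n (fun N => v (N a)) ≤ v n := by
  rw [D.vr' hn]
  exact mul_le_mul_of_nonneg_left (by linarith [Vx_nonneg D.hp0' n (GG ν)]) D.hM0.le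

lemma v_nonneg (n : ℕ) : 0 ≤ v n :=
  Gpos D.hp0' D.hp D.hM0.le D.hq v D.v0.ge D.v1.ge (fun n hn => D.v_rec_ge hn) n

lemma zz_rec (n : ℕ) (hn : 1 ≤ n) : zz ν n = (if n = 2 then 2 else 0) +
      M * ∑ a, Ex p n (fun N => zz ν (N a)) := D.z_rec n hn

lemma zz_rec_ge {n : ℕ} (hn : 1 ≤ n) : M * ∑ a, Ex p n (fun N => zz ν (N a)) ≤ zz ν n := by
  rw [D.zz_rec n hn]; split_ifs <;> linarith

omit D in
lemma zz0 : zz ν 0 = 0 := by simp [zz]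
lemma zz1 : zz ν 1 = 0 := by simp [zz, du, D.ν0, D.ν1]

lemma zz_nonneg (n : ℕ) : 0 ≤ zz ν n :=
  Gpos D.hp0' D.hp D.hM0.le D.hq (zz ν) zz0.ge D.zz1.ge (fun n hn => D.zz_rec_ge (by omega)) n

lemma zz2 : 2 ≤ zz ν 2 := by
  rw [D.zz_rec 2 (by norm_num), if_pos rfl]
  have : 0 ≤ M * ∑ a, Ex p 2 (fun N => zz ν (N a)) := mul_nonneg D.hM0.le
    (Finset.sum_nonneg fun a _ => Ex_nonneg D.hp0' fun N _ => D.zz_nonneg _)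
  linarith

lemma nu2 : 1 ≤ ν 2 := by
  have := D.zz2
  have e : zz ν 2 = 2 * ν 2 := by simp [zz, du, D.ν1]
  linarith

lemma v2 : 0 < v 2 := by
  have h2 := D.nu2
  have hM := D.hM
  rw [D.vr' le_rfl]
  refine mul_pos D.hM0 (add_pos_of_nonneg_of_pos (Finset.sum_nonneg fun a _ => Ex_nonneg D.hp0' fun N _ => D.v_nonneg _) ?_)
  have hs : Ex p 2 (fun N => GG ν N ^ 2) = ν 2 * Ex p 2 (GG ν) := by
    rw [← Ex_mul]
    refine Ex_congr fun N hN => ?_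
    by_cases h : ∃ a, N a = 2
    · obtain ⟨a, ha⟩ := h
      have : GG ν N = ν 2 := by
        unfold GG
        rw [Finset.sum_eq_single a, ha]
        · intro b _ hb
          have : N a + N b ≤ ∑ a, N a := by
            rw [← Finset.sum_pair hb.symm]; exact Finset.sum_le_sum_of_subset (Finset.subset_univ _)
          exact D.ν_small (by omega)
        · simp
      rw [this]; ring
    · have : GG ν N = 0 := by
        refine Finset.sum_eq_zero fun a _ => D.ν_small ?_
        have := le_of_sum_eq hN a
        have : N a ≠ 2 := fun h' => h ⟨a, h'⟩
        omega
      rw [this]; ring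
  rw [Vx_eq D.hp, hs]
  have hm : ν 2 = 1 + M * Ex p 2 (GG ν) := D.νr 2 le_rfl
  have hm0 : 0 < Ex p 2 (GG ν) := by
    have h0 : 0 < A := by have := D.hA; omega
    have hle : ν 2 * p ⟨0, h0⟩ ^ 2 ≤ Ex p 2 (GG ν) := by
      rw [← Ex_top, ← Ex_mul]
      refine Ex_mono D.hp0' fun N hN => ?_
      have hnn : ∀ b ∈ Finset.univ, 0 ≤ ν (N b) := by
        intro b _
        have := le_of_sum_eq hN b
        rcases (by omega : N b ≤ 1 ∨ N b = 2) with h | h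
        · rw [D.ν_small h]
        · rw [h]; linarith
      split_ifs with h
      · rw [mul_one, ← h]
        exact Finset.single_le_sum hnn (Finset.mem_univ _)
      · rw [mul_zero]; exact Finset.sum_nonneg hnn
    have := D.hp0 ⟨0, h0⟩
    exact lt_of_lt_of_le (by positivity) hle
  generalize Ex p 2 (GG ν) = m at *
  nlinarith

lemma v_low {β : ℝ} (hβ0 : 0 < β) (hβ : 1 < M * ∑ a, p a ^ β) :
    ∃ c : ℝ, 0 < c ∧ ∀ n : ℕ, 2 ≤ n → c * (n : ℝ) ^ β ≤ v n :=
  GrL D.hp0 D.hA D.hp D.hM0 D.hq hβ0 hβ v D.v_nonneg D.v2 (fun n hn => D.v_rec_ge (by omega))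

lemma zz_low {β : ℝ} (hβ0 : 0 < β) (hβ : 1 < M * ∑ a, p a ^ β) :
    ∃ c : ℝ, 0 < c ∧ ∀ n : ℕ, 2 ≤ n → c * (n : ℝ) ^ β ≤ zz ν n :=
  GrL D.hp0 D.hA D.hp D.hM0 D.hq hβ0 hβ _ D.zz_nonneg (by linarith [D.zz2]) (fun n hn => D.zz_rec_ge (by omega))

lemma zz_up {σ : ℝ} (hσ : 0 < σ) (h : M * ∑ a, p a ^ (1 + σ) < 1) :
    ∃ C, 0 < C ∧ ∀ n : ℕ, 1 ≤ n → zz ν n ≤ C * (n : ℝ) ^ (1 + σ) := by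
  obtain ⟨C, hC, H⟩ := D.u_bound hσ h
  refine ⟨C, hC, fun n hn => ?_⟩
  have hn' : (0 : ℝ) < n := by exact_mod_cast hn
  have := (le_abs_self _).trans (H (n - 1))
  rw [Nat.cast_sub hn, Nat.cast_one, sub_add_cancel] at this
  rw [Real.rpow_add hn', Real.rpow_one]
  unfold zz
  calc _ ≤ n * (C * (n : ℝ) ^ σ) := by gcongr
    _ = _ := by ring

end Dat

/-- the sum of powers -/
lemma pw_lt (hp0 : ∀ a, 0 < p a) (hA : 2 ≤ A) (hp : ∑ a, p a = 1) {x y : ℝ} (h : x < y) : ∑ a, p a ^ y < ∑ a, p a ^ x := by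
  have hp1 : ∀ a, p a < 1 := by
    intro a
    rw [← hp]
    obtain ⟨b, hb⟩ : ∃ b, b ≠ a := by
      have : Nontrivial (Fin A) := Fin.nontrivial_iff_two_le.2 hA
      exact exists_ne a
    exact Finset.single_lt_sum hb (Finset.mem_univ _) (Finset.mem_univ _) (hp0 b) (fun c _ _ => (hp0 c).le)
  have : (Finset.univ : Finset (Fin A)).Nonempty := ⟨⟨0, by omega⟩, Finset.mem_univ _⟩
  exact Finset.sum_lt_sum_of_nonempty this fun a _ => Real.rpow_lt_rpow_of_exponent_gt (hp0 a) (hp1 a) h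

lemma pw_root (hp0 : ∀ a, 0 < p a) (hA : 2 ≤ A) (hp : ∑ a, p a = 1) (hM : 1 ≤ M) (hq : M * ∑ a, p a ^ 2 < 1) :
    ∃ s : ℝ, 0 ≤ s ∧ s < 1 ∧ M * ∑ a, p a ^ (1 + s) = 1 := by
  have hc : ContinuousOn (fun s : ℝ => M * ∑ a, p a ^ (1 + s)) (Set.Icc 0 1) := by
    refine Continuous.continuousOn ?_
    refine continuous_const.mul (continuous_finsetSum _ fun a _ => ?_)
    exact continuous_const.rpow (by fun_prop) (fun x => Or.inl (hp0 a).ne')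
  have := intermediate_value_Icc' (zero_le_one' ℝ) hc
  have h1 : M * ∑ a, p a ^ (1 + 1 : ℝ) < 1 := by
    have e : ∀ a, p a ^ (1 + 1 : ℝ) = p a ^ 2 := fun a => by
      rw [← Real.rpow_natCast]; norm_num
    simp_rw [e]; exact hq
  obtain ⟨s, hs, hs1⟩ := this (show (1 : ℝ) ∈ _ from ⟨h1.le, by simp [hp, hM]⟩)
  refine ⟨s, hs.1, lt_of_le_of_ne hs.2 ?_, hs1⟩
  rintro rfl
  simp only at hs1
  linarith

end A8

open Filter Topology

section A9
variable {A : ℕ} {p : Fin A → ℝ} {M : ℝ}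

lemma persp (K : ℕ) {r l : ℝ} (hr : 0 ≤ r) (hl : 0 ≤ l) :
    ((K : ℝ) + 1) * l ^ K * r ≤ r ^ (K + 1) + K * l ^ (K + 1) := by
  induction K with
  | zero => simp
  | succ K ih =>
    have h1 := mul_le_mul_of_nonneg_left ih hr
    have h2 : 0 ≤ ((K : ℝ) + 1) * l ^ K * (r - l) ^ 2 := by positivity
    push_cast
    have e : r ^ (K + 1 + 1) + ((K : ℝ) + 1) * l ^ (K + 1 + 1) - ((K : ℝ) + 1 + 1) * l ^ (K + 1) * r =
      (r * (r ^ (K + 1) + K * l ^ (K + 1)) - r * (((K : ℝ) + 1) * l ^ K * r)) + ((K : ℝ) + 1) * l ^ K * (r - l) ^ 2 := by ring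
    linarith

lemma div_pow_aux (K : ℕ) {x z : ℝ} (hz : z ≠ 0) : (x / z) ^ (K + 1) * z = x ^ (K + 1) / z ^ K := by
  rw [div_pow, pow_succ z]; field_simp

lemma Ex_persp (hp0 : ∀ a, 0 ≤ p a) (n : ℕ) (a : Fin A) (K : ℕ) (x z g : ℕ → ℝ)
    (hz : ∀ k, 0 ≤ z k) (hg : ∀ k, 0 ≤ g k)
    (h : ∀ k, x k ≤ 0 ∨ (0 < x k ∧ 0 < z k ∧ x k ^ (K + 1) / z k ^ K ≤ g k)) {X Z : ℝ} (hX : 0 ≤ X) (hZ : 0 < Z)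
    (hXx : X ≤ Ex p n (fun N => x (N a))) (hZz : Ex p n (fun N => z (N a)) ≤ Z) :
    X ^ (K + 1) / Z ^ K ≤ Ex p n (fun N => g (N a)) := by
  set l := X / Z with hl
  have hl0 : 0 ≤ l := by positivity
  calc X ^ (K + 1) / Z ^ K = (((K : ℝ) + 1) * l ^ K) * X - (K * l ^ (K + 1)) * Z := by
        have e : X = l * Z := by rw [hl]; field_simp
        rw [← div_pow_aux K hZ.ne', ← hl]
        conv_rhs => rw [e]
        ring
    _ ≤ (((K : ℝ) + 1) * l ^ K) * Ex p n (fun N => x (N a)) - (K * l ^ (K + 1)) * Ex p n (fun N => z (N a)) := by gcongr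
    _ = Ex p n (fun N => (((K : ℝ) + 1) * l ^ K) * x (N a) - (K * l ^ (K + 1)) * z (N a)) := by
        rw [Ex_sub, Ex_mul, Ex_mul]
    _ ≤ _ := by
        refine Ex_mono hp0 fun N _ => ?_
        generalize N a = k
        rcases h k with h | ⟨h1, h2, h3⟩
        · have e1 : (((K : ℝ) + 1) * l ^ K) * x k ≤ 0 := mul_nonpos_of_nonneg_of_nonpos (by positivity) h
          have e2 : 0 ≤ (K * l ^ (K + 1)) * z k := mul_nonneg (by positivity) (hz k)
          linarith [hg k]
        · refine le_trans ?_ h3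
          have := mul_le_mul_of_nonneg_right (persp K (r := x k / z k) (by positivity) hl0) h2.le
          have e : (x k / z k) ^ (K + 1) * z k = x k ^ (K + 1) / z k ^ K := div_pow_aux K h2.ne'
          have e3 : ((K : ℝ) + 1) * l ^ K * (x k / z k) * z k = ((K : ℝ) + 1) * l ^ K * x k := by field_simp
          rw [add_mul _ _ (z k), e, e3] at this
          linarith

lemma fin_c (f g : ℕ → ℝ) (h : ∀ k, 2 ≤ k → 0 < f k) (hg : ∀ k, 0 ≤ g k) (n : ℕ) :
    ∃ c : ℝ, 0 < c ∧ ∀ k, 2 ≤ k → k < n → c * g k ≤ f k := by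
  induction n with
  | zero => exact ⟨1, one_pos, fun k _ h => by omega⟩
  | succ n ih =>
    obtain ⟨c, hc, H⟩ := ih
    by_cases hn : 2 ≤ n
    · have h1 := h n hn
      have h2 := hg n
      refine ⟨min c (f n / (g n + 1)), lt_min hc (by positivity), fun k hk hkn => ?_⟩
      rcases (by omega : k < n ∨ k = n) with h' | rfl
      · exact (mul_le_mul_of_nonneg_right (min_le_left _ _) (hg k)).trans (H k hk h')
      · refine (mul_le_mul_of_nonneg_right (min_le_right _ _) (hg k)).trans ?_
        rw [div_mul_eq_mul_div, div_le_iff₀ (by positivity)]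
        nlinarith
    · exact ⟨c, hc, fun k hk hkn => by omega⟩

namespace Dat
variable {ν v : ℕ → ℝ} (D : Dat p M ν v)
include D

lemma v_case {n : ℕ} (hn : 3 ≤ n) (a : Fin A) :
    M * (n * p a) * (Ex p n (fun N => zz ν (N a)) / (n * p a) - zz ν n / (n * M)) ^ 2 ≤ v n := by
  obtain ⟨m, rfl⟩ : ∃ m, n = m + 1 := ⟨n - 1, by omega⟩
  have hM := D.hM0
  have hz : ∀ b, Ex p (m + 1) (fun N => zz ν (N b)) = (m + 1 : ℝ) * p b * Ex p m (fun N => du ν (N b)) :=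
    fun b => Ex_sb' m b (du ν)
  have hpa := D.hp0 a
  have hm : (0 : ℝ) < (m : ℝ) + 1 := by positivity
  have hu : zz ν (m + 1) / (((m + 1 : ℕ) : ℝ) * M) = ∑ b, p b * Ex p m (fun N => du ν (N b)) := by
    have h1 := D.u_rec m
    rw [if_neg (by omega)] at h1
    simp only [pow_one, zero_add] at h1
    unfold zz
    rw [Nat.add_sub_cancel, h1]; push_cast; field_simp
  rw [hu, hz]
  have e1 : ((m : ℝ) + 1) * p a * Ex p m (fun N => du ν (N a)) / (((m + 1 : ℕ) : ℝ) * p a) = Ex p m (fun N => du ν (N a)) := by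
    push_cast; field_simp
  rw [e1]
  have hge := Vx_ge D.hp0' D.hp m (GG ν)
  have e2 : Ex p (m + 1) (GG ν) = Ex p m (GG ν) + ∑ b, p b * Ex p m (fun N => du ν (N b)) := by
    rw [Ex_succ]
    simp_rw [smul_eq_mul, GG_add, mul_add, Finset.sum_add_distrib, ← Finset.sum_mul, D.hp, one_mul]
    rw [Ex_add, Ex_sum]
    simp_rw [Ex_mul]
  have e3 : ∀ b, Ex p m (fun N => GG ν (N + Pi.single b 1)) = Ex p m (GG ν) + Ex p m (fun N => du ν (N b)) := by
    intro b; simp_rw [GG_add]; rw [Ex_add]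
  simp_rw [e3, e2, add_sub_add_left_eq_sub] at hge
  have hsingle := Finset.single_le_sum (f := fun b => p b * (Ex p m (fun N => du ν (N b)) - ∑ b, p b * Ex p m (fun N => du ν (N b))) ^ 2)
    (fun b _ => mul_nonneg (D.hp0' b) (sq_nonneg _)) (Finset.mem_univ a)
  have h3 := (mul_le_mul_of_nonneg_left hsingle hm.le).trans hge
  rw [D.vr' (by omega)]
  have h4 : 0 ≤ ∑ a, Ex p (m + 1) (fun N => v (N a)) := Finset.sum_nonneg fun b _ => Ex_nonneg D.hp0' fun N _ => D.v_nonneg _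
  push_cast
  calc _ = M * (((m : ℝ) + 1) * (p a * (Ex p m (fun N => du ν (N a)) - ∑ b, p b * Ex p m (fun N => du ν (N b))) ^ 2)) := by ring
    _ ≤ _ := mul_le_mul_of_nonneg_left (by linarith) hM.le

/-- if the bias towards `a` is visible, the variance is large -/
lemma v_case1 {n : ℕ} (hn : 3 ≤ n) (a : Fin A) {R : ℝ} (hR : 1 < R) 
    (h : R * p a / M * zz ν n ≤ Ex p n (fun N => zz ν (N a))) :
    p a * (R - 1) ^ 2 / M * (zz ν n ^ 2 / n) ≤ v n := by
  refine le_trans ?_ (D.v_case hn a)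
  have hM := D.hM0
  have hpa := D.hp0 a
  have hn' : (0 : ℝ) < n := by exact_mod_cast (by omega : 0 < n)
  have hz := D.zz_nonneg n
  have h1 : (R - 1) * zz ν n / (n * M) ≤ Ex p n (fun N => zz ν (N a)) / (n * p a) - zz ν n / (n * M) := by
    have : R * p a / M * zz ν n / (n * p a) ≤ Ex p n (fun N => zz ν (N a)) / (n * p a) := by gcongr
    have e : R * p a / M * zz ν n / (n * p a) = R * zz ν n / (n * M) := by field_simp
    rw [e] at this
    have e2 : (R - 1) * zz ν n / (n * M) = R * zz ν n / (n * M) - zz ν n / (n * M) := by ring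
    linarith
  have h0 : 0 ≤ (R - 1) * zz ν n / (n * M) := by
    have : 0 ≤ R - 1 := by linarith
    positivity
  calc _ = M * (n * p a) * ((R - 1) * zz ν n / (n * M)) ^ 2 := by field_simp
    _ ≤ _ := by gcongr

lemma p_lt_one (a : Fin A) : p a < 1 := by
  have := D.hA
  have hp0 := D.hp0
  rw [← D.hp]
  obtain ⟨b, hb⟩ : ∃ b, b ≠ a := by
    have : Nontrivial (Fin A) := Fin.nontrivial_iff_two_le.2 this
    exact exists_ne a
  exact Finset.single_lt_sum hb (Finset.mem_univ _) (Finset.mem_univ _) (hp0 b) (fun c _ _ => (hp0 c).le)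

lemma v_case2 {n : ℕ} (hn : 2 ≤ n) (a : Fin A) (g : ℕ → ℝ) {c : ℝ} (hc : 0 ≤ c) 
    (ih : ∀ k < n, c * g k ≤ v k) (h : g n ≤ M * Ex p n (fun N => g (N a))) : c * g n ≤ v n := by
  by_contra hcon
  push Not at hcon
  have hM := D.hM0
  have h1 := Ex_top_le D.hp0' D.hp n a (fun k => c * g k - v k) 0 le_rfl (fun k hk => by linarith [ih k hk]) (by linarith)
  rw [Ex_sub, Ex_mul, zero_add] at h1
  have h2 : M * Ex p n (fun N => v (N a)) ≤ v n := by
    refine le_trans (mul_le_mul_of_nonneg_left ?_ hM.le) (D.v_rec_ge hn)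
    exact Finset.single_le_sum (f := fun a => Ex p n (fun N => v (N a))) (fun b _ => Ex_nonneg D.hp0' fun N _ => D.v_nonneg _) (Finset.mem_univ a)
  have h3 : M * p a ^ n < 1 := by
    refine lt_of_le_of_lt (mul_le_mul_of_nonneg_left ?_ hM.le) D.hq
    calc p a ^ n ≤ p a ^ 2 := pow_le_pow_of_le_one (D.hp0' a) (D.p_lt_one a).le hn
      _ ≤ _ := Finset.single_le_sum (f := fun a => p a ^ 2) (fun b _ => sq_nonneg _) (Finset.mem_univ a)
  have h4 := mul_le_mul_of_nonneg_left h1 hM.le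
  have h5 := mul_le_mul_of_nonneg_left h hc
  have h6 : (c * g n - v n) * (1 - M * p a ^ n) ≤ 0 := by nlinarith
  have h7 : 0 < (c * g n - v n) * (1 - M * p a ^ n) := mul_pos (by linarith) (by linarith)
  linarith

end Dat
end A9

open Filter Topology

section A10
variable {A : ℕ} {p : Fin A → ℝ} {M : ℝ}

lemma pow_gap {q θ : ℝ} (hq : 0 < q) (hθ : 1 < θ) (K : ℕ) :
    ∃ n0 : ℕ, ∀ n ≥ n0, 0 ≤ ((n : ℝ) * q) ^ θ - n * q ∧
      (((n : ℝ) * q) ^ θ) ^ (K + 1) / 2 ≤ (((n : ℝ) * q) ^ θ - n * q) ^ (K + 1) := by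
  have t1 : Tendsto (fun n : ℕ => (n : ℝ) * q) atTop atTop := tendsto_natCast_atTop_atTop.atTop_mul_const hq
  have t2 : Tendsto (fun n : ℕ => ((n : ℝ) * q) ^ (-(θ - 1))) atTop (𝓝 0) :=
    (tendsto_rpow_neg_atTop (by linarith : 0 < θ - 1)).comp t1
  have t3 : Tendsto (fun n : ℕ => (1 - ((n : ℝ) * q) ^ (-(θ - 1))) ^ (K + 1)) atTop (𝓝 1) := by
    simpa using ((tendsto_const_nhds (x := (1 : ℝ))).sub t2).pow (K + 1)
  have ev := (t3.eventually_const_lt (by norm_num : (1 / 2 : ℝ) < 1)).and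
    ((t2.eventually_lt_const (by norm_num : (0 : ℝ) < 1)).and (t1.eventually_gt_atTop 0))
  obtain ⟨n0, h⟩ := eventually_atTop.1 ev
  refine ⟨n0, fun n hn => ?_⟩
  obtain ⟨h1, h2, h3⟩ := h n hn
  have e : ((n : ℝ) * q) ^ θ - n * q = ((n : ℝ) * q) ^ θ * (1 - ((n : ℝ) * q) ^ (-(θ - 1))) := by
    rw [mul_sub, ← Real.rpow_add h3, mul_one]
    congr 1
    conv_lhs => rw [← Real.rpow_one ((n : ℝ) * q)]
    congr 1; ring
  have h4 : 0 < ((n : ℝ) * q) ^ θ := Real.rpow_pos_of_pos h3 _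
  rw [e]
  refine ⟨mul_nonneg h4.le (by linarith), ?_⟩
  rw [mul_pow]
  calc _ = (((n : ℝ) * q) ^ θ) ^ (K + 1) * (1 / 2) := by ring
    _ ≤ _ := by gcongr

namespace Dat
variable {ν v : ℕ → ℝ} (D : Dat p M ν v)
include D

lemma chain {s : ℝ} (a : Fin A) (hR : 1 < M * p a ^ s) : ∃ K : ℕ, 1 ≤ K ∧
    ∀ s', 0 < s' → s' ≤ s → 1 < M * ∑ b, p b ^ (1 + s') → ∃ c : ℝ, 0 < c ∧ ∀ n : ℕ, 2 ≤ n → 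
      c * ((n : ℝ) ^ (1 + (2 + K) * s' + K) / zz ν n ^ K) ≤ v n := by
  have hM := D.hM0
  have hpa := D.hp0 a
  have hpa1 := D.p_lt_one a
  set R := √(M * p a ^ s) with hRd
  have hR1 : 1 < R := by rw [hRd, Real.lt_sqrt (by norm_num)]; simpa using hR
  have hR0 : 0 < R := by linarith
  have hR2 : M * p a ^ s = R * R := by rw [hRd, Real.mul_self_sqrt (by linarith)]
  have hB0 : 0 < M * p a ^ (1 + 2 * s) := by positivity
  obtain ⟨K, hK⟩ : ∃ K : ℕ, 1 ≤ K ∧ 2 ≤ M * p a ^ (1 + 2 * s) * R ^ K := by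
    obtain ⟨K0, hK0⟩ := pow_unbounded_of_one_lt (2 / (M * p a ^ (1 + 2 * s))) hR1
    refine ⟨K0 + 1, by omega, ?_⟩
    have : R ^ K0 ≤ R ^ (K0 + 1) := pow_le_pow_right₀ hR1.le (by omega)
    rw [div_lt_iff₀ hB0] at hK0
    nlinarith
  obtain ⟨hK1, hK2⟩ := hK
  refine ⟨K, hK1, fun s' hs' hs's hlow => ?_⟩
  obtain ⟨cz, hcz, hzl⟩ := D.zz_low (by linarith : 0 < 1 + s') hlow
  obtain ⟨cv, hcv, hvl⟩ := D.v_low (by linarith : 0 < 1 + s') hlow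
  have hvpos : ∀ k, 2 ≤ k → 0 < v k := fun k hk => lt_of_lt_of_le (by
    have : (0 : ℝ) < k := by exact_mod_cast (by omega : 0 < k)
    positivity) (hvl k hk)
  have hzpos : ∀ k, 2 ≤ k → 0 < zz ν k := fun k hk => lt_of_lt_of_le (by
    have : (0 : ℝ) < k := by exact_mod_cast (by omega : 0 < k)
    positivity) (hzl k hk)
  set γ : ℝ := 1 + (2 + K) * s' + K with hγ
  set θ : ℝ := γ / (K + 1) with hθd
  have hK0 : (0 : ℝ) < (K : ℝ) + 1 := by positivity
  have hθγ : θ * ((K + 1 : ℕ) : ℝ) = γ := by rw [hθd]; push_cast; field_simp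
  have hθ : 1 < θ := by
    rw [hθd, lt_div_iff₀ hK0, hγ]
    have : 0 < (2 + (K : ℝ)) * s' := by positivity
    linarith
  set g : ℕ → ℝ := fun n => (n : ℝ) ^ γ / zz ν n ^ K with hg
  have hg0 : ∀ k, 0 ≤ g k := fun k => by
    have := D.zz_nonneg k
    rw [hg]; positivity
  have hgsmall : ∀ k, k ≤ 1 → g k = 0 := by
    intro k hk
    have : zz ν k = 0 := by
      interval_cases k
      · exact zz0
      · exact D.zz1
    simp only [hg, this, zero_pow (by omega : K ≠ 0), div_zero]
  obtain ⟨n0, hn0⟩ := pow_gap hpa hθ K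
  obtain ⟨c0, hc0, hc0'⟩ := fin_c v g hvpos hg0 (max n0 3)
  have hRm : 0 < R - 1 := by linarith
  set c1 := cz ^ (K + 2) * (p a * (R - 1) ^ 2 / M) with hc1
  have hc1' : 0 < c1 := by positivity
  have hc : 0 < min c0 c1 := lt_min hc0 hc1'
  refine ⟨min c0 c1, hc, fun n _ => ?_⟩
  show min c0 c1 * g n ≤ v n
  induction n using Nat.strong_induction_on with
  | _ n ih =>
  by_cases h1 : n ≤ 1
  · rw [hgsmall n h1, D.v_small h1, mul_zero]
  have hn2 : 2 ≤ n := by omega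
  by_cases h2 : n < max n0 3
  · exact (mul_le_mul_of_nonneg_right (min_le_left _ _) (hg0 n)).trans (hc0' n hn2 h2)
  push Not at h2
  have hn3 : 3 ≤ n := (le_max_right _ _).trans h2
  have hnn0 : n0 ≤ n := (le_max_left _ _).trans h2
  have hn' : (0 : ℝ) < n := by exact_mod_cast (by omega : 0 < n)
  have hz := hzpos n hn2
  by_cases h3 : R * p a / M * zz ν n ≤ Ex p n (fun N => zz ν (N a))
  · refine le_trans ?_ (D.v_case1 hn3 a hR1 h3)
    refine (mul_le_mul_of_nonneg_right (min_le_right _ _) (hg0 n)).trans ?_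
    have e1 : cz ^ (K + 2) * ((n : ℝ) ^ γ * n) ≤ zz ν n ^ (K + 2) := by
      calc _ = (cz * (n : ℝ) ^ (1 + s')) ^ (K + 2) := by
            rw [mul_pow, ← Real.rpow_natCast ((n : ℝ) ^ (1 + s')), ← Real.rpow_mul hn'.le]
            nth_rewrite 2 [← Real.rpow_one (n : ℝ)]
            rw [← Real.rpow_add hn']
            congr 2; rw [hγ]; push_cast; ring
        _ ≤ _ := by gcongr; exact hzl n hn2
    have e2 : cz ^ (K + 2) * g n ≤ zz ν n ^ 2 / n := by
      rw [hg, le_div_iff₀ hn', ← mul_div_assoc, div_mul_eq_mul_div, div_le_iff₀ (by positivity), ← pow_add]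
      rw [add_comm 2 K]; linarith
    calc _ = (p a * (R - 1) ^ 2 / M) * (cz ^ (K + 2) * g n) := by rw [hc1]; ring
      _ ≤ _ := by gcongr
  push Not at h3
  refine D.v_case2 hn2 a g hc.le (fun k hk => ?_) ?_
  · by_cases hk2 : k ≤ 1
    · rw [hgsmall k hk2, D.v_small hk2, mul_zero]
    · exact ih k hk (by omega)
  obtain ⟨hX0, hX⟩ := hn0 n hnn0
  have hE := Ex_persp D.hp0' n a K (fun k => (k : ℝ) ^ θ - k) (zz ν) g D.zz_nonneg hg0 (fun k => ?_) hX0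
    (by positivity : 0 < R * p a / M * zz ν n) ?_ h3.le
  · refine le_trans ?_ (mul_le_mul_of_nonneg_left hE hM.le)
    have e1 : (((n : ℝ) * p a) ^ θ) ^ (K + 1) = (n : ℝ) ^ γ * p a ^ γ := by
      rw [← Real.rpow_natCast, ← Real.rpow_mul (by positivity), hθγ, Real.mul_rpow hn'.le hpa.le]
    rw [e1] at hX
    refine le_trans ?_ (mul_le_mul_of_nonneg_left (div_le_div_of_nonneg_right hX (by positivity)) hM.le)
    have e2 : p a ^ (1 + 2 * s) * (p a ^ s) ^ K * p a ^ K ≤ p a ^ γ := by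
      rw [← Real.rpow_natCast (p a ^ s), ← Real.rpow_mul hpa.le, ← Real.rpow_natCast (p a), ← Real.rpow_add hpa, ← Real.rpow_add hpa]
      refine Real.rpow_le_rpow_of_exponent_ge hpa hpa1.le ?_
      rw [hγ]
      have : (2 + (K : ℝ)) * s' ≤ (2 + K) * s := by gcongr
      linarith
    have e3 : 2 * (R * p a / M) ^ K ≤ M * p a ^ γ := by
      calc 2 * (R * p a / M) ^ K ≤ (M * p a ^ (1 + 2 * s) * R ^ K) * (R * p a / M) ^ K := by gcongr
        _ = M * p a ^ (1 + 2 * s) * ((R * R) ^ K * p a ^ K / M ^ K) := by rw [div_pow, mul_pow, mul_pow]; ring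
        _ = M * (p a ^ (1 + 2 * s) * (p a ^ s) ^ K * p a ^ K) := by rw [← hR2, mul_pow]; field_simp
        _ ≤ _ := by gcongr
    have hρ : 0 < (R * p a / M) ^ K := by positivity
    rw [mul_pow]
    show (n : ℝ) ^ γ / zz ν n ^ K ≤ _
    have hz' : 0 < zz ν n ^ K := by positivity
    have hnγ : 0 < (n : ℝ) ^ γ := by positivity
    generalize (R * p a / M) ^ K = ρ at *
    generalize zz ν n ^ K = Z at *
    generalize (n : ℝ) ^ γ = Y at *
    generalize p a ^ γ = w at *
    rw [← mul_div_assoc, div_le_div_iff₀ hz' (by positivity)]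
    have : Y * Z * (2 * ρ) ≤ Y * Z * (M * w) := by gcongr
    linarith
  · by_cases hk : k ≤ 1
    · left
      interval_cases k
      · simp [Real.zero_rpow (by linarith : θ ≠ 0)]
      · simp
    · right
      have hk1 : (1 : ℝ) < k := by exact_mod_cast (by omega : 1 < k)
      have hk0 : (0 : ℝ) < k := by linarith
      have hx : 0 < (k : ℝ) ^ θ - k := by
        have := Real.rpow_lt_rpow_of_exponent_lt hk1 hθ
        rw [Real.rpow_one] at this; linarith
      have hzk := hzpos k (by omega)
      refine ⟨hx, hzk, ?_⟩
      rw [hg]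
      refine div_le_div_of_nonneg_right ?_ (by positivity)
      calc _ ≤ ((k : ℝ) ^ θ) ^ (K + 1) := by gcongr; linarith
        _ = _ := by rw [← Real.rpow_natCast, ← Real.rpow_mul hk0.le, hθγ]
  · rw [Ex_sub, Ex_mean n a D.hp]
    have := Ex_rpow_le D.hp0' D.hp n (fun N => (N a : ℝ)) (fun N => by positivity) hθ.le
    rw [Ex_mean n a D.hp] at this
    linarith

end Dat
end A10

open Filter Topology

section A11
variable {A : ℕ} {p : Fin A → ℝ} {M : ℝ} {ν v : ℕ → ℝ}

/-- the final output of the analytic part -/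
def Outp (p : Fin A → ℝ) (m : ℕ) (ν v : ℕ → ℝ) : Prop :=
  ∃ C c τ β : ℝ, 0 < C ∧ 0 < c ∧ τ < 3 * β / 2 ∧ (∀ n : ℕ, 2 ≤ n → c * (n : ℝ) ^ β ≤ v n) ∧
    ∀ (t : ℝ) (φ : ℕ → ℂ), φ 0 = 1 → φ 1 = 1 → (∀ n, ‖φ n‖ ≤ 1) →
      (∀ n, 2 ≤ n → φ n = (Ex p n (fun N => ei (t * (GG ν N - Ex p n (GG ν))) * ∏ a, φ (N a))) ^ m) →
      ∀ n, ‖φ n - ((Real.exp (-(t ^ 2 * v n / 2)) : ℝ) : ℂ)‖ ≤ C * |t| ^ 3 * (n : ℝ) ^ τ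

namespace Dat
variable (D : Dat p M ν v)
include D

lemma pack {σ α η τ β c : ℝ} (X : Xp p M ν v σ α η) (m : ℕ) (hm : (m : ℝ) = M) (hτ0 : 0 < τ)
    (hτ : M * ∑ a, p a ^ τ < 1) (h1 : σ + 2 * α ≤ τ) (h2 : 3 * α - 1 / 2 ≤ τ) (h3 : α + η - 1 / 2 ≤ τ)
    (h4 : 3 * (η - 1 / 2) / 2 ≤ τ) (hc : 0 < c) (hβ : τ < 3 * β / 2) (hl : ∀ n : ℕ, 2 ≤ n → c * (n : ℝ) ^ β ≤ v n) :
    Outp p m ν v := by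
  obtain ⟨C, hC, H⟩ := X.master m hm D.v_nonneg hτ0 hτ h1 h2 h3 h4
  exact ⟨C, c, τ, β, hC, hc, hβ, hl, H⟩

lemma hx_gen {σ : ℝ} (hσ : 0 < σ) (h : M * ∑ a, p a ^ (1 + σ) < 1) :
    ∃ C, 0 < C ∧ ∀ n : ℕ, 1 ≤ n → ∀ a b, |du ν (mm p n a) - du ν (mm p n b)| ≤ C * (n : ℝ) ^ ((σ + 1 / 2) - 1 / 2) := by
  obtain ⟨C, hC, H⟩ := D.u_bound hσ h
  refine ⟨2 * C * 2 ^ σ, by positivity, fun n hn a b => ?_⟩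
  have hn' : (1 : ℝ) ≤ n := by exact_mod_cast hn
  have key : ∀ a, |du ν (mm p n a)| ≤ C * 2 ^ σ * (n : ℝ) ^ σ := by
    intro a
    refine (H _).trans ?_
    have h1 : (mm p n a : ℝ) ≤ n := by exact_mod_cast mm_le D.hp0 D.hp n a
    rw [mul_assoc, ← Real.mul_rpow (by norm_num) (by positivity)]
    gcongr
    linarith
  rw [add_sub_cancel_right]
  calc _ ≤ |du ν (mm p n a)| + |du ν (mm p n b)| := abs_sub _ _
    _ ≤ _ := add_le_add (key a) (key b)
    _ = _ := by ring

theorem out (m : ℕ) (hm : (m : ℝ) = M) : Outp p m ν v := by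
  have hM := D.hM0
  obtain ⟨s, hs0, hs1, hs⟩ := pw_root D.hp0 D.hA D.hp D.hM D.hq
  have up : ∀ x, 1 + s < x → M * ∑ a, p a ^ x < 1 := fun x hx => by
    rw [← hs]; exact mul_lt_mul_of_pos_left (pw_lt D.hp0 D.hA D.hp hx) hM
  have lo : ∀ x, x < 1 + s → 1 < M * ∑ a, p a ^ x := fun x hx => by
    rw [← hs]; exact mul_lt_mul_of_pos_left (pw_lt D.hp0 D.hA D.hp hx) hM
  have Xgen : ∀ σ, s < σ → σ < 1 → Xp p M ν v σ (σ + 1 / 2) (2 * σ + 1) := fun σ h1 h2 =>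
    { D := D, hσ := by linarith, hσ1 := h2, h := up _ (by linarith), hα := by linarith, hα' := le_rfl,
      hx := D.hx_gen (by linarith) (up _ (by linarith)), hη1 := by linarith, hη := by linarith, hη' := up _ (by linarith) }
  rcases hs0.eq_or_lt with h0 | h0
  · obtain ⟨c, hc, hl⟩ := D.v_low (β := 9 / 10) (by norm_num) (lo _ (by linarith))
    exact D.pack (Xgen (1 / 18) (by linarith) (by norm_num)) (τ := 7 / 6) (β := 9 / 10) (c := c) m hm (by norm_num)
      (up _ (by linarith)) (by norm_num) (by norm_num) (by norm_num) (by norm_num) hc (by norm_num) hl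
  by_cases hu : ∀ a b, p a = p b
  · obtain ⟨c, hc, hl⟩ := D.v_low (β := 1 + s - (1 - s) / 8) (by linarith) (lo _ (by linarith))
    have X : Xp p M ν v (s + (1 - s) / 8) (s + (1 - s) / 8) (1 + 3 * (s + (1 - s) / 8) / 2) :=
      { D := D, hσ := by linarith, hσ1 := by linarith, h := up _ (by linarith), hα := le_rfl, hα' := by linarith,
        hx := ⟨1, one_pos, fun n hn a b => by
          have : mm p n a = mm p n b := by unfold mm; rw [hu a b]
          rw [this, sub_self, abs_zero]; positivity⟩
        hη1 := by linarith, hη := by linarith, hη' := up _ (by linarith) }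
    exact D.pack X (τ := 1 + 2 * (s + (1 - s) / 8)) m hm (by linarith) (up _ (by linarith)) (by linarith) (by linarith)
      (by linarith) (by linarith) hc (by linarith) hl
  obtain ⟨a, ha⟩ : ∃ a, 1 < M * p a ^ s := by
    by_contra hcon
    push Not at hcon
    have e : ∑ a, p a * (M * p a ^ s) = ∑ a, p a := by
      rw [D.hp, ← hs, Finset.mul_sum]
      refine Finset.sum_congr rfl fun a _ => ?_
      rw [Real.rpow_add (D.hp0 a), Real.rpow_one]; ring
    have h1 := (Finset.sum_eq_sum_iff_of_le (fun a _ => mul_le_of_le_one_right (D.hp0' a) (hcon a))).1 e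
    have h2 : ∀ a, M * p a ^ s = 1 := fun a => by
      have := h1 a (Finset.mem_univ _)
      have hpa := D.hp0 a
      exact mul_left_cancel₀ hpa.ne' (by linarith)
    refine hu fun a b => ?_
    have h3 : p a ^ s = p b ^ s := mul_left_cancel₀ hM.ne' ((h2 a).trans (h2 b).symm)
    exact (Real.rpow_left_inj (D.hp0' a) (D.hp0' b) h0.ne').1 h3
  obtain ⟨K, hK1, H⟩ := D.chain a ha
  obtain ⟨δ, hδ0, hδ1, hδ2, hδ3⟩ : ∃ δ : ℝ, 0 < δ ∧ δ < s ∧ δ < 1 - s ∧ δ * (6 * (K + 3)) ≤ 1 := by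
    refine ⟨min (s / 2) (min ((1 - s) / 2) (1 / (6 * (K + 3)))), ?_, ?_, ?_, ?_⟩
    · refine lt_min (by linarith) (lt_min (by linarith) (by positivity))
    · exact lt_of_le_of_lt (min_le_left _ _) (by linarith)
    · exact lt_of_le_of_lt ((min_le_right _ _).trans (min_le_left _ _)) (by linarith)
    · rw [← le_div_iff₀ (by positivity)]
      exact (min_le_right _ _).trans (min_le_right _ _)
  obtain ⟨c, hc, hl⟩ := H (s - δ) (by linarith) (by linarith) (lo _ (by linarith))
  obtain ⟨C, hC, hz⟩ := D.zz_up (σ := s + δ) (by linarith) (up _ (by linarith))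
  obtain ⟨cz, hcz, hzl⟩ := D.zz_low (β := 1) (by linarith) (lo _ (by linarith))
  refine D.pack (Xgen (s + δ) (by linarith) (by linarith)) (τ := 1 + 3 * (s + δ)) (β := 1 + 2 * s - (2 + 2 * K) * δ)
    (c := c / C ^ K) m hm (by linarith) (up _ (by linarith)) (by linarith) (by linarith) (by linarith) (by linarith)
    (by positivity) (by nlinarith) (fun n hn => le_trans ?_ (hl n hn))
  have hn' : (0 : ℝ) < n := by exact_mod_cast (by omega : 0 < n)
  have hzpos : 0 < zz ν n := lt_of_lt_of_le (by positivity) (hzl n hn)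
  have h1 : zz ν n ^ K ≤ (C * (n : ℝ) ^ (1 + (s + δ))) ^ K := by gcongr; exact hz n (by omega)
  calc _ = c * ((n : ℝ) ^ (1 + (2 + (K : ℝ)) * (s - δ) + K) / (C * (n : ℝ) ^ (1 + (s + δ))) ^ K) := by
        rw [mul_pow, ← Real.rpow_natCast ((n : ℝ) ^ (1 + (s + δ))), ← Real.rpow_mul hn'.le, div_mul_eq_mul_div, mul_div_assoc,
          mul_comm (C ^ K), ← div_div, ← Real.rpow_sub hn']
        congr 3; ring
    _ ≤ _ := by gcongr

end Dat
end A11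

open MeasureTheory ProbabilityTheory Filter Topology

section A12
variable {A M : ℕ} {p : Fin A → ℝ}

lemma size_law (P : Measure (Fin A)) [IsProbabilityMeasure P] (hp0 : ∀ a, 0 ≤ p a) (hp : ∑ a, p a = 1)
    (hq : M * ∑ a, p a ^ 2 < 1) (hP : ∀ a, P {a} = ENNReal.ofReal (p a)) (n : ℕ) :
    AEMeasurable (fun Ls : Fin n → List (Fin M) → Fin A => gtrieSize Ls) 
      (Measure.pi (fun _ : Fin n => Measure.infinitePi (fun _ : List (Fin M) => P))) ∧
    (Measure.pi (fun _ : Fin n => Measure.infinitePi (fun _ : List (Fin M) => P))).map (fun Ls => gtrieSize Ls) = lawG M P n := by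
  obtain ⟨hfin, hL⟩ := lim_facts P hp0 hp hq hP n
  have hm : AEMeasurable (fun ω => ((gSet ω).ncard : ℝ)) (flatP P M n) :=
    hL.aestronglyMeasurable.aemeasurable
  have hfl : Measurable (fun (Ls : Fin n → List (Fin M) → Fin A) (q : Fin n × Fin M × List (Fin M)) => Ls q.1 (q.2.1 :: q.2.2)) := by
    fun_prop
  have e : (fun Ls : Fin n → List (Fin M) → Fin A => gtrieSize Ls) = (fun ω => ((gSet ω).ncard : ℝ)) ∘
      (fun (Ls : Fin n → List (Fin M) → Fin A) (q : Fin n × Fin M × List (Fin M)) => Ls q.1 (q.2.1 :: q.2.2)) := by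
    funext Ls; exact gtrieSize_eq Ls
  rw [← flat_law P] at hm
  refine ⟨by rw [e]; exact hm.comp_measurable hfl, ?_⟩
  rw [e, ← AEMeasurable.map_map_of_aemeasurable hm hfl.aemeasurable, flat_law]
  rfl

lemma law_dat (P : Measure (Fin A)) [IsProbabilityMeasure P] (hp0 : ∀ a, 0 < p a) (hp : ∑ a, p a = 1) (hA : 2 ≤ A) (hM : 1 ≤ M)
    (hq : M * ∑ a, p a ^ 2 < 1) (hP : ∀ a, P {a} = ENNReal.ofReal (p a)) :
    Dat p M (fun n => ∫ x, x ∂(lawG M P n)) (fun n => variance id (lawG M P n)) where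
  hp0 := hp0
  hp := hp
  hA := hA
  hM := by exact_mod_cast hM
  hq := hq
  ν0 := by rw [lawG_small P 0 (by norm_num)]; simp
  ν1 := by rw [lawG_small P 1 (by norm_num)]; simp
  v0 := by rw [lawG_small P 0 (by norm_num)]; simp [variance_dirac]
  v1 := by rw [lawG_small P 1 (by norm_num)]; simp [variance_dirac]
  νr := fun n hn => (lawG_rec P (fun a => (hp0 a).le) hp hq hP n hn).1
  vr := fun n hn => (lawG_rec P (fun a => (hp0 a).le) hp hq hP n hn).2.1

/-- the centered characteristic function -/
noncomputable def phiC (M : ℕ) (P : Measure (Fin A)) [IsProbabilityMeasure P] (t : ℝ) (n : ℕ) : ℂ :=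
  ei (-(t * ∫ x, x ∂(lawG M P n))) * charFun (lawG M P n) t

lemma ei_sum {ι : Type} (s : Finset ι) (f : ι → ℝ) : ei (∑ i ∈ s, f i) = ∏ i ∈ s, ei (f i) := by
  unfold ei
  rw [← Complex.exp_sum, ← Finset.sum_mul]; push_cast; rfl

lemma ei_pow (x : ℝ) (m : ℕ) : ei x ^ m = ei (m * x) := by
  unfold ei
  rw [← Complex.exp_nat_mul]; push_cast; ring_nf

lemma phiC_rec (P : Measure (Fin A)) [IsProbabilityMeasure P] (hp0 : ∀ a, 0 ≤ p a) (hp : ∑ a, p a = 1)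
    (hq : M * ∑ a, p a ^ 2 < 1) (hP : ∀ a, P {a} = ENNReal.ofReal (p a)) (t : ℝ) (n : ℕ) (hn : 2 ≤ n) :
    phiC M P t n = (Ex p n (fun N => ei (t * (GG (fun n => ∫ x, x ∂(lawG M P n)) N - 
      Ex p n (GG (fun n => ∫ x, x ∂(lawG M P n))))) * ∏ a, phiC M P t (N a))) ^ M := by
  obtain ⟨h1, _, h3⟩ := lawG_rec P hp0 hp hq hP n hn
  have e : (fun N : Fin A → ℕ => ei (t * (GG (fun n => ∫ x, x ∂(lawG M P n)) N - 
      Ex p n (GG (fun n => ∫ x, x ∂(lawG M P n))))) * ∏ a, phiC M P t (N a)) = 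
      fun N : Fin A → ℕ => ei (-(t * Ex p n (GG (fun n => ∫ x, x ∂(lawG M P n))))) * ∏ a, charFun (lawG M P (N a)) t := by
    funext N
    unfold phiC
    rw [Finset.prod_mul_distrib, ← ei_sum, ← mul_assoc, ← ei_add]
    congr 2
    unfold GG
    rw [Finset.sum_neg_distrib, ← Finset.mul_sum]; ring
  rw [e, Ex_cmul, mul_pow, ei_pow]
  unfold phiC
  rw [h3 t, ← mul_assoc, h1]
  congr 1
  change _ * ei t = _
  rw [← ei_add]
  congr 1
  change _ = _ * -(t * Ex p n (fun N => ∑ a, ∫ x, x ∂(lawG M P (N a))))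
  ring

lemma charFun_std (ρ : Measure ℝ) (m s t : ℝ) :
    charFun (ρ.map (fun x => (x - m) / s)) t = ei (-(t / s * m)) * charFun ρ (t / s) := by
  rw [charFun_apply_real, charFun_apply_real, integral_map (by fun_prop) (by fun_prop), ← integral_const_mul]
  congr 1; funext x
  unfold ei
  rw [← Complex.exp_add]
  congr 1; push_cast; ring

theorem law_clt (P : Measure (Fin A)) [IsProbabilityMeasure P] (hp0 : ∀ a, 0 < p a) (hp : ∑ a, p a = 1) (hA : 2 ≤ A) (hM : 1 ≤ M)
    (hq : M * ∑ a, p a ^ 2 < 1) (hP : ∀ a, P {a} = ENNReal.ofReal (p a)) :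
    (∀ n, 2 ≤ n → 0 < variance id (lawG M P n)) ∧ ∀ f : BoundedContinuousFunction ℝ ℝ,
      Tendsto (fun n => ∫ x, f ((x - ∫ y, y ∂(lawG M P n)) / √(variance id (lawG M P n))) ∂(lawG M P n)) atTop
        (𝓝 (∫ x, f x ∂(gaussianReal 0 1))) := by
  have D := law_dat P hp0 hp hA hM hq hP
  obtain ⟨C, c, τ, β, hC, hc, hβ, hl, H⟩ := D.out M rfl
  have hpos : ∀ n, 2 ≤ n → 0 < variance id (lawG M P n) := fun n hn => lt_of_lt_of_le (by
    have : (0 : ℝ) < n := by exact_mod_cast (by omega : 0 < n)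
    positivity) (hl n hn)
  refine ⟨hpos, ?_⟩
  have hpr : ∀ n, IsProbabilityMeasure (lawG M P n) := fun n => (lawG_facts P D.hp0' hp hq hP n).1
  have hφ0 : ∀ t n, n ≤ 1 → phiC M P t n = 1 := by
    intro t n hn
    unfold phiC
    rw [lawG_small P n hn]
    simp [charFun_dirac, ei]
  have hφ : ∀ t n, ‖phiC M P t n - ((Real.exp (-(t ^ 2 * variance id (lawG M P n) / 2)) : ℝ) : ℂ)‖ ≤ C * |t| ^ 3 * (n : ℝ) ^ τ := by
    intro t
    refine H t (phiC M P t) (hφ0 t 0 (by norm_num)) (hφ0 t 1 le_rfl) (fun n => ?_) (fun n hn => phiC_rec P D.hp0' hp hq hP t n hn)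
    unfold phiC
    rw [norm_mul, ei_norm, one_mul]
    exact norm_charFun_le_one t
  set v : ℕ → ℝ := fun n => variance id (lawG M P n) with hv
  set m : ℕ → ℝ := fun n => ∫ y, y ∂(lawG M P n) with hm
  have hmeas : ∀ n, Measurable (fun x : ℝ => (x - m n) / √(v n)) := fun n => by fun_prop
  have hpr2 : ∀ n, IsProbabilityMeasure ((lawG M P n).map (fun x => (x - m n) / √(v n))) := fun n =>
    Measure.isProbabilityMeasure_map (hmeas n).aemeasurable
  have key : ∀ t : ℝ, Tendsto (fun n => charFun ((lawG M P n).map (fun x => (x - m n) / √(v n))) t) atTop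
      (𝓝 (charFun (gaussianReal 0 1) t)) := by
    intro t
    rw [tendsto_iff_norm_sub_tendsto_zero]
    have lim0 : Tendsto (fun n : ℕ => C * |t| ^ 3 / c ^ (3 / 2 : ℝ) * (n : ℝ) ^ (-(3 * β / 2 - τ))) atTop (𝓝 0) := by
      have := ((tendsto_rpow_neg_atTop (by linarith : 0 < 3 * β / 2 - τ)).comp tendsto_natCast_atTop_atTop).const_mul
        (C * |t| ^ 3 / c ^ (3 / 2 : ℝ))
      rw [mul_zero] at this
      exact this
    refine squeeze_zero' (Eventually.of_forall fun n => norm_nonneg _) ?_ lim0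
    filter_upwards [eventually_ge_atTop 2] with n hn
    have hvn : 0 < v n := hpos n hn
    have hn' : (0 : ℝ) < n := by exact_mod_cast (by omega : 0 < n)
    rw [charFun_std, charFun_gaussianReal]
    have h1 := hφ (t / √(v n)) n
    have e1 : (t / √(v n)) ^ 2 * variance id (lawG M P n) / 2 = t ^ 2 / 2 := by
      change (t / √(v n)) ^ 2 * v n / 2 = t ^ 2 / 2
      rw [div_pow, Real.sq_sqrt hvn.le]; field_simp
    rw [e1] at h1
    have e2 : Complex.exp (t * (0 : ℝ) * Complex.I - ((1 : NNReal) : ℝ) * t ^ 2 / 2) = ((Real.exp (-(t ^ 2 / 2)) : ℝ) : ℂ) := by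
      push_cast; congr 1; simp
    rw [e2]
    refine h1.trans ?_
    have e3 : |t / √(v n)| ^ 3 ≤ |t| ^ 3 / (c ^ (3 / 2 : ℝ) * (n : ℝ) ^ (3 * β / 2)) := by
      rw [abs_div, div_pow, abs_of_nonneg (Real.sqrt_nonneg _)]
      refine div_le_div_of_nonneg_left (by positivity) (by positivity) ?_
      have e4 : √(v n) ^ 3 = v n ^ (3 / 2 : ℝ) := by
        rw [Real.sqrt_eq_rpow, ← Real.rpow_natCast, ← Real.rpow_mul hvn.le]; norm_num
      rw [e4]
      calc _ = (c * (n : ℝ) ^ β) ^ (3 / 2 : ℝ) := by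
            rw [Real.mul_rpow hc.le (by positivity), ← Real.rpow_mul hn'.le]; congr 2; ring
        _ ≤ _ := by gcongr; exact hl n hn
    calc _ ≤ C * (|t| ^ 3 / (c ^ (3 / 2 : ℝ) * (n : ℝ) ^ (3 * β / 2))) * (n : ℝ) ^ τ := by gcongr
      _ = _ := by
        rw [neg_sub, Real.rpow_sub hn']; field_simp
  have conv := ProbabilityMeasure.tendsto_of_tendsto_charFun
    (μ := fun n => (⟨_, hpr2 n⟩ : ProbabilityMeasure ℝ)) (μ₀ := ⟨gaussianReal 0 1, inferInstance⟩) key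
  intro f
  have h2 := (ProbabilityMeasure.tendsto_iff_forall_integral_tendsto.1 conv) f
  refine h2.congr fun n => ?_
  change ∫ x, f x ∂((lawG M P n).map (fun x => (x - m n) / √(v n))) = _
  rw [integral_map (hmeas n).aemeasurable f.continuous.aestronglyMeasurable]

end A12

/-- **Central limit theorem for the size of G-tries** (Theorem 1).
`S n` is the size of the G-trie built from `n` i.i.d. random labelings of the infinite
rooted `M`-ary tree (the `n` labelings are modeled by the product measure `μ n` of `n`
copies of the labeling measure `μL`).  The variance of `S n` is eventually strictly
positive, and `(S n - E(S n)) / sqrt(Var(S n))` converges in distribution (tested against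
bounded continuous functions) to the standard normal distribution `N(0,1)`. -/
theorem gtrie_size_clt
    {M A : ℕ} (hM : 1 ≤ M) (hA : 2 ≤ A)
    (p : Fin A → ℝ) (hp0 : ∀ j, 0 < p j) (hp1 : ∀ j, p j < 1)
    (hpsum : ∑ j, p j = 1)
    (hnonexp : ∑ j, (p j) ^ 2 < 1 / (M : ℝ))
    (μL : Measure (List (Fin M) → Fin A)) [IsProbabilityMeasure μL]
    (hμL : IsLabelingMeasure p μL)
    (μ : (n : ℕ) → Measure (Fin n → List (Fin M) → Fin A))
    (hμ : ∀ n, μ n = Measure.pi fun _ => μL)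
    (E V : ℕ → ℝ)
    (hE : ∀ n, E n = ∫ Ls, gtrieSize Ls ∂(μ n))
    (hV : ∀ n, V n = variance (fun Ls => gtrieSize Ls) (μ n)) :
    (∃ N : ℕ, ∀ n ≥ N, 0 < V n) ∧
    ∀ f : BoundedContinuousFunction ℝ ℝ,
      Tendsto (fun n => ∫ Ls, f ((gtrieSize Ls - E n) / Real.sqrt (V n)) ∂(μ n)) atTop
        (𝓝 (∫ x, f x ∂(gaussianReal 0 1))) := by
  have hp0' : ∀ a, 0 ≤ p a := fun a => (hp0 a).le
  haveI := letterP_prob hp0' hpsum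
  have hP := letterP_apply p
  have hMr : (0 : ℝ) < M := by exact_mod_cast hM
  have hq : M * ∑ a, p a ^ 2 < 1 := by
    rw [lt_div_iff₀ hMr] at hnonexp; linarith
  have hμ' : ∀ n, μ n = Measure.pi (fun _ : Fin n => Measure.infinitePi (fun _ : List (Fin M) => letterP p)) := by
    intro n; rw [hμ n, ← labeling_eq hμL (letterP p) hP]
  have hs := size_law (M := M) (letterP p) hp0' hpsum hq hP
  simp_rw [← hμ'] at hs
  obtain ⟨hpos, hclt⟩ := law_clt (M := M) (letterP p) hp0 hpsum hA hM hq hP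
  have hE' : ∀ n, E n = ∫ x, x ∂(lawG M (letterP p) n) := by
    intro n
    rw [hE n, ← (hs n).2, integral_map (hs n).1 (by fun_prop)]
  have hV' : ∀ n, V n = variance id (lawG M (letterP p) n) := by
    intro n
    rw [hV n, ← (hs n).2, variance_map (by fun_prop) (hs n).1]
    rfl
  refine ⟨⟨2, fun n hn => by rw [hV' n]; exact hpos n hn⟩, fun f => ?_⟩
  refine (hclt f).congr fun n => ?_
  rw [← hE', ← hV', ← (hs n).2, integral_map (hs n).1 (by fun_prop)]
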